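/- There exist constants 0 < c_1 ≤ c_2 and T_0 such that for all T ≥ T_0, c_1 · T (log T)^{1/4} ≤ I_+(T) ≤ c_2 · T (log T)^{1/4}, i.e. I_+(T) is of exact order T (log T)^{1/4}. -/

import Mathlib

open MeasureTheory

/-- The phase factor `e^{iθ(t)} = π^{-it/2} Γ(1/4+it/2)/|Γ(1/4+it/2)|`. -/
noncomputable def eTheta (t : ℝ) : ℂ :=
  (Real.pi : ℂ) ^ (-(Complex.I * (t : ℂ)) / 2) *
    (Complex.Gamma (1 / 4 + Complex.I * (t : ℂ) / 2) /
      ‖Complex.Gamma (1 / 4 + Complex.I * (t : ℂ) / 2)‖)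

/-- Hardy's function `Z(t) = e^{iθ(t)} ζ(1/2+it)` (a real number for real `t`). -/
noncomputable def HardyZ (t : ℝ) : ℝ :=
  (eTheta t * riemannZeta (1 / 2 + Complex.I * (t : ℂ))).re

/-- `I₊(T) = ∫_{t ∈ (T,2T], Z(t)>0} Z(t) dt`. -/
noncomputable def Iplus (T : ℝ) : ℝ :=
  ∫ t in {t : ℝ | t ∈ Set.Ioc T (2 * T) ∧ 0 < HardyZ t}, HardyZ t

/-- An integral of holomorphic functions, dominated near `z₀`, is holomorphic at `z₀`. -/
lemma differentiableAt_integral_of_dominated {α : Type*} [MeasurableSpace α] {μ : Measure α}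
    {F : ℂ → α → ℂ} {z₀ : ℂ} {R : ℝ} {bound : α → ℝ} (hR : 0 < R)
    (hmeas : ∀ z ∈ Metric.ball z₀ R, AEStronglyMeasurable (F z) μ)
    (hbound : ∀ᵐ a ∂μ, ∀ z ∈ Metric.ball z₀ R, ‖F z a‖ ≤ bound a) (h_int : Integrable bound μ)
    (hdiff : ∀ᵐ a ∂μ, DifferentiableOn ℂ (fun z => F z a) (Metric.ball z₀ R)) :
    DifferentiableAt ℂ (fun z => ∫ a, F z a ∂μ) z₀ := by
  have hz₀ : z₀ ∈ Metric.ball z₀ R := Metric.mem_ball_self hR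
  have hnhds : Metric.ball z₀ (R / 2) ∈ nhds z₀ := Metric.ball_mem_nhds _ (by positivity)
  have hderiv : ∀ᵐ a ∂μ, ∀ x ∈ Metric.ball z₀ (R / 2),
      HasDerivAt (fun z => F z a) (deriv (fun z => F z a) x) x := by
    filter_upwards [hdiff] with a ha x hx
    exact (ha.differentiableAt (Metric.isOpen_ball.mem_nhds
      (Metric.ball_subset_ball (by linarith) hx))).hasDerivAt
  refine (hasDerivAt_integral_of_dominated_loc_of_deriv_le (bound := fun a => bound a / (R / 2))
    (F' := fun z a => deriv (fun z => F z a) z) hnhds ?_ ?_ ?_ ?_ (h_int.div_const _)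
    hderiv).2.differentiableAt
  · filter_upwards [Metric.ball_mem_nhds z₀ hR] with z hz using hmeas z hz
  · exact h_int.mono' (hmeas _ hz₀) (by filter_upwards [hbound] with a ha using ha _ hz₀)
  · have hseq : Filter.Tendsto (fun n : ℕ => ((R / 2 / (n + 1) : ℝ) : ℂ)) Filter.atTop
        (nhdsWithin 0 {0}ᶜ) := by
      rw [tendsto_nhdsWithin_iff]
      constructor
      · have h1 : Filter.Tendsto (fun n : ℕ => (R / 2 / (n + 1) : ℝ)) Filter.atTop (nhds 0) := by
          have := (tendsto_one_div_add_atTop_nhds_zero_nat (𝕜 := ℝ)).const_mul (R / 2)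
          simpa [div_eq_mul_inv] using this
        exact_mod_cast (Complex.continuous_ofReal.tendsto 0).comp h1
      · refine Filter.Eventually.of_forall fun n => ?_
        have : (R / 2 / (n + 1) : ℝ) ≠ 0 := by positivity
        simpa only [Set.mem_compl_iff, Set.mem_singleton_iff, Complex.ofReal_eq_zero] using this
    refine aestronglyMeasurable_of_tendsto_ae Filter.atTop
      (f := fun n : ℕ => fun a => ((R / 2 / (n + 1) : ℝ) : ℂ)⁻¹ •
        (F (z₀ + ((R / 2 / (n + 1) : ℝ) : ℂ)) a - F z₀ a)) ?_ ?_
    · intro n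
      refine AEStronglyMeasurable.const_smul (𝕜 := ℂ) ((hmeas _ ?_).sub (hmeas _ hz₀)) _
      have h1 : R / 2 / ((n : ℝ) + 1) ≤ R / 2 :=
        div_le_self (by positivity) (by linarith [n.cast_nonneg (α := ℝ)])
      have h0 : 0 ≤ R / 2 / ((n : ℝ) + 1) := by positivity
      rw [Metric.mem_ball, dist_eq_norm, add_sub_cancel_left, Complex.norm_real,
        Real.norm_of_nonneg h0]
      linarith
    · filter_upwards [hderiv] with a ha
      exact ((hasDerivAt_iff_tendsto_slope_zero.1
        (ha z₀ (Metric.mem_ball_self (by positivity)))).comp hseq)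
  · filter_upwards [hdiff, hbound] with a ha hb x hx
    refine Complex.norm_deriv_le_of_forall_mem_sphere_norm_le (by positivity) ?_ ?_
    · refine (ha.mono ?_).diffContOnCl_ball (U := Metric.ball z₀ R) ?_
      · exact subset_rfl
      · intro y hy
        rw [Metric.mem_closedBall] at hy
        rw [Metric.mem_ball] at hx ⊢
        linarith [dist_triangle y x z₀]
    · intro z hz
      refine hb z ?_
      rw [Metric.mem_sphere] at hz
      rw [Metric.mem_ball] at hx ⊢
      linarith [dist_triangle z x z₀]

/-- Holomorphic in the right half-plane, with quadratic decay in closed vertical strips. -/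
def StripDecay (f : ℂ → ℂ) : Prop :=
  DifferentiableOn ℂ f {s | 0 < s.re} ∧
    ∀ a b : ℝ, 0 < a → ∃ C, ∀ s : ℂ, a ≤ s.re → s.re ≤ b → ‖f s‖ ≤ C * (1 + s.im ^ 2)⁻¹

/-- The `L¹` norm on the vertical line of abscissa `σ`. -/
noncomputable def lineNorm (f : ℂ → ℂ) (σ : ℝ) : ℝ := ∫ t : ℝ, ‖f (σ + t * Complex.I)‖

lemma lineNorm_nonneg (f : ℂ → ℂ) (σ : ℝ) : 0 ≤ lineNorm f σ :=
  integral_nonneg fun _ => norm_nonneg _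

namespace StripDecay

variable {f g : ℂ → ℂ}

lemma continuous_line (hf : StripDecay f) {z : ℂ} (hz : 0 < z.re) :
    Continuous fun t : ℝ => f (z + t * Complex.I) := by
  refine hf.1.continuousOn.comp_continuous (by fun_prop) fun t => ?_
  simpa using hz

lemma integrable_line (hf : StripDecay f) {σ : ℝ} (hσ : 0 < σ) :
    Integrable fun t : ℝ => f (σ + t * Complex.I) := by
  obtain ⟨C, hC⟩ := hf.2 σ σ hσ
  refine (integrable_inv_one_add_sq.const_mul C).mono'
    (hf.continuous_line (z := σ) (by simpa using hσ)).aestronglyMeasurable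
    (Filter.Eventually.of_forall fun t => ?_)
  simpa using hC (σ + t * Complex.I) (by simp) (by simp)

lemma add (hf : StripDecay f) (hg : StripDecay g) : StripDecay (fun s => f s + g s) := by
  refine ⟨hf.1.add hg.1, fun a b ha => ?_⟩
  obtain ⟨C, hC⟩ := hf.2 a b ha
  obtain ⟨D, hD⟩ := hg.2 a b ha
  refine ⟨C + D, fun s h1 h2 => (norm_add_le _ _).trans ?_⟩
  rw [add_mul]
  exact add_le_add (hC s h1 h2) (hD s h1 h2)

lemma neg (hf : StripDecay f) : StripDecay (fun s => -f s) := by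
  refine ⟨hf.1.neg, fun a b ha => ?_⟩
  obtain ⟨C, hC⟩ := hf.2 a b ha
  exact ⟨C, fun s h1 h2 => by simpa using hC s h1 h2⟩

lemma sub (hf : StripDecay f) (hg : StripDecay g) : StripDecay (fun s => f s - g s) := by
  simpa [sub_eq_add_neg] using hf.add hg.neg

/-- A bound uniform in vertical translations of bounded size. -/
lemma exists_translate_bound (hf : StripDecay f) {a b : ℝ} (ha : 0 < a) (Y : ℝ) :
    ∃ C, 0 ≤ C ∧ ∀ z : ℂ, a ≤ z.re → z.re ≤ b → |z.im| ≤ Y → ∀ t : ℝ,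
      ‖f (z + t * Complex.I)‖ ≤ C * (1 + t ^ 2)⁻¹ := by
  obtain ⟨C, hC⟩ := hf.2 a b ha
  refine ⟨|C| * (2 + 2 * Y ^ 2), by positivity, fun z h1 h2 h3 t => ?_⟩
  have h := hC (z + t * Complex.I) (by simpa using h1) (by simpa using h2)
  simp only [Complex.add_im, Complex.mul_im, Complex.ofReal_re, Complex.I_im, mul_one,
    Complex.ofReal_im, Complex.I_re, mul_zero, add_zero] at h
  refine h.trans ?_
  have hY : z.im ^ 2 ≤ Y ^ 2 := sq_le_sq' (by linarith [neg_abs_le z.im]) (by linarith [le_abs_self z.im])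
  have key : (1 + (z.im + t) ^ 2)⁻¹ ≤ (2 + 2 * Y ^ 2) * (1 + t ^ 2)⁻¹ := by
    rw [← div_eq_mul_inv, inv_eq_one_div, div_le_div_iff₀ (by positivity) (by positivity)]
    nlinarith [sq_nonneg (t + 2 * z.im), mul_nonneg (sq_nonneg Y) (sq_nonneg (z.im + t))]
  calc C * (1 + (z.im + t) ^ 2)⁻¹ ≤ |C| * (1 + (z.im + t) ^ 2)⁻¹ := by
        gcongr; exact le_abs_self C
    _ ≤ |C| * ((2 + 2 * Y ^ 2) * (1 + t ^ 2)⁻¹) := by gcongr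
    _ = _ := by ring

/-- Pairing the vertical translates with a bounded function gives a holomorphic function. -/
lemma differentiableAt_pairing (hf : StripDecay f) {φ : ℝ → ℂ} (hφm : Measurable φ)
    (hφ : ∀ t, ‖φ t‖ ≤ 1) {z : ℂ} (hz : 0 < z.re) :
    DifferentiableAt ℂ (fun z => ∫ t : ℝ, f (z + t * Complex.I) * φ t) z := by
  obtain ⟨C, hC0, hC⟩ := hf.exists_translate_bound (a := z.re / 2) (b := 2 * z.re) (by linarith)
    (|z.im| + z.re)
  have hball : ∀ w ∈ Metric.ball z (z.re / 2), z.re / 2 ≤ w.re ∧ w.re ≤ 2 * z.re ∧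
      |w.im| ≤ |z.im| + z.re := by
    intro w hw
    rw [Metric.mem_ball, dist_eq_norm] at hw
    have h1 := (Complex.abs_re_le_norm (w - z)).trans hw.le
    have h2 := (Complex.abs_im_le_norm (w - z)).trans hw.le
    rw [Complex.sub_re, abs_le] at h1
    rw [Complex.sub_im] at h2
    refine ⟨by linarith, by linarith, ?_⟩
    have := abs_sub_abs_le_abs_sub w.im z.im
    linarith
  refine differentiableAt_integral_of_dominated (R := z.re / 2)
    (bound := fun t => C * (1 + t ^ 2)⁻¹) (by linarith) ?_ ?_ ?_ ?_
  · intro w hw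
    exact (hf.continuous_line (by linarith [(hball w hw).1])).aestronglyMeasurable.mul
      hφm.aestronglyMeasurable
  · refine Filter.Eventually.of_forall fun t w hw => ?_
    obtain ⟨h1, h2, h3⟩ := hball w hw
    rw [norm_mul]
    have := hC w h1 h2 h3 t
    calc ‖f (w + t * Complex.I)‖ * ‖φ t‖ ≤ ‖f (w + t * Complex.I)‖ * 1 := by
          gcongr; exact hφ t
      _ ≤ _ := by simpa using this
  · exact integrable_inv_one_add_sq.const_mul C
  · refine Filter.Eventually.of_forall fun t => DifferentiableOn.mul_const ?_ _
    refine hf.1.comp (by fun_prop) fun w hw => ?_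
    have := (hball w hw).1
    simp only [Set.mem_ofPred_eq, Complex.add_re, Complex.mul_re, Complex.ofReal_re, Complex.I_re,
      mul_zero, Complex.ofReal_im, Complex.I_im, mul_one, sub_self, add_zero]
    linarith

lemma norm_pairing_le (hf : StripDecay f) {φ : ℝ → ℂ} (hφ : ∀ t, ‖φ t‖ ≤ 1) {z : ℂ}
    (hz : 0 < z.re) : ‖∫ t : ℝ, f (z + t * Complex.I) * φ t‖ ≤ lineNorm f z.re := by
  have hshift : ∀ t : ℝ, z + t * Complex.I = z.re + (t + z.im : ℝ) * Complex.I := by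
    intro t
    apply Complex.ext <;> simp [add_comm]
  have h1 : ∫ t : ℝ, ‖f (z + t * Complex.I)‖ = lineNorm f z.re := by
    simp_rw [hshift]
    exact integral_add_right_eq_self (fun t : ℝ => ‖f (z.re + t * Complex.I)‖) z.im
  have h2 : Integrable fun t : ℝ => ‖f (z + t * Complex.I)‖ := by
    simp_rw [hshift]
    exact (hf.integrable_line hz).norm.comp_add_right z.im
  rw [← h1]
  refine norm_integral_le_of_norm_le h2 (Filter.Eventually.of_forall fun t => ?_)
  rw [norm_mul]
  exact mul_le_of_le_one_right (norm_nonneg _) (hφ t)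

/-- Convexity of mean values: the `L¹` norms on vertical lines are logarithmically convex. -/
theorem lineNorm_le_interp (hf : StripDecay f) {a b σ : ℝ} (ha : 0 < a) (hab : a < b)
    (h1 : a ≤ σ) (h2 : σ ≤ b) :
    lineNorm f σ ≤ lineNorm f a ^ (1 - (σ - a) / (b - a)) *
      lineNorm f b ^ ((σ - a) / (b - a)) := by
  have hσ : 0 < σ := ha.trans_le h1
  set φ : ℝ → ℂ := fun t => (starRingEnd ℂ) (f (σ + t * Complex.I)) / ‖f (σ + t * Complex.I)‖
    with hφdef
  have hcont := hf.continuous_line (z := σ) (by simpa using hσ)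
  have hφm : Measurable φ := by
    have h := hcont.measurable
    exact ((Complex.continuous_conj.measurable.comp h)).div
      (Complex.measurable_ofReal.comp h.norm)
  have hφ : ∀ t, ‖φ t‖ ≤ 1 := by
    intro t
    simp only [hφdef, norm_div, RCLike.norm_conj, Complex.norm_real, norm_norm]
    exact div_self_le_one _
  set G : ℂ → ℂ := fun z => ∫ t : ℝ, f (z + t * Complex.I) * φ t with hG
  have hval : G σ = (lineNorm f σ : ℂ) := by
    rw [hG, lineNorm, ← integral_complex_ofReal]
    refine integral_congr_ae (Filter.Eventually.of_forall fun t => ?_)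
    simp only [hφdef]
    rw [← mul_div_assoc, Complex.mul_conj, Complex.normSq_eq_norm_sq]
    by_cases h0 : ‖f (σ + t * Complex.I)‖ = 0
    · simp [h0]
    · have : (‖f (σ + t * Complex.I)‖ : ℂ) ≠ 0 := by exact_mod_cast h0
      push_cast
      field_simp
  have hdiff : ∀ z : ℂ, 0 < z.re → DifferentiableAt ℂ G z := fun z hz =>
    hf.differentiableAt_pairing hφm hφ hz
  have hbd : ∀ z : ℂ, 0 < z.re → ‖G z‖ ≤ lineNorm f z.re := fun z hz =>
    hf.norm_pairing_le hφ hz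
  obtain ⟨C, hC⟩ := hf.2 a b ha
  have key := Complex.HadamardThreeLines.norm_le_interp_of_mem_verticalClosedStrip' (f := G)
    (z := σ) (a := lineNorm f a) (b := lineNorm f b) hab ?_ ?_ ?_ ?_ ?_
  · simpa [hval, abs_of_nonneg (lineNorm_nonneg f σ)] using key
  · exact ⟨by simpa using h1, by simpa using h2⟩
  · refine ⟨fun z hz => (hdiff z ?_).differentiableWithinAt, fun z hz =>
      (hdiff z ?_).continuousAt.continuousWithinAt⟩
    · exact ha.trans hz.1
    · have : z ∈ Complex.re ⁻¹' Set.Icc a b := by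
        refine closure_minimal ?_ (isClosed_Icc.preimage Complex.continuous_re) hz
        exact Set.preimage_mono Set.Ioo_subset_Icc_self
      exact ha.trans_le this.1
  · refine ⟨∫ t : ℝ, C * (1 + t ^ 2)⁻¹, ?_⟩
    rintro _ ⟨z, hz, rfl⟩
    have hz0 : 0 < z.re := ha.trans_le hz.1
    refine (hbd z hz0).trans (integral_mono (hf.integrable_line hz0).norm
      (integrable_inv_one_add_sq.const_mul C) fun t => ?_)
    simpa using hC (z.re + t * Complex.I) (by simpa using hz.1) (by simpa using hz.2)
  · intro z hz
    have hz' : z.re = a := hz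
    simpa [hz'] using hbd z (by rw [hz']; exact ha)
  · intro z hz
    have hz' : z.re = b := hz
    simpa [hz'] using hbd z (by rw [hz']; exact ha.trans hab)

/-- Shifting the line of integration. -/
theorem integral_line_eq (hf : StripDecay f) {a b : ℝ} (ha : 0 < a) (hb : 0 < b) :
    ∫ t : ℝ, f (a + t * Complex.I) = ∫ t : ℝ, f (b + t * Complex.I) := by
  set G : ℂ → ℂ := fun z => ∫ t : ℝ, f (z + t * Complex.I) * 1 with hG
  have hdiff : ∀ z : ℂ, 0 < z.re → DifferentiableAt ℂ G z := fun z hz =>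
    hf.differentiableAt_pairing (φ := fun _ => 1) measurable_const (by simp) hz
  have hinv : ∀ (z : ℂ) (y : ℝ), G (z + y * Complex.I) = G z := by
    intro z y
    have : ∀ t : ℝ, z + y * Complex.I + t * Complex.I = z + (t + y : ℝ) * Complex.I := by
      intro t; push_cast; ring
    simp only [hG, this]
    exact integral_add_right_eq_self (fun t : ℝ => f (z + t * Complex.I) * 1) y
  have hderiv : Set.EqOn (deriv G) 0 {z : ℂ | 0 < z.re} := by
    intro z hz
    have h1 : HasDerivAt (fun y : ℝ => G (z + y * Complex.I)) (deriv G z * Complex.I) 0 := by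
      have h2 : HasDerivAt (fun y : ℂ => z + y * Complex.I) Complex.I ((0 : ℝ) : ℂ) := by
        simpa using ((hasDerivAt_id ((0 : ℝ) : ℂ)).mul_const Complex.I).const_add z
      have h3 : HasDerivAt G (deriv G z) (z + ((0 : ℝ) : ℂ) * Complex.I) := by
        simpa using (hdiff z hz).hasDerivAt
      exact (HasDerivAt.comp (h₂ := G) (h := fun y : ℂ => z + y * Complex.I) ((0 : ℝ) : ℂ)
        h3 h2).comp_ofReal
    simp only [hinv] at h1
    have h4 := h1.unique (hasDerivAt_const (0 : ℝ) (G z))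
    simpa using h4
  have hopen : IsOpen {z : ℂ | 0 < z.re} := isOpen_lt continuous_const Complex.continuous_re
  have hconn : IsPreconnected {z : ℂ | 0 < z.re} :=
    (convex_halfSpace_re_gt 0).isPreconnected
  have := hopen.is_const_of_deriv_eq_zero hconn
    (fun z hz => (hdiff z hz).differentiableWithinAt) hderiv (x := a) (y := b)
    (by simpa using ha) (by simpa using hb)
  simpa [hG] using this

end StripDecay

lemma norm_Gamma_le_Gamma_re {s : ℂ} (hs : 0 < s.re) : ‖Complex.Gamma s‖ ≤ Real.Gamma s.re := by
  rw [Complex.Gamma_eq_integral hs, Real.Gamma_eq_integral hs, Complex.GammaIntegral]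
  refine (norm_integral_le_integral_norm _).trans_eq ?_
  refine setIntegral_congr_fun measurableSet_Ioi fun x hx => ?_
  rw [norm_mul, Complex.norm_cpow_eq_rpow_re_of_pos hx, Complex.norm_real, Real.norm_eq_abs,
    abs_of_pos (Real.exp_pos _)]
  simp

lemma exists_norm_Gamma_le (a b : ℝ) (ha : 0 < a) :
    ∃ C, 0 < C ∧ ∀ s : ℂ, a ≤ s.re → s.re ≤ b → ‖Complex.Gamma s‖ ≤ C := by
  have hc : ContinuousOn Real.Gamma (Set.Icc a b) := fun x hx =>
    (Real.differentiableAt_Gamma fun m => by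
      have := ha.trans_le hx.1
      have h2 : (0 : ℝ) ≤ m := m.cast_nonneg
      linarith).continuousAt.continuousWithinAt
  obtain ⟨C, hC⟩ := isCompact_Icc.exists_bound_of_continuousOn hc
  refine ⟨max C 1, by positivity, fun s h1 h2 => ?_⟩
  refine (norm_Gamma_le_Gamma_re (ha.trans_le h1)).trans ?_
  exact ((le_abs_self _).trans (hC _ ⟨h1, h2⟩)).trans (le_max_left _ _)

lemma norm_Gamma_half_add_sq (y : ℝ) :
    ‖Complex.Gamma (1 / 2 + y * Complex.I)‖ ^ 2 = Real.pi / Real.cosh (Real.pi * y) := by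
  have h := Complex.Gamma_mul_Gamma_one_sub (1 / 2 + y * Complex.I)
  have h1 : (1 : ℂ) - (1 / 2 + y * Complex.I) = (starRingEnd ℂ) (1 / 2 + y * Complex.I) := by
    apply Complex.ext <;> simp <;> norm_num
  have h2 : Complex.sin (Real.pi * (1 / 2 + y * Complex.I)) = Real.cosh (Real.pi * y) := by
    rw [show (Real.pi : ℂ) * (1 / 2 + y * Complex.I) =
      ((Real.pi * y : ℝ) : ℂ) * Complex.I + Real.pi / 2 by push_cast; ring,
      Complex.sin_add_pi_div_two, Complex.cos_mul_I, Complex.ofReal_cosh]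
  rw [h1, Complex.Gamma_conj, Complex.mul_conj, h2, Complex.normSq_eq_norm_sq] at h
  exact_mod_cast h

lemma half_exp_abs_le_cosh (x : ℝ) : Real.exp |x| / 2 ≤ Real.cosh x := by
  rw [← Real.cosh_abs, Real.cosh_eq]
  linarith [Real.exp_pos (-|x|)]

lemma norm_Gamma_half_add_le (y : ℝ) :
    ‖Complex.Gamma (1 / 2 + y * Complex.I)‖ ≤ 3 * Real.exp (-(Real.pi * |y| / 2)) := by
  refine le_of_sq_le_sq ?_ (by positivity)
  rw [norm_Gamma_half_add_sq, mul_pow, ← Real.exp_nat_mul, div_le_iff₀ (Real.cosh_pos _)]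
  have h := half_exp_abs_le_cosh (Real.pi * y)
  rw [abs_mul, abs_of_pos Real.pi_pos] at h
  have h2 : Real.exp (((2 : ℕ) : ℝ) * -(Real.pi * |y| / 2)) * Real.exp (Real.pi * |y|) = 1 := by
    rw [← Real.exp_add]; simp; ring
  have h3 := Real.pi_le_four
  have h4 := Real.exp_pos (((2 : ℕ) : ℝ) * -(Real.pi * |y| / 2))
  have h5 := mul_le_mul_of_nonneg_left h h4.le
  nlinarith

lemma norm_Gamma_three_halves_add_le (y : ℝ) :
    ‖Complex.Gamma (3 / 2 + y * Complex.I)‖ ≤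
      3 * (1 + |y|) * Real.exp (-(Real.pi * |y| / 2)) := by
  have h0 : (1 / 2 + y * Complex.I : ℂ) ≠ 0 := by
    intro h
    have := congrArg Complex.re h
    simp at this
  have h1 : (3 / 2 + y * Complex.I : ℂ) = (1 / 2 + y * Complex.I) + 1 := by ring
  rw [h1, Complex.Gamma_add_one _ h0, norm_mul]
  have h2 : ‖(1 / 2 + y * Complex.I : ℂ)‖ ≤ 1 + |y| := by
    refine (norm_add_le _ _).trans ?_
    rw [norm_mul, Complex.norm_I, Complex.norm_real, mul_one, Real.norm_eq_abs]
    norm_num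
  calc _ ≤ (1 + |y|) * (3 * Real.exp (-(Real.pi * |y| / 2))) := by
        gcongr; exact norm_Gamma_half_add_le y
    _ = _ := by ring

/-- Upper bound of Stirling strength in the strip `1/2 ≤ Re s ≤ 3/2`. -/
lemma exists_norm_Gamma_upper : ∃ C, 0 < C ∧ ∀ x y : ℝ, 1 / 2 ≤ x → x ≤ 3 / 2 → 1 ≤ y →
    ‖Complex.Gamma (x + y * Complex.I)‖ ≤
      C * y ^ (x - 1 / 2) * Real.exp (-(Real.pi * y / 2)) := by
  set C₀ : ℝ := 8 * Real.exp (9 / 4) with hC₀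
  have hC₀pos : 0 < C₀ := by positivity
  refine ⟨C₀, hC₀pos, fun x y hx1 hx2 hy => ?_⟩
  have hy0 : 0 < y := by linarith
  set f : ℂ → ℂ := fun z => Complex.Gamma z * Complex.exp (-(Complex.I * Real.pi / 2) * z -
    Real.log y * (z - 1 / 2) + (z - Complex.I * y) ^ 2) with hf
  have hnorm : ∀ z : ℂ, ‖f z‖ = ‖Complex.Gamma z‖ *
      Real.exp (Real.pi * z.im / 2 - Real.log y * (z.re - 1 / 2) + z.re ^ 2 -
        (z.im - y) ^ 2) := by
    intro z
    rw [hf, norm_mul, Complex.norm_exp]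
    congr 2
    simp [pow_two]
    ring
  have hdiff : ∀ z : ℂ, 0 < z.re → DifferentiableAt ℂ f z := by
    intro z hz
    refine (Complex.differentiableAt_Gamma z fun m h => ?_).mul (by fun_prop)
    rw [h] at hz
    simp at hz
    linarith [m.cast_nonneg (α := ℝ)]
  have hexp : ∀ u : ℝ, 1 + u ^ 2 ≤ Real.exp (u ^ 2) := fun u => by
    linarith [Real.add_one_le_exp (u ^ 2)]
  have key := Complex.HadamardThreeLines.norm_le_interp_of_mem_verticalClosedStrip' (f := f)
    (z := x + y * Complex.I) (l := 1 / 2) (u := 3 / 2) (a := C₀) (b := C₀) (by norm_num)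
    ?_ ?_ ?_ ?_ ?_
  · rw [← Real.rpow_add hC₀pos, sub_add_cancel, Real.rpow_one, hnorm] at key
    simp only [Complex.add_re, Complex.ofReal_re, Complex.mul_re, Complex.I_re, mul_zero,
      Complex.ofReal_im, Complex.I_im, mul_one, sub_self, add_zero, Complex.add_im,
      Complex.mul_im, zero_add] at key
    have e1 : Real.exp (Real.pi * y / 2 - Real.log y * (x - 1 / 2) + x ^ 2 - 0 ^ 2) =
        Real.exp (Real.pi * y / 2) * (y ^ (x - 1 / 2))⁻¹ * Real.exp (x ^ 2) := by
      rw [Real.rpow_def_of_pos hy0, ← Real.exp_neg, ← Real.exp_add, ← Real.exp_add]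
      congr 1; ring
    rw [e1] at key
    have hp : 0 < y ^ (x - 1 / 2) := Real.rpow_pos_of_pos hy0 _
    have e2 : 1 ≤ Real.exp (x ^ 2) := Real.one_le_exp (sq_nonneg x)
    rw [Real.exp_neg]
    have e3 : ‖Complex.Gamma (x + y * Complex.I)‖ *
        (Real.exp (Real.pi * y / 2) * (y ^ (x - 1 / 2))⁻¹) ≤ C₀ := by
      refine le_trans ?_ key
      exact mul_le_mul_of_nonneg_left (le_mul_of_one_le_right (by positivity) e2) (norm_nonneg _)
    rw [← mul_assoc, ← div_eq_mul_inv, div_le_iff₀ hp] at e3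
    rw [← div_eq_mul_inv, le_div_iff₀ (Real.exp_pos _)]
    exact e3
  · refine ⟨?_, ?_⟩ <;> simp <;> linarith
  · refine ⟨fun z hz => (hdiff z ?_).differentiableWithinAt, fun z hz =>
      (hdiff z ?_).continuousAt.continuousWithinAt⟩
    · exact lt_trans (by norm_num) hz.1
    · have : z ∈ Complex.re ⁻¹' Set.Icc (1 / 2) (3 / 2) := by
        refine closure_minimal ?_ (isClosed_Icc.preimage Complex.continuous_re) hz
        exact Set.preimage_mono Set.Ioo_subset_Icc_self
      exact lt_of_lt_of_le (by norm_num) this.1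
  · obtain ⟨D, hD0, hD⟩ := exists_norm_Gamma_le (1 / 2) (3 / 2) (by norm_num)
    refine ⟨D * Real.exp (Real.pi * y / 2 + Real.pi ^ 2 + 9 / 4), ?_⟩
    rintro _ ⟨z, hz, rfl⟩
    have hz1 : 1 / 2 ≤ z.re := hz.1
    have hz2 : z.re ≤ 3 / 2 := hz.2
    simp only [Function.comp_apply, hnorm]
    refine mul_le_mul (hD z hz1 hz2) (Real.exp_le_exp.2 ?_) (Real.exp_pos _).le hD0.le
    have hl : 0 ≤ Real.log y * (z.re - 1 / 2) :=
      mul_nonneg (Real.log_nonneg hy) (by linarith)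
    nlinarith [sq_nonneg (z.im - y - Real.pi / 4), sq_nonneg Real.pi]
  · intro z hz
    have hz' : z.re = 1 / 2 := hz
    have hz2 : z = 1 / 2 + z.im * Complex.I := by
      apply Complex.ext <;> simp [hz']
    rw [hnorm, hz']
    have h1 := norm_Gamma_half_add_le z.im
    rw [← hz2] at h1
    calc _ ≤ 3 * Real.exp (-(Real.pi * |z.im| / 2)) * Real.exp (Real.pi * z.im / 2 -
          Real.log y * (1 / 2 - 1 / 2) + (1 / 2) ^ 2 - (z.im - y) ^ 2) := by gcongr
      _ = 3 * Real.exp (-(Real.pi * |z.im| / 2) + (Real.pi * z.im / 2 -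
          Real.log y * (1 / 2 - 1 / 2) + (1 / 2) ^ 2 - (z.im - y) ^ 2)) := by
          rw [mul_assoc, ← Real.exp_add]
      _ ≤ 8 * Real.exp (9 / 4) := by
          gcongr
          · norm_num
          · nlinarith [le_abs_self z.im, Real.pi_pos, sq_nonneg (z.im - y)]
  · intro z hz
    have hz' : z.re = 3 / 2 := hz
    have hz2 : z = 3 / 2 + z.im * Complex.I := by
      apply Complex.ext <;> simp [hz']
    rw [hnorm, hz']
    have h1 := norm_Gamma_three_halves_add_le z.im
    rw [← hz2] at h1
    have h2 : 1 + |z.im| ≤ y * ((5 / 2) * Real.exp ((z.im - y) ^ 2)) := by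
      have h3 : |z.im| ≤ y + |z.im - y| := by
        have := abs_sub_abs_le_abs_sub z.im y
        rw [abs_of_pos hy0] at this
        linarith
      have h4 := hexp (z.im - y)
      have h5 : |z.im - y| ≤ (1 + (z.im - y) ^ 2) / 2 := by
        rw [← sq_abs]
        nlinarith [sq_nonneg (|z.im - y| - 1)]
      nlinarith [sq_nonneg (z.im - y)]
    calc _ ≤ 3 * (y * ((5 / 2) * Real.exp ((z.im - y) ^ 2))) *
          Real.exp (-(Real.pi * |z.im| / 2)) * Real.exp (Real.pi * z.im / 2 -
          Real.log y * (3 / 2 - 1 / 2) + (3 / 2) ^ 2 - (z.im - y) ^ 2) := by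
            refine mul_le_mul_of_nonneg_right (h1.trans ?_) (Real.exp_pos _).le
            gcongr
      _ = 15 / 2 * (y * Real.exp (-Real.log y)) * Real.exp ((z.im - y) ^ 2 +
          -(Real.pi * |z.im| / 2) + (Real.pi * z.im / 2 + (3 / 2) ^ 2 - (z.im - y) ^ 2)) := by
          rw [show Real.pi * z.im / 2 - Real.log y * (3 / 2 - 1 / 2) + (3 / 2) ^ 2 -
            (z.im - y) ^ 2 = -Real.log y + (Real.pi * z.im / 2 + (3 / 2) ^ 2 - (z.im - y) ^ 2)
            by ring, Real.exp_add, Real.exp_add, Real.exp_add]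
          ring
      _ ≤ 8 * 1 * Real.exp (9 / 4) := by
          have : y * Real.exp (-Real.log y) = 1 := by
            rw [Real.exp_neg, Real.exp_log hy0, mul_inv_cancel₀ hy0.ne']
          rw [this]
          gcongr
          · norm_num
          · nlinarith [le_abs_self z.im, Real.pi_pos]
      _ = _ := by rw [hC₀]; ring

/-- Lower bound of Stirling strength in the strip `1/4 ≤ Re s ≤ 1/2`. -/
lemma exists_norm_Gamma_lower : ∃ c, 0 < c ∧ ∀ x y : ℝ, 1 / 4 ≤ x → x ≤ 1 / 2 → 1 ≤ y →
    c * y ^ (x - 1 / 2) * Real.exp (-(Real.pi * y / 2)) ≤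
      ‖Complex.Gamma (x + y * Complex.I)‖ := by
  obtain ⟨C, hC0, hC⟩ := exists_norm_Gamma_upper
  refine ⟨Real.pi / C, div_pos Real.pi_pos hC0, fun x y hx1 hx2 hy => ?_⟩
  have hy0 : 0 < y := by linarith
  have h := Complex.Gamma_mul_Gamma_one_sub (x + y * Complex.I)
  have h1 : (1 : ℂ) - (x + y * Complex.I) =
      (starRingEnd ℂ) (((1 - x : ℝ) : ℂ) + y * Complex.I) := by
    apply Complex.ext <;> simp
  rw [h1, Complex.Gamma_conj] at h
  have h2 := congrArg norm h
  rw [norm_mul, RCLike.norm_conj, norm_div, Complex.norm_real, Real.norm_of_nonneg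
    Real.pi_pos.le] at h2
  have h3 : ‖Complex.sin (Real.pi * (x + y * Complex.I))‖ ≤ Real.exp (Real.pi * y) := by
    rw [Complex.sin, norm_div, norm_mul, Complex.norm_I, mul_one, Complex.norm_ofNat]
    have h4 := norm_sub_le (Complex.exp (-(Real.pi * (x + y * Complex.I)) * Complex.I))
      (Complex.exp (Real.pi * (x + y * Complex.I) * Complex.I))
    have e1 : ‖Complex.exp (-(Real.pi * (x + y * Complex.I)) * Complex.I)‖ =
        Real.exp (Real.pi * y) := by
      rw [Complex.norm_exp]; congr 1; simp
    have e2 : ‖Complex.exp (Real.pi * (x + y * Complex.I) * Complex.I)‖ =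
        Real.exp (-(Real.pi * y)) := by
      rw [Complex.norm_exp]; congr 1; simp
    have e3 : Real.exp (-(Real.pi * y)) ≤ Real.exp (Real.pi * y) := by
      gcongr; nlinarith [Real.pi_pos]
    rw [e1, e2] at h4
    linarith
  have hs : 0 < ‖Complex.sin (Real.pi * (x + y * Complex.I))‖ := by
    rw [norm_pos_iff]
    intro h0
    rw [h0, div_zero] at h
    have hg : ∀ a : ℝ, 0 < a → Complex.Gamma (a + y * Complex.I) ≠ 0 := fun a ha =>
      Complex.Gamma_ne_zero_of_re_pos (by simpa using ha)
    rcases mul_eq_zero.1 h with h' | h'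
    · exact hg x (by linarith) h'
    · exact hg (1 - x) (by linarith) ((map_eq_zero _).1 h')
  have h5 := hC (1 - x) y (by linarith) (by linarith) hy
  rw [show 1 - x - 1 / 2 = -(x - 1 / 2) by ring, Real.rpow_neg hy0.le] at h5
  have hp : 0 < y ^ (x - 1 / 2) := Real.rpow_pos_of_pos hy0 _
  have h6 : Real.pi / Real.exp (Real.pi * y) ≤ ‖Complex.Gamma (x + y * Complex.I)‖ *
      (C * (y ^ (x - 1 / 2))⁻¹ * Real.exp (-(Real.pi * y / 2))) := by
    calc _ ≤ Real.pi / ‖Complex.sin (Real.pi * (x + y * Complex.I))‖ := by gcongr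
      _ = _ := h2.symm
      _ ≤ _ := by gcongr
  have e1 : Real.exp (Real.pi * y) = Real.exp (Real.pi * y / 2) ^ 2 := by
    rw [← Real.exp_nat_mul]; congr 1; push_cast; ring
  rw [e1, Real.exp_neg, div_le_iff₀ (by positivity)] at h6
  rw [Real.exp_neg, ← div_eq_mul_inv, div_le_iff₀ (by positivity), div_mul_eq_mul_div,
    div_le_iff₀ hC0]
  generalize y ^ (x - 1 / 2) = p at h6 hp ⊢
  field_simp at h6
  nlinarith

/-- The factor `s(s-1)π^{-s/2}Γ(s/2)` linking the zeta function to the entire function `ξ`. -/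
noncomputable def xiFactor (s : ℂ) : ℂ := s * (s - 1) * Complex.Gammaℝ s

lemma norm_Gammaℝ (σ t : ℝ) : ‖Complex.Gammaℝ (σ + t * Complex.I)‖ =
    Real.pi ^ (-σ / 2) * ‖Complex.Gamma ((σ / 2 : ℝ) + (t / 2 : ℝ) * Complex.I)‖ := by
  rw [Complex.Gammaℝ_def, norm_mul, Complex.norm_cpow_eq_rpow_re_of_pos Real.pi_pos]
  congr 2
  · simp
  · congr 1; push_cast; ring

lemma norm_xiFactor (σ t : ℝ) : ‖xiFactor (σ + t * Complex.I)‖ =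
    ‖(σ + t * Complex.I : ℂ)‖ * ‖(σ + t * Complex.I - 1 : ℂ)‖ * (Real.pi ^ (-σ / 2) *
      ‖Complex.Gamma ((σ / 2 : ℝ) + (t / 2 : ℝ) * Complex.I)‖) := by
  rw [xiFactor, norm_mul, norm_mul, norm_Gammaℝ]

lemma differentiableAt_xiFactor {s : ℂ} (hs : 0 < s.re) : DifferentiableAt ℂ xiFactor s := by
  refine DifferentiableAt.mul (by fun_prop) ?_
  simp only [funext Complex.Gammaℝ_def]
  refine DifferentiableAt.mul ?_ ?_
  · exact (by fun_prop : DifferentiableAt ℂ (fun s : ℂ => -s / 2) s).const_cpow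
      (Or.inl (by exact_mod_cast Real.pi_ne_zero))
  · refine DifferentiableAt.comp s (Complex.differentiableAt_Gamma _ fun m h => ?_) (by fun_prop)
    have := congrArg Complex.re h
    simp at this
    linarith [m.cast_nonneg (α := ℝ)]

lemma pi_rpow_le_one {σ : ℝ} (hσ : 0 ≤ σ) : Real.pi ^ (-σ / 2) ≤ 1 :=
  Real.rpow_le_one_of_one_le_of_nonpos (by linarith [Real.pi_gt_three]) (by linarith)

lemma exists_norm_xiFactor_half_le : ∃ C, 0 < C ∧ ∀ t : ℝ,
    ‖xiFactor ((1 / 2 : ℝ) + t * Complex.I)‖ * Real.exp (Real.pi / 4 * t) ≤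
      C * (1 + |t|) ^ (7 / 4 : ℝ) := by
  obtain ⟨C, hC0, hC⟩ := exists_norm_Gamma_upper
  obtain ⟨D, hD0, hD⟩ := exists_norm_Gamma_le (1 / 4) (1 / 4) (by norm_num)
  have hconj : ∀ t : ℝ, ‖Complex.Gamma (1 / 4 + t * Complex.I)‖ =
      ‖Complex.Gamma (1 / 4 + |t| * Complex.I)‖ := by
    intro t
    rcases abs_choice t with h | h <;> rw [h]
    rw [← RCLike.norm_conj (Complex.Gamma (1 / 4 + t * Complex.I)), ← Complex.Gamma_conj]
    congr 2
    apply Complex.ext <;> simp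
  have hbig : ∀ y : ℝ, 1 ≤ y → ‖Complex.Gamma (1 / 4 + y * Complex.I)‖ ≤
      C * y ^ (-(1 / 4) : ℝ) * Real.exp (-(Real.pi * y / 2)) := by
    intro y hy
    have hy0 : 0 < y := by linarith
    have h0 : (1 / 4 + y * Complex.I : ℂ) ≠ 0 := by
      intro h
      have := congrArg Complex.re h
      simp at this
    have h1 := hC (5 / 4) y (by norm_num) (by norm_num) hy
    rw [show (((5 / 4 : ℝ) : ℂ) + y * Complex.I : ℂ) = (1 / 4 + y * Complex.I) + 1 by
      push_cast; ring, Complex.Gamma_add_one _ h0, norm_mul] at h1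
    have h2 : y ≤ ‖(1 / 4 + y * Complex.I : ℂ)‖ := by
      have := Complex.abs_im_le_norm (1 / 4 + y * Complex.I : ℂ)
      simp [abs_of_pos hy0] at this
      simpa using this
    have h3 : y * ‖Complex.Gamma (1 / 4 + y * Complex.I)‖ ≤
        C * y ^ (5 / 4 - 1 / 2 : ℝ) * Real.exp (-(Real.pi * y / 2)) :=
      (mul_le_mul_of_nonneg_right h2 (norm_nonneg _)).trans h1
    rw [show (5 / 4 - 1 / 2 : ℝ) = -(1 / 4) + 1 by norm_num, Real.rpow_add_one hy0.ne'] at h3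
    nlinarith
  have hG : ∀ t : ℝ, ‖Complex.Gamma (1 / 4 + (t / 2 : ℝ) * Complex.I)‖ *
      Real.exp (Real.pi / 4 * t) ≤ (4 * C + 4 * D * Real.exp (Real.pi)) *
        (1 + |t|) ^ (-(1 / 4) : ℝ) := by
    intro t
    rw [hconj]
    have ht1 : 0 < 1 + |t| := by positivity
    have habs : |t / 2| = |t| / 2 := by rw [abs_div]; norm_num
    rcases le_total 1 |t / 2| with h | h
    · have h1 := hbig _ h
      have h2 : Real.exp (-(Real.pi * |t / 2| / 2)) * Real.exp (Real.pi / 4 * t) ≤ 1 := by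
        rw [← Real.exp_add, Real.exp_le_one_iff, habs]
        nlinarith [le_abs_self t, Real.pi_pos]
      have h3 : |t / 2| ^ (-(1 / 4) : ℝ) ≤ 4 * (1 + |t|) ^ (-(1 / 4) : ℝ) := by
        have : |t / 2| ^ (-(1 / 4) : ℝ) ≤ ((1 + |t|) / 4) ^ (-(1 / 4) : ℝ) := by
          refine Real.rpow_le_rpow_of_nonpos (by positivity) ?_ (by norm_num)
          rw [habs] at h ⊢
          linarith
        refine this.trans ?_
        rw [Real.div_rpow ht1.le (by norm_num), div_eq_mul_inv, mul_comm,
          ← Real.rpow_neg (by norm_num), neg_neg]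
        gcongr
        exact (Real.rpow_le_rpow_of_exponent_le (by norm_num) (by norm_num : (1 / 4 : ℝ) ≤ 1)).trans_eq
          (Real.rpow_one 4)
      calc _ ≤ C * |t / 2| ^ (-(1 / 4) : ℝ) * Real.exp (-(Real.pi * |t / 2| / 2)) *
            Real.exp (Real.pi / 4 * t) := by gcongr
        _ = C * |t / 2| ^ (-(1 / 4) : ℝ) * (Real.exp (-(Real.pi * |t / 2| / 2)) *
            Real.exp (Real.pi / 4 * t)) := by ring
        _ ≤ C * (4 * (1 + |t|) ^ (-(1 / 4) : ℝ)) * 1 := by gcongr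
        _ ≤ _ := by
          have : 0 ≤ D * Real.exp Real.pi * (1 + |t|) ^ (-(1 / 4) : ℝ) := by positivity
          nlinarith
    · have h1 := hD (1 / 4 + |t / 2| * Complex.I) (by simp) (by simp)
      have ht2 : |t| ≤ 2 := by rw [habs] at h; linarith
      have h2 : Real.exp (Real.pi / 4 * t) ≤ Real.exp Real.pi := by
        gcongr
        nlinarith [le_abs_self t, Real.pi_pos]
      have h3 : 1 ≤ 4 * (1 + |t|) ^ (-(1 / 4) : ℝ) := by
        have : (4 : ℝ)⁻¹ ≤ (1 + |t|) ^ (-(1 / 4) : ℝ) := by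
          calc (4 : ℝ)⁻¹ = 4 ^ (-1 : ℝ) := (Real.rpow_neg_one 4).symm
            _ ≤ 4 ^ (-(1 / 4) : ℝ) := Real.rpow_le_rpow_of_exponent_le (by norm_num) (by norm_num)
            _ ≤ _ := Real.rpow_le_rpow_of_nonpos ht1 (by linarith) (by norm_num)
        linarith
      calc _ ≤ D * Real.exp Real.pi * 1 := by rw [mul_one]; gcongr
        _ ≤ D * Real.exp Real.pi * (4 * (1 + |t|) ^ (-(1 / 4) : ℝ)) := by gcongr
        _ ≤ _ := by
          have : 0 ≤ C * (1 + |t|) ^ (-(1 / 4) : ℝ) := by positivity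
          nlinarith
  refine ⟨4 * C + 4 * D * Real.exp Real.pi, by positivity, fun t => ?_⟩
  rw [norm_xiFactor]
  have ht1 : 0 < 1 + |t| := by positivity
  have h1 : ‖(((1 / 2 : ℝ) : ℂ) + t * Complex.I : ℂ)‖ ≤ 1 + |t| := by
    refine (norm_add_le _ _).trans ?_
    rw [norm_mul, Complex.norm_I, Complex.norm_real, Complex.norm_real, mul_one, Real.norm_eq_abs,
      Real.norm_eq_abs]
    norm_num
  have h2 : ‖(((1 / 2 : ℝ) : ℂ) + t * Complex.I - 1 : ℂ)‖ ≤ 1 + |t| := by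
    rw [show (((1 / 2 : ℝ) : ℂ) + t * Complex.I - 1 : ℂ) = ((-1 / 2 : ℝ) : ℂ) + t * Complex.I by
      push_cast; ring]
    refine (norm_add_le _ _).trans ?_
    rw [norm_mul, Complex.norm_I, Complex.norm_real, Complex.norm_real, mul_one, Real.norm_eq_abs,
      Real.norm_eq_abs]
    norm_num
  have h3 := hG t
  have h4 : (((1 / 2 / 2 : ℝ) : ℂ)) = 1 / 4 := by push_cast; norm_num
  rw [h4]
  calc _ = (‖(((1 / 2 : ℝ) : ℂ) + t * Complex.I : ℂ)‖ *
        ‖(((1 / 2 : ℝ) : ℂ) + t * Complex.I - 1 : ℂ)‖) * (Real.pi ^ (-(1 / 2 : ℝ) / 2) *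
        (‖Complex.Gamma (1 / 4 + (t / 2 : ℝ) * Complex.I)‖ * Real.exp (Real.pi / 4 * t))) := by ring
    _ ≤ ((1 + |t|) * (1 + |t|)) * (1 * ((4 * C + 4 * D * Real.exp (Real.pi)) *
        (1 + |t|) ^ (-(1 / 4) : ℝ))) := by
        gcongr
        exact pi_rpow_le_one (by norm_num)
    _ = (4 * C + 4 * D * Real.exp Real.pi) * ((1 + |t|) ^ (-(1 / 4) : ℝ) * (1 + |t|) ^ 2) := by ring
    _ = _ := by
        rw [← Real.rpow_natCast (1 + |t|) 2, ← Real.rpow_add ht1]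
        norm_num

lemma norm_xiFactor_three_le (t : ℝ) :
    ‖xiFactor ((3 : ℝ) + t * Complex.I)‖ * Real.exp (Real.pi / 4 * t) ≤ 18 * (1 + |t|) ^ 3 := by
  rw [norm_xiFactor]
  have h1 : ‖(((3 : ℝ) : ℂ) + t * Complex.I : ℂ)‖ ≤ 3 * (1 + |t|) := by
    refine (norm_add_le _ _).trans ?_
    rw [norm_mul, Complex.norm_I, Complex.norm_real, Complex.norm_real, mul_one, Real.norm_eq_abs,
      Real.norm_eq_abs, abs_of_pos (by norm_num : (0 : ℝ) < 3)]
    linarith [abs_nonneg t]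
  have h2 : ‖(((3 : ℝ) : ℂ) + t * Complex.I - 1 : ℂ)‖ ≤ 2 * (1 + |t|) := by
    rw [show (((3 : ℝ) : ℂ) + t * Complex.I - 1 : ℂ) = ((2 : ℝ) : ℂ) + t * Complex.I by
      push_cast; ring]
    refine (norm_add_le _ _).trans ?_
    rw [norm_mul, Complex.norm_I, Complex.norm_real, Complex.norm_real, mul_one, Real.norm_eq_abs,
      Real.norm_eq_abs, abs_of_pos (by norm_num : (0 : ℝ) < 2)]
    linarith [abs_nonneg t]
  have h3 := norm_Gamma_three_halves_add_le (t / 2)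
  have h4 : (((3 / 2 : ℝ) : ℂ)) = 3 / 2 := by push_cast; norm_num
  have habs : |t / 2| = |t| / 2 := by rw [abs_div]; norm_num
  have h5 : Real.exp (-(Real.pi * |t / 2| / 2)) * Real.exp (Real.pi / 4 * t) ≤ 1 := by
    rw [← Real.exp_add, Real.exp_le_one_iff, habs]
    nlinarith [le_abs_self t, Real.pi_pos]
  rw [h4]
  calc _ ≤ (3 * (1 + |t|)) * (2 * (1 + |t|)) * (1 * (3 * (1 + |t / 2|) *
        Real.exp (-(Real.pi * |t / 2| / 2)))) * Real.exp (Real.pi / 4 * t) := by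
        gcongr
        exact pi_rpow_le_one (by norm_num)
    _ = 18 * (1 + |t|) ^ 2 * (1 + |t / 2|) * (Real.exp (-(Real.pi * |t / 2| / 2)) *
        Real.exp (Real.pi / 4 * t)) := by ring
    _ ≤ 18 * (1 + |t|) ^ 2 * (1 + |t|) * 1 := by
        have h6 : 1 + |t / 2| ≤ 1 + |t| := by
          rw [habs]
          linarith [abs_nonneg t]
        exact mul_le_mul (mul_le_mul_of_nonneg_left h6 (by positivity)) h5 (by positivity)
          (by positivity)
    _ = _ := by ring

lemma exists_le_norm_xiFactor : ∃ c, 0 < c ∧ ∀ σ t : ℝ, 1 / 2 ≤ σ → σ ≤ 1 → 2 ≤ t →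
    c * t ^ (7 / 4 : ℝ) ≤
      ‖xiFactor (σ + t * Complex.I)‖ * Real.exp (Real.pi / 4 * t) := by
  obtain ⟨c, hc0, hc⟩ := exists_norm_Gamma_lower
  refine ⟨c * Real.pi ^ (-1 / 2 : ℝ), by positivity, fun σ t h1 h2 ht => ?_⟩
  have ht0 : 0 < t := by linarith
  rw [norm_xiFactor]
  have e1 : t ≤ ‖(σ + t * Complex.I : ℂ)‖ := by
    have := Complex.abs_im_le_norm (σ + t * Complex.I : ℂ)
    simpa [abs_of_pos ht0] using this
  have e2 : t ≤ ‖(σ + t * Complex.I - 1 : ℂ)‖ := by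
    have := Complex.abs_im_le_norm (σ + t * Complex.I - 1 : ℂ)
    simpa [abs_of_pos ht0] using this
  have e3 := hc (σ / 2) (t / 2) (by linarith) (by linarith) (by linarith)
  have e4 : t ^ (-(1 / 4) : ℝ) ≤ (t / 2) ^ (σ / 2 - 1 / 2 : ℝ) := by
    calc t ^ (-(1 / 4) : ℝ) ≤ (t / 2) ^ (-(1 / 4) : ℝ) :=
          Real.rpow_le_rpow_of_nonpos (by positivity) (by linarith) (by norm_num)
      _ ≤ _ := Real.rpow_le_rpow_of_exponent_le (by linarith) (by linarith)
  have e5 : Real.pi ^ (-1 / 2 : ℝ) ≤ Real.pi ^ (-σ / 2 : ℝ) :=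
    Real.rpow_le_rpow_of_exponent_le (by linarith [Real.pi_gt_three]) (by linarith)
  have e6 : Real.exp (-(Real.pi * (t / 2) / 2)) * Real.exp (Real.pi / 4 * t) = 1 := by
    rw [← Real.exp_add, Real.exp_eq_one_iff]; ring
  calc c * Real.pi ^ (-1 / 2 : ℝ) * t ^ (7 / 4 : ℝ) = t * t * (Real.pi ^ (-1 / 2 : ℝ) *
        (c * t ^ (-(1 / 4) : ℝ) * (Real.exp (-(Real.pi * (t / 2) / 2)) *
          Real.exp (Real.pi / 4 * t)))) := by
        rw [e6, show (7 / 4 : ℝ) = -(1 / 4) + 1 + 1 by norm_num, Real.rpow_add_one ht0.ne',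
          Real.rpow_add_one ht0.ne']
        ring
    _ ≤ t * t * (Real.pi ^ (-σ / 2 : ℝ) *
        (c * (t / 2) ^ (σ / 2 - 1 / 2 : ℝ) * (Real.exp (-(Real.pi * (t / 2) / 2)) *
          Real.exp (Real.pi / 4 * t)))) := by gcongr
    _ = t * t * (Real.pi ^ (-σ / 2 : ℝ) *
        (c * (t / 2) ^ (σ / 2 - 1 / 2 : ℝ) * Real.exp (-(Real.pi * (t / 2) / 2)))) *
          Real.exp (Real.pi / 4 * t) := by ring
    _ ≤ _ := by gcongr

lemma exists_norm_mellin_le {f : ℝ → ℂ} {a b : ℝ} (ha : MellinConvergent f a)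
    (hb : MellinConvergent f b) :
    ∃ C, 0 ≤ C ∧ ∀ s : ℂ, a ≤ s.re → s.re ≤ b → ‖mellin f s‖ ≤ C := by
  refine ⟨(∫ t in Set.Ioi (0 : ℝ), ‖(t : ℂ) ^ ((a : ℂ) - 1) • f t‖) +
    ∫ t in Set.Ioi (0 : ℝ), ‖(t : ℂ) ^ ((b : ℂ) - 1) • f t‖, by positivity, fun s h1 h2 => ?_⟩
  rw [← integral_add ha.norm hb.norm, mellin]
  refine norm_integral_le_of_norm_le (ha.norm.add hb.norm) ?_
  refine (ae_restrict_iff' measurableSet_Ioi).2 (Filter.Eventually.of_forall fun t ht => ?_)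
  have ht : 0 < t := ht
  simp only [norm_smul, Complex.norm_cpow_eq_rpow_re_of_pos ht, ← add_mul]
  refine mul_le_mul_of_nonneg_right ?_ (norm_nonneg _)
  simp only [Complex.sub_re, Complex.ofReal_re, Complex.one_re]
  rcases le_total t 1 with h | h
  · have := Real.rpow_le_rpow_of_exponent_ge ht h (by linarith : a - 1 ≤ s.re - 1)
    linarith [Real.rpow_nonneg ht.le (b - 1)]
  · have := Real.rpow_le_rpow_of_exponent_le h (by linarith : s.re - 1 ≤ b - 1)
    linarith [Real.rpow_nonneg ht.le (a - 1)]

lemma exists_norm_completedRiemannZeta₀_le (a b : ℝ) :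
    ∃ C, 0 ≤ C ∧ ∀ s : ℂ, a ≤ s.re → s.re ≤ b → ‖completedRiemannZeta₀ s‖ ≤ C := by
  have hc : ∀ s : ℂ, MellinConvergent (HurwitzZeta.hurwitzEvenFEPair 0).f_modif s := fun s =>
    ((HurwitzZeta.hurwitzEvenFEPair 0).isStrongFEPair_toStrongFEPair.hasMellin s).1
  obtain ⟨C, hC0, hC⟩ := exists_norm_mellin_le (hc (a / 2 : ℝ)) (hc (b / 2 : ℝ))
  refine ⟨C, hC0, fun s h1 h2 => ?_⟩
  have e : completedRiemannZeta₀ s =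
      mellin (HurwitzZeta.hurwitzEvenFEPair 0).f_modif (s / 2) / 2 := rfl
  have h3 : (s / 2).re = s.re / 2 := by simp
  rw [e, norm_div, Complex.norm_two]
  have := hC (s / 2) (by linarith) (by linarith)
  linarith [norm_nonneg (mellin (HurwitzZeta.hurwitzEvenFEPair 0).f_modif (s / 2))]

/-- Riemann's entire function `s(s-1)π^{-s/2}Γ(s/2)ζ(s)`. -/
noncomputable def xiFun (s : ℂ) : ℂ := s * (s - 1) * completedRiemannZeta₀ s + 1

lemma differentiable_xiFun : Differentiable ℂ xiFun :=
  ((differentiable_id.mul (differentiable_id.sub_const 1)).mul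
    differentiable_completedZeta₀).add_const 1

lemma xiFun_eq {s : ℂ} (hs : 0 < s.re) (hs1 : s ≠ 1) :
    xiFun s = xiFactor s * riemannZeta s := by
  have h0 : s ≠ 0 := fun h => by simp [h] at hs
  have h1 : 1 - s ≠ 0 := sub_ne_zero.2 hs1.symm
  rw [riemannZeta_def_of_ne_zero h0, xiFactor, completedRiemannZeta_eq, xiFun]
  have := Complex.Gammaℝ_ne_zero_of_re_pos hs
  field_simp
  ring

lemma exists_norm_xiFun_le (a b : ℝ) :
    ∃ C, 0 ≤ C ∧ ∀ s : ℂ, a ≤ s.re → s.re ≤ b → ‖xiFun s‖ ≤ C * (1 + s.im ^ 2) := by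
  obtain ⟨C, hC0, hC⟩ := exists_norm_completedRiemannZeta₀_le a b
  set M := |a| + |b| + 1 with hM
  refine ⟨2 * M ^ 2 * C + 1 + 2 * C, by positivity, fun s h1 h2 => ?_⟩
  have hre : |s.re| ≤ M - 1 := by
    rw [abs_le]
    constructor
    · have := neg_abs_le a
      linarith [abs_nonneg b]
    · have := le_abs_self b
      linarith [abs_nonneg a]
  have hM1 : 1 ≤ M := by
    have := abs_nonneg a
    have := abs_nonneg b
    linarith
  have hs : ‖s‖ ≤ M + |s.im| := (Complex.norm_le_abs_re_add_abs_im s).trans (by linarith)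
  have hs' : ‖s - 1‖ ≤ M + |s.im| := by
    refine (Complex.norm_le_abs_re_add_abs_im _).trans ?_
    have : |s.re - 1| ≤ |s.re| + 1 := by simpa using abs_sub s.re 1
    simp only [Complex.sub_re, Complex.one_re, Complex.sub_im, Complex.one_im, sub_zero]
    linarith
  have h3 : ‖xiFun s‖ ≤ (M + |s.im|) * (M + |s.im|) * C + 1 := by
    refine (norm_add_le _ _).trans ?_
    rw [norm_mul, norm_mul, norm_one]
    have := hC s h1 h2
    gcongr
  refine h3.trans ?_
  have h4 : (M + |s.im|) * (M + |s.im|) ≤ 2 * M ^ 2 + 2 * s.im ^ 2 := by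
    rw [← sq_abs s.im]
    nlinarith [sq_nonneg (M - |s.im|)]
  have h5 := mul_le_mul_of_nonneg_right h4 hC0
  have h6 : 0 ≤ M ^ 2 * C * s.im ^ 2 := by positivity
  nlinarith [sq_nonneg s.im]

lemma Gammaℝ_conj (s : ℂ) :
    Complex.Gammaℝ ((starRingEnd ℂ) s) = (starRingEnd ℂ) (Complex.Gammaℝ s) := by
  rw [Complex.Gammaℝ_def, Complex.Gammaℝ_def, map_mul]
  have e1 : (starRingEnd ℂ) s / 2 = (starRingEnd ℂ) (s / 2) := by rw [map_div₀, Complex.conj_ofNat]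
  have e2 : -(starRingEnd ℂ) s / 2 = (starRingEnd ℂ) (-s / 2) := by
    rw [map_div₀, Complex.conj_ofNat, map_neg]
  rw [e1, e2, Complex.Gamma_conj, Complex.cpow_conj _ _ (by
    rw [Complex.arg_ofReal_of_nonneg Real.pi_pos.le]; exact Real.pi_pos.ne), Complex.conj_ofReal]

lemma xiFun_conj {s : ℂ} (hs : 0 < s.re) :
    xiFun ((starRingEnd ℂ) s) = (starRingEnd ℂ) (xiFun s) := by
  by_cases h1 : s = 1
  · simp [h1, xiFun]
  rw [xiFun_eq hs h1, xiFun_eq (by simpa using hs) (by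
    intro h
    apply h1
    simpa using congrArg (starRingEnd ℂ) h), xiFactor, xiFactor, Gammaℝ_conj, riemannZeta_conj]
  simp

lemma xiFun_one_sub (s : ℂ) : xiFun (1 - s) = xiFun s := by
  rw [xiFun, xiFun, completedRiemannZeta₀_one_sub]
  ring

lemma norm_xiFun_reflect {σ : ℝ} (h0 : 0 < σ) (t : ℝ) :
    ‖xiFun ((1 - σ : ℝ) + t * Complex.I)‖ = ‖xiFun (σ + t * Complex.I)‖ := by
  have e : (((1 - σ : ℝ) : ℂ) + t * Complex.I) = 1 - (starRingEnd ℂ) (σ + t * Complex.I) := by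
    simp [Complex.conj_ofReal]
    ring
  rw [e, xiFun_one_sub, xiFun_conj (by simpa using h0), Complex.norm_conj]

lemma im_xiFun_half (t : ℝ) : (xiFun ((1 / 2 : ℝ) + t * Complex.I)).im = 0 := by
  rw [← Complex.conj_eq_iff_im, ← xiFun_conj (by simp), ← xiFun_one_sub]
  congr 1
  rw [map_add, map_mul, Complex.conj_ofReal, Complex.conj_ofReal, Complex.conj_I]
  push_cast
  ring

lemma Gammaℝ_half_eq (t : ℝ) : Complex.Gammaℝ ((1 / 2 : ℝ) + t * Complex.I) =
    ‖Complex.Gammaℝ ((1 / 2 : ℝ) + t * Complex.I)‖ * eTheta t := by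
  have h : Complex.Gamma (1 / 4 + Complex.I * (t : ℂ) / 2) ≠ 0 :=
    Complex.Gamma_ne_zero_of_re_pos (by simp)
  have e1 : (((1 / 2 : ℝ) : ℂ) + t * Complex.I) / 2 = 1 / 4 + Complex.I * (t : ℂ) / 2 := by
    push_cast; ring
  have e2 : -(((1 / 2 : ℝ) : ℂ) + t * Complex.I) / 2 =
      ((-1 / 4 : ℝ) : ℂ) + -(Complex.I * (t : ℂ)) / 2 := by
    push_cast; ring
  have hpi : (Real.pi : ℂ) ≠ 0 := by exact_mod_cast Real.pi_ne_zero
  have hn : (‖Complex.Gamma (1 / 4 + Complex.I * (t : ℂ) / 2)‖ : ℂ) ≠ 0 := by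
    exact_mod_cast norm_ne_zero_iff.2 h
  rw [Complex.Gammaℝ_def, e1, e2, Complex.cpow_add _ _ hpi, norm_mul, norm_mul,
    ← Complex.ofReal_cpow Real.pi_pos.le, Complex.norm_real, Real.norm_eq_abs,
    abs_of_pos (Real.rpow_pos_of_pos Real.pi_pos _),
    Complex.norm_cpow_eq_rpow_re_of_pos Real.pi_pos, eTheta]
  have : (-(Complex.I * (t : ℂ)) / 2).re = 0 := by simp
  rw [this, Real.rpow_zero]
  push_cast
  generalize Complex.Gamma (1 / 4 + Complex.I * (t : ℂ) / 2) = g at hn ⊢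
  field_simp

lemma xiFun_half (t : ℝ) : xiFun ((1 / 2 : ℝ) + t * Complex.I) =
    ((-(‖xiFactor ((1 / 2 : ℝ) + t * Complex.I)‖ * HardyZ t) : ℝ) : ℂ) := by
  set s : ℂ := (1 / 2 : ℝ) + t * Complex.I with hs
  have hs1 : s ≠ 1 := fun h => by
    have := congrArg Complex.re h
    norm_num [hs] at this
  have e0 : s * (s - 1) = ((-(1 / 4 + t ^ 2) : ℝ) : ℂ) := by
    rw [hs]; push_cast
    linear_combination (t : ℂ) ^ 2 * Complex.I_sq
  have e1 : xiFun s = ((-(1 / 4 + t ^ 2) * ‖Complex.Gammaℝ s‖ : ℝ) : ℂ) *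
      (eTheta t * riemannZeta s) := by
    rw [xiFun_eq (by simp [hs]) hs1, xiFactor, e0]
    conv_lhs => rw [hs, Gammaℝ_half_eq t, ← hs]
    push_cast
    ring
  have e2 : ‖xiFactor s‖ = (1 / 4 + t ^ 2) * ‖Complex.Gammaℝ s‖ := by
    rw [xiFactor, norm_mul, e0, Complex.norm_real, Real.norm_eq_abs, abs_neg,
      abs_of_pos (by positivity)]
  apply Complex.ext
  · rw [e1, Complex.re_ofReal_mul, Complex.ofReal_re, e2, HardyZ]
    have : s = 1 / 2 + Complex.I * (t : ℂ) := by rw [hs]; push_cast; ring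
    rw [this]; ring
  · rw [hs, im_xiFun_half, Complex.ofReal_im]

/-- The coefficient of `X ^ k` in `(1 - X) ^ (-1/2)`. -/
noncomputable def invSqrtCoeff (k : ℕ) : ℝ := (Nat.centralBinom k : ℝ) / 4 ^ k

lemma invSqrtCoeff_zero : invSqrtCoeff 0 = 1 := by simp [invSqrtCoeff]

lemma invSqrtCoeff_nonneg (k : ℕ) : 0 ≤ invSqrtCoeff k := by unfold invSqrtCoeff; positivity

lemma succ_mul_invSqrtCoeff_succ (k : ℕ) :
    ((k : ℝ) + 1) * invSqrtCoeff (k + 1) = (k + 1 / 2) * invSqrtCoeff k := by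
  have h : ((k : ℝ) + 1) * (Nat.centralBinom (k + 1) : ℝ) =
      2 * (2 * k + 1) * (Nat.centralBinom k : ℝ) := by
    exact_mod_cast Nat.succ_mul_centralBinom_succ k
  unfold invSqrtCoeff
  rw [pow_succ]
  field_simp
  linarith

lemma sum_antidiagonal_invSqrtCoeff (k : ℕ) :
    ∑ x ∈ Finset.HasAntidiagonal.antidiagonal k, invSqrtCoeff x.1 * invSqrtCoeff x.2 = 1 := by
  induction k with
  | zero => simp [invSqrtCoeff_zero]
  | succ k ih =>
    have hk : (0 : ℝ) < (k : ℝ) + 1 := by positivity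
    have swap : ∀ n : ℕ, ∑ x ∈ Finset.HasAntidiagonal.antidiagonal n,
        (x.2 : ℝ) * (invSqrtCoeff x.1 * invSqrtCoeff x.2) =
        ∑ x ∈ Finset.HasAntidiagonal.antidiagonal n,
          (x.1 : ℝ) * (invSqrtCoeff x.1 * invSqrtCoeff x.2) := by
      intro n
      rw [← Finset.Nat.sum_antidiagonal_swap]
      exact Finset.sum_congr rfl fun x _ => by simp only [Prod.fst_swap, Prod.snd_swap]; ring
    have split : ∀ n : ℕ, (n : ℝ) * ∑ x ∈ Finset.HasAntidiagonal.antidiagonal n,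
        invSqrtCoeff x.1 * invSqrtCoeff x.2 =
        2 * ∑ x ∈ Finset.HasAntidiagonal.antidiagonal n,
          (x.1 : ℝ) * (invSqrtCoeff x.1 * invSqrtCoeff x.2) := by
      intro n
      rw [two_mul, Finset.mul_sum]
      nth_rewrite 2 [← swap n]
      rw [← Finset.sum_add_distrib]
      refine Finset.sum_congr rfl fun x hx => ?_
      have : (n : ℝ) = x.1 + x.2 := by
        exact_mod_cast (Finset.HasAntidiagonal.mem_antidiagonal.1 hx).symm
      rw [this]; ring
    have key : ∑ x ∈ Finset.HasAntidiagonal.antidiagonal (k + 1),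
        (x.1 : ℝ) * (invSqrtCoeff x.1 * invSqrtCoeff x.2) =
        ∑ x ∈ Finset.HasAntidiagonal.antidiagonal k, (x.1 : ℝ) * (invSqrtCoeff x.1 * invSqrtCoeff x.2) +
          1 / 2 * ∑ x ∈ Finset.HasAntidiagonal.antidiagonal k, invSqrtCoeff x.1 * invSqrtCoeff x.2 := by
      rw [Finset.Nat.sum_antidiagonal_succ, Finset.mul_sum, ← Finset.sum_add_distrib]
      simp only [Nat.cast_zero, zero_mul, zero_add, Nat.cast_add, Nat.cast_one]
      refine Finset.sum_congr rfl fun x _ => ?_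
      rw [← mul_assoc, succ_mul_invSqrtCoeff_succ]; ring
    have h1 := split (k + 1)
    have h2 := split k
    rw [key] at h1
    rw [ih] at h1 h2
    push_cast at h1
    have h3 : ((k : ℝ) + 1) * (∑ x ∈ Finset.HasAntidiagonal.antidiagonal (k + 1),
        invSqrtCoeff x.1 * invSqrtCoeff x.2) = ((k : ℝ) + 1) * 1 := by linarith
    exact mul_left_cancel₀ hk.ne' h3

lemma invSqrtCoeff_one : invSqrtCoeff 1 = 1 / 2 := by
  norm_num [invSqrtCoeff, Nat.centralBinom]

lemma invSqrtCoeff_le_half {k : ℕ} (hk : 1 ≤ k) : invSqrtCoeff k ≤ 1 / 2 := by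
  induction k, hk using Nat.le_induction with
  | base => rw [invSqrtCoeff_one]
  | succ k hk ih =>
    have h := succ_mul_invSqrtCoeff_succ k
    have : (0 : ℝ) < (k : ℝ) + 1 := by positivity
    nlinarith [invSqrtCoeff_nonneg k]

/-- The Dirichlet series coefficients of the square root of the zeta function. -/
noncomputable def sqrtZeta : ArithmeticFunction ℝ :=
  ⟨fun n => if n = 0 then 0 else n.factorization.prod fun _ k => invSqrtCoeff k, by simp⟩

lemma sqrtZeta_apply {n : ℕ} (hn : n ≠ 0) :
    sqrtZeta n = n.factorization.prod fun _ k => invSqrtCoeff k := by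
  simp [sqrtZeta, hn]

lemma sqrtZeta_prime_pow {p : ℕ} (hp : p.Prime) (k : ℕ) :
    sqrtZeta (p ^ k) = invSqrtCoeff k := by
  rw [sqrtZeta_apply (pow_ne_zero _ hp.ne_zero), hp.factorization_pow,
    Finsupp.prod_single_index invSqrtCoeff_zero]

lemma isMultiplicative_sqrtZeta : sqrtZeta.IsMultiplicative := by
  refine ⟨by simp [sqrtZeta_apply one_ne_zero], fun {m n} h => ?_⟩
  by_cases hm : m = 0
  · simp [hm]
  by_cases hn : n = 0
  · simp [hn]
  rw [sqrtZeta_apply hm, sqrtZeta_apply hn, sqrtZeta_apply (mul_ne_zero hm hn),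
    Nat.factorization_mul_of_coprime h, ← Finsupp.prod_add_index_of_disjoint]
  simpa using h.disjoint_primeFactors

lemma sqrtZeta_nonneg (n : ℕ) : 0 ≤ sqrtZeta n := by
  by_cases hn : n = 0
  · simp [hn]
  rw [sqrtZeta_apply hn]
  exact Finset.prod_nonneg fun p _ => invSqrtCoeff_nonneg _

lemma sqrtZeta_mul_self : sqrtZeta * sqrtZeta = (ArithmeticFunction.zeta : ArithmeticFunction ℝ) := by
  rw [ArithmeticFunction.IsMultiplicative.eq_iff_eq_on_prime_powers _
    (isMultiplicative_sqrtZeta.mul isMultiplicative_sqrtZeta) _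
    ArithmeticFunction.isMultiplicative_zeta.natCast]
  intro p i hp
  rw [ArithmeticFunction.mul_apply, Nat.sum_divisorsAntidiagonal
    (f := fun a b => sqrtZeta a * sqrtZeta b), Nat.sum_divisors_prime_pow hp,
    ArithmeticFunction.natCoe_apply, ArithmeticFunction.zeta_apply_ne (pow_ne_zero _ hp.ne_zero),
    Nat.cast_one, ← sum_antidiagonal_invSqrtCoeff i,
    Finset.Nat.sum_antidiagonal_eq_sum_range_succ (fun a b => invSqrtCoeff a * invSqrtCoeff b)]
  refine Finset.sum_congr rfl fun k hk => ?_
  rw [Nat.pow_div (Nat.lt_succ_iff.1 (Finset.mem_range.1 hk)) hp.pos, sqrtZeta_prime_pow hp,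
    sqrtZeta_prime_pow hp]

lemma sum_divisorsAntidiagonal_sqrtZeta {n : ℕ} (hn : n ≠ 0) :
    ∑ x ∈ n.divisorsAntidiagonal, sqrtZeta x.1 * sqrtZeta x.2 = 1 := by
  rw [← ArithmeticFunction.mul_apply, sqrtZeta_mul_self, ArithmeticFunction.natCoe_apply,
    ArithmeticFunction.zeta_apply_ne hn, Nat.cast_one]

lemma sqrtZeta_one : sqrtZeta 1 = 1 := isMultiplicative_sqrtZeta.1

lemma sqrtZeta_le_one (n : ℕ) : sqrtZeta n ≤ 1 := by
  by_cases hn : n = 0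
  · simp [hn]
  rw [← sum_divisorsAntidiagonal_sqrtZeta hn]
  have : ((1, n) : ℕ × ℕ) ∈ n.divisorsAntidiagonal := by simp [hn]
  refine le_trans ?_ (Finset.single_le_sum (f := fun x : ℕ × ℕ => sqrtZeta x.1 * sqrtZeta x.2)
    (fun x _ => mul_nonneg (sqrtZeta_nonneg _) (sqrtZeta_nonneg _)) this)
  simp [sqrtZeta_one]

/-- The Dirichlet series `∑ n^{-y}` at a real point. -/
noncomputable def realZeta (y : ℝ) : ℝ := ∑' n : ℕ, (n : ℝ) ^ (-y)

/-- The Dirichlet series `∑ a_n² n^{-y}`, where `ζ^{1/2} = ∑ a_n n^{-s}`. -/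
noncomputable def sqrtZetaSq (y : ℝ) : ℝ := ∑' n : ℕ, sqrtZeta n ^ 2 * (n : ℝ) ^ (-y)

lemma summable_nat_rpow_neg {y : ℝ} (hy : 1 < y) : Summable fun n : ℕ => (n : ℝ) ^ (-y) :=
  Real.summable_nat_rpow.2 (by linarith)

lemma sqrtZeta_sq_le_one (n : ℕ) : sqrtZeta n ^ 2 ≤ 1 :=
  pow_le_one₀ (sqrtZeta_nonneg n) (sqrtZeta_le_one n)

lemma summable_sqrtZetaSq {y : ℝ} (hy : 1 < y) :
    Summable fun n : ℕ => sqrtZeta n ^ 2 * (n : ℝ) ^ (-y) :=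
  Summable.of_nonneg_of_le (fun n => by positivity)
    (fun n => mul_le_of_le_one_left (by positivity) (sqrtZeta_sq_le_one n))
    (summable_nat_rpow_neg hy)

lemma tendsto_realZeta {y : ℝ} (hy : 1 < y) :
    Filter.Tendsto (fun n : ℕ => ∏ p ∈ n.primesBelow, (1 - (p : ℝ) ^ (-y))⁻¹) Filter.atTop
      (nhds (realZeta y)) := by
  let f : ℕ →*₀ ℝ :=
    { toFun := fun n => (n : ℝ) ^ (-y)
      map_zero' := by simp [Real.zero_rpow (by linarith : -y ≠ 0)]
      map_one' := by simp
      map_mul' := fun m n => by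
        rw [Nat.cast_mul, Real.mul_rpow (Nat.cast_nonneg _) (Nat.cast_nonneg _)] }
  exact EulerProduct.eulerProduct_completely_multiplicative (f := f)
    (summable_nat_rpow_neg hy).norm

/-- The local factor of `∑ a_n² n^{-y}` at a prime `p`, in terms of `u = p^{-y}`. -/
noncomputable def localFactor (u : ℝ) : ℝ := ∑' k : ℕ, invSqrtCoeff k ^ 2 * u ^ k

lemma tendsto_sqrtZetaSq {y : ℝ} (hy : 1 < y) :
    Filter.Tendsto (fun n : ℕ => ∏ p ∈ n.primesBelow, localFactor ((p : ℝ) ^ (-y))) Filter.atTop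
      (nhds (sqrtZetaSq y)) := by
  have h := EulerProduct.eulerProduct (f := fun n : ℕ => sqrtZeta n ^ 2 * (n : ℝ) ^ (-y))
    (by simp [sqrtZeta_one]) (fun {m n} hmn => by
      rw [isMultiplicative_sqrtZeta.2 hmn, Nat.cast_mul,
        Real.mul_rpow (Nat.cast_nonneg _) (Nat.cast_nonneg _)]
      ring) (summable_sqrtZetaSq hy).norm (by simp)
  refine h.congr fun n => Finset.prod_congr rfl fun p hp => tsum_congr fun k => ?_
  have hp := Nat.prime_of_mem_primesBelow hp
  rw [sqrtZeta_prime_pow hp, Nat.cast_pow, ← Real.rpow_natCast_mul (Nat.cast_nonneg _),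
    ← Real.rpow_mul_natCast (Nat.cast_nonneg _), mul_comm (k : ℝ)]

lemma invSqrtCoeff_sq_le (k : ℕ) : invSqrtCoeff k ^ 2 ≤ 1 := by
  refine pow_le_one₀ (invSqrtCoeff_nonneg k) ?_
  rcases Nat.eq_zero_or_pos k with rfl | h
  · rw [invSqrtCoeff_zero]
  · linarith [invSqrtCoeff_le_half h]

lemma summable_localFactor {u : ℝ} (h0 : 0 ≤ u) (h1 : u ≤ 1 / 2) :
    Summable fun k : ℕ => invSqrtCoeff k ^ 2 * u ^ k :=
  Summable.of_nonneg_of_le (fun n => by positivity)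
    (fun n => mul_le_of_le_one_left (by positivity) (invSqrtCoeff_sq_le n))
    (summable_geometric_of_lt_one h0 (by linarith))

lemma localFactor_eq {u : ℝ} (h0 : 0 ≤ u) (h1 : u ≤ 1 / 2) :
    localFactor u = 1 + u / 4 + ∑' k : ℕ, invSqrtCoeff (k + 2) ^ 2 * u ^ (k + 2) := by
  rw [localFactor, ← (summable_localFactor h0 h1).sum_add_tsum_nat_add 2]
  simp [Finset.sum_range_succ, invSqrtCoeff_zero, invSqrtCoeff_one]
  ring

lemma le_localFactor {u : ℝ} (h0 : 0 ≤ u) (h1 : u ≤ 1 / 2) : 1 + u / 4 ≤ localFactor u := by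
  rw [localFactor_eq h0 h1]
  have : 0 ≤ ∑' k : ℕ, invSqrtCoeff (k + 2) ^ 2 * u ^ (k + 2) :=
    tsum_nonneg fun k => by positivity
  linarith

lemma localFactor_le {u : ℝ} (h0 : 0 ≤ u) (h1 : u ≤ 1 / 2) :
    localFactor u ≤ 1 + u / 4 + u ^ 2 / 2 := by
  rw [localFactor_eq h0 h1]
  have hs := (summable_geometric_of_lt_one h0 (by linarith : u < 1)).mul_left (u ^ 2 / 4)
  have : ∑' k : ℕ, invSqrtCoeff (k + 2) ^ 2 * u ^ (k + 2) ≤ ∑' k : ℕ, u ^ 2 / 4 * u ^ k := by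
    refine Summable.tsum_le_tsum (fun k => ?_)
      ((summable_nat_add_iff 2).2 (summable_localFactor h0 h1)) hs
    have h2 : invSqrtCoeff (k + 2) ^ 2 ≤ (1 / 2) ^ 2 :=
      pow_le_pow_left₀ (invSqrtCoeff_nonneg _) (invSqrtCoeff_le_half (by omega)) 2
    calc _ ≤ (1 / 2) ^ 2 * u ^ (k + 2) := by gcongr
      _ = _ := by ring
  rw [tsum_mul_left, tsum_geometric_of_lt_one h0 (by linarith)] at this
  have h3 : (1 - u)⁻¹ ≤ 2 := by
    rw [inv_le_comm₀ (by linarith) (by norm_num)]; linarith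
  nlinarith [sq_nonneg u]

lemma inv_one_sub_le_localFactor {u : ℝ} (h0 : 0 ≤ u) (h1 : u ≤ 1 / 2) :
    (1 - u)⁻¹ ≤ localFactor u ^ 4 * (1 - u ^ 2)⁻¹ := by
  have h2 : 1 + u ≤ localFactor u ^ 4 := by
    calc 1 + u ≤ (1 + u / 4) ^ 4 := by nlinarith [pow_nonneg h0 2, pow_nonneg h0 3, pow_nonneg h0 4]
      _ ≤ _ := pow_le_pow_left₀ (by positivity) (le_localFactor h0 h1) 4
  have h3 : 0 < 1 - u := by linarith
  have h4 : 0 < 1 + u := by linarith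
  have h5 : 1 - u ^ 2 = (1 - u) * (1 + u) := by ring
  rw [h5, mul_inv, mul_left_comm]
  refine le_mul_of_one_le_right (by positivity) ?_
  rwa [← div_eq_mul_inv, one_le_div h4]

lemma localFactor_pow_le {u : ℝ} (h0 : 0 ≤ u) (h1 : u ≤ 1 / 2) :
    localFactor u ^ 4 ≤ (1 - u)⁻¹ * ((1 - u ^ 2)⁻¹) ^ 2 := by
  have h3 : 0 < 1 - u := by linarith
  have h4 : 0 < 1 - u ^ 2 := by nlinarith
  have e1 : localFactor u ≤ Real.exp (u / 4 + u ^ 2 / 2) :=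
    (localFactor_le h0 h1).trans (by linarith [Real.add_one_le_exp (u / 4 + u ^ 2 / 2)])
  have e2 : 1 - u ≤ Real.exp (-u) := Real.one_sub_le_exp_neg u
  have e3 : 1 - u ^ 2 ≤ Real.exp (-u ^ 2) := Real.one_sub_le_exp_neg (u ^ 2)
  have hl : 0 < localFactor u := by linarith [le_localFactor h0 h1]
  rw [inv_pow, ← mul_inv, le_inv_comm₀ (by positivity) (by positivity)]
  calc _ ≤ Real.exp (-u) * (Real.exp (-u ^ 2)) ^ 2 := by gcongr
    _ = (Real.exp (u / 4 + u ^ 2 / 2) ^ 4)⁻¹ := by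
      rw [← Real.exp_nat_mul, ← Real.exp_nat_mul, ← Real.exp_add, ← Real.exp_neg]
      congr 1; push_cast; ring
    _ ≤ _ := by gcongr

lemma prime_rpow_neg_le_half {p : ℕ} (hp : p.Prime) {y : ℝ} (hy : 1 < y) :
    (p : ℝ) ^ (-y) ≤ 1 / 2 := by
  have h2 : (2 : ℝ) ≤ p := by exact_mod_cast hp.two_le
  calc (p : ℝ) ^ (-y) ≤ (p : ℝ) ^ (-1 : ℝ) :=
        Real.rpow_le_rpow_of_exponent_le (by linarith) (by linarith)
    _ = (p : ℝ)⁻¹ := by rw [Real.rpow_neg_one]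
    _ ≤ _ := by rw [one_div]; gcongr

lemma rpow_neg_two_mul (p : ℕ) (y : ℝ) : (p : ℝ) ^ (-(2 * y)) = ((p : ℝ) ^ (-y)) ^ 2 := by
  rw [← Real.rpow_natCast, ← Real.rpow_mul (Nat.cast_nonneg _)]
  congr 1; push_cast; ring

lemma realZeta_le_sqrtZetaSq {y : ℝ} (hy : 1 < y) :
    realZeta y ≤ sqrtZetaSq y ^ 4 * realZeta (2 * y) := by
  refine le_of_tendsto_of_tendsto' (tendsto_realZeta hy)
    (((tendsto_sqrtZetaSq hy).pow 4).mul (tendsto_realZeta (by linarith : 1 < 2 * y))) fun n => ?_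
  rw [← Finset.prod_pow, ← Finset.prod_mul_distrib]
  have hu : ∀ p ∈ n.primesBelow, (0 : ℝ) ≤ (p : ℝ) ^ (-y) ∧ (p : ℝ) ^ (-y) ≤ 1 / 2 := fun p hp =>
    ⟨by positivity, prime_rpow_neg_le_half (Nat.prime_of_mem_primesBelow hp) hy⟩
  refine Finset.prod_le_prod (fun p hp => ?_) fun p hp => ?_
  · have := (hu p hp).2
    exact inv_nonneg.2 (by linarith)
  · rw [rpow_neg_two_mul]
    exact inv_one_sub_le_localFactor (hu p hp).1 (hu p hp).2

lemma sqrtZetaSq_le_realZeta {y : ℝ} (hy : 1 < y) :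
    sqrtZetaSq y ^ 4 ≤ realZeta y * realZeta (2 * y) ^ 2 := by
  refine le_of_tendsto_of_tendsto' ((tendsto_sqrtZetaSq hy).pow 4)
    ((tendsto_realZeta hy).mul ((tendsto_realZeta (by linarith : 1 < 2 * y)).pow 2)) fun n => ?_
  rw [← Finset.prod_pow, ← Finset.prod_pow, ← Finset.prod_mul_distrib]
  have hu : ∀ p ∈ n.primesBelow, (0 : ℝ) ≤ (p : ℝ) ^ (-y) ∧ (p : ℝ) ^ (-y) ≤ 1 / 2 := fun p hp =>
    ⟨by positivity, prime_rpow_neg_le_half (Nat.prime_of_mem_primesBelow hp) hy⟩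
  refine Finset.prod_le_prod (fun p hp => ?_) fun p hp => ?_
  · have := le_localFactor (hu p hp).1 (hu p hp).2
    have := (hu p hp).1
    positivity
  · rw [rpow_neg_two_mul]
    exact localFactor_pow_le (hu p hp).1 (hu p hp).2

lemma realZeta_anti {y y' : ℝ} (hy : 1 < y) (h : y ≤ y') : realZeta y' ≤ realZeta y := by
  refine Summable.tsum_le_tsum (fun n => ?_) (summable_nat_rpow_neg (hy.trans_le h))
    (summable_nat_rpow_neg hy)
  rcases Nat.eq_zero_or_pos n with rfl | hn
  · simp [Real.zero_rpow (by linarith : -y ≠ 0), Real.zero_rpow (by linarith : -y' ≠ 0)]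
  · exact Real.rpow_le_rpow_of_exponent_le (by exact_mod_cast hn) (by linarith)

lemma one_le_realZeta {y : ℝ} (hy : 1 < y) : 1 ≤ realZeta y := by
  have := (summable_nat_rpow_neg hy).le_tsum 1 (fun n _ => by positivity)
  simpa [realZeta] using this

lemma sqrtZetaSq_nonneg (y : ℝ) : 0 ≤ sqrtZetaSq y := tsum_nonneg fun n => by positivity

/-- `∑ a_n² n^{-1-x}` is of exact order `x^{-1/4}` as `x → 0+`. -/
lemma exists_sqrtZetaSq_bounds : ∃ c C x₀ : ℝ, 0 < c ∧ 0 < C ∧ 0 < x₀ ∧ ∀ x, 0 < x → x ≤ x₀ →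
    c * x ^ (-(1 / 4) : ℝ) ≤ sqrtZetaSq (1 + x) ∧
      sqrtZetaSq (1 + x) ≤ C * x ^ (-(1 / 4) : ℝ) := by
  have hz : ∃ x₀ : ℝ, 0 < x₀ ∧ ∀ x, 0 < x → x ≤ x₀ → 1 / 2 * x⁻¹ ≤ realZeta (1 + x) ∧
      realZeta (1 + x) ≤ 2 * x⁻¹ := by
    have h := tendsto_sub_mul_tsum_nat_rpow
    have h1 : ∀ᶠ s : ℝ in nhdsWithin 1 (Set.Ioi 1), (s - 1) * ∑' n : ℕ, 1 / (n : ℝ) ^ s ∈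
      Set.Ioo (1 / 2 : ℝ) 2 := h.eventually_mem (Ioo_mem_nhds (by norm_num) (by norm_num))
    rw [eventually_nhdsWithin_iff, Metric.eventually_nhds_iff] at h1
    obtain ⟨ε, hε, h1⟩ := h1
    refine ⟨ε / 2, by positivity, fun x hx0 hx => ?_⟩
    have h2 := @h1 (1 + x) (by rw [Real.dist_eq]; rw [add_sub_cancel_left, abs_of_pos hx0]; linarith)
      (by simpa using hx0)
    have e : ∑' n : ℕ, 1 / (n : ℝ) ^ (1 + x) = realZeta (1 + x) :=
      tsum_congr fun n => by rw [Real.rpow_neg (Nat.cast_nonneg _), one_div]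
    rw [e, add_sub_cancel_left] at h2
    constructor
    · rw [← div_eq_mul_inv, div_le_iff₀ hx0]; linarith [h2.1]
    · rw [← div_eq_mul_inv, le_div_iff₀ hx0]; linarith [h2.2]
  obtain ⟨x₀, hx₀, hz⟩ := hz
  set M := realZeta 2 with hM
  have hM1 : 1 ≤ M := one_le_realZeta (by norm_num)
  refine ⟨(1 / (2 * M)) ^ (1 / 4 : ℝ), (2 * M ^ 2) ^ (1 / 4 : ℝ), x₀, by positivity, by positivity,
    hx₀, fun x hx0 hx => ?_⟩
  have h1 := hz x hx0 hx
  have hy : 1 < 1 + x := by linarith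
  have h2 : realZeta (2 * (1 + x)) ≤ M := realZeta_anti (by norm_num) (by linarith)
  have h2' : 1 ≤ realZeta (2 * (1 + x)) := one_le_realZeta (by linarith)
  have h3 := realZeta_le_sqrtZetaSq hy
  have h4 := sqrtZetaSq_le_realZeta hy
  have hF := sqrtZetaSq_nonneg (1 + x)
  have e : sqrtZetaSq (1 + x) = (sqrtZetaSq (1 + x) ^ 4) ^ (1 / 4 : ℝ) := by
    rw [← Real.rpow_natCast, ← Real.rpow_mul hF]; norm_num
  have e' : x ^ (-(1 / 4) : ℝ) = (x⁻¹) ^ (1 / 4 : ℝ) := by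
    rw [Real.inv_rpow hx0.le, Real.rpow_neg hx0.le]
  rw [e, e', ← Real.mul_rpow (by positivity) (by positivity),
    ← Real.mul_rpow (by positivity) (by positivity)]
  constructor
  · refine Real.rpow_le_rpow (by positivity) ?_ (by norm_num)
    have h5 : sqrtZetaSq (1 + x) ^ 4 * realZeta (2 * (1 + x)) ≤ sqrtZetaSq (1 + x) ^ 4 * M := by
      gcongr
    have h6 : 1 / 2 * x⁻¹ ≤ sqrtZetaSq (1 + x) ^ 4 * M := by linarith [h1.1]
    rw [one_div, mul_inv, ← one_div, mul_right_comm, ← div_eq_mul_inv, div_le_iff₀ (by linarith)]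
    exact h6
  · refine Real.rpow_le_rpow (by positivity) (h4.trans ?_) (by norm_num)
    calc _ ≤ (2 * x⁻¹) * M ^ 2 := by gcongr; exact h1.2
      _ = _ := by ring

/-- The truncation at `N` of the Dirichlet series of `ζ^{1/2}`. -/
noncomputable def sqrtZetaPoly (N : ℕ) (s : ℂ) : ℂ :=
  ∑ n ∈ Finset.Icc 1 N, (sqrtZeta n : ℂ) * (n : ℂ) ^ (-s)

open scoped LSeries.notation in
/-- The square of the truncation approximates `ζ` on the line of abscissa `3`. -/
lemma exists_norm_riemannZeta_sub_sq_le : ∃ C : ℝ, 0 < C ∧ ∀ N : ℕ, 1 ≤ N → ∀ s : ℂ, s.re = 3 →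
    ‖riemannZeta s - sqrtZetaPoly N s ^ 2‖ ≤ C * (N : ℝ) ^ (-(7 / 4) : ℝ) := by
  have hsum : Summable fun n : ℕ => (n : ℝ) ^ (-(5 / 4) : ℝ) := summable_nat_rpow_neg (by norm_num)
  refine ⟨(∑' n : ℕ, (n : ℝ) ^ (-(5 / 4) : ℝ)) + 1, by positivity, fun N hN s hs => ?_⟩
  set f : ℕ → ℂ := fun n => if n ≤ N then (sqrtZeta n : ℂ) else 0 with hf
  have hterm : ∀ n, LSeries.term f s n =
      if n ∈ Finset.Icc 1 N then (sqrtZeta n : ℂ) * (n : ℂ) ^ (-s) else 0 := by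
    intro n
    rcases Nat.eq_zero_or_pos n with rfl | hn
    · simp
    · rw [LSeries.term_of_ne_zero hn.ne', hf, Complex.cpow_neg]
      by_cases h : n ≤ N
      · simp [h, hn.ne', Nat.one_le_iff_ne_zero, div_eq_mul_inv]
      · simp [h]
  have hS : LSeries f s = sqrtZetaPoly N s := by
    rw [LSeries, sqrtZetaPoly, tsum_eq_sum (s := Finset.Icc 1 N)]
    · exact Finset.sum_congr rfl fun n hn => by rw [hterm, if_pos hn]
    · intro n hn
      rw [hterm, if_neg hn]
  have hfs : LSeriesSummable f s := by
    refine summable_of_ne_finset_zero (s := Finset.Icc 1 N) fun n hn => ?_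
    rw [hterm, if_neg hn]
  have hff := (hfs.LSeriesHasSum.convolution hfs.LSeriesHasSum)
  have h1 : LSeriesSummable 1 s := LSeriesSummable_one_iff.2 (by rw [hs]; norm_num)
  have hdiff : riemannZeta s - sqrtZetaPoly N s ^ 2 =
      ∑' n, (LSeries.term 1 s n - LSeries.term (f ⍟ f) s n) := by
    rw [Summable.tsum_sub h1 hff.LSeriesSummable,
      ← LSeries_one_eq_riemannZeta (by rw [hs]; norm_num), sq, ← hS,
      ← LSeries_convolution' hfs hfs]
    rfl
  have hcoef : ∀ n, n ≠ 0 → ∃ b : ℝ, (f ⍟ f) n = b ∧ 0 ≤ b ∧ b ≤ 1 ∧ (n ≤ N → b = 1) := by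
    intro n hn
    refine ⟨∑ x ∈ n.divisorsAntidiagonal, (if x.1 ≤ N then sqrtZeta x.1 else 0) *
      (if x.2 ≤ N then sqrtZeta x.2 else 0), ?_, ?_, ?_, ?_⟩
    · rw [LSeries.convolution_def, Complex.ofReal_sum]
      refine Finset.sum_congr rfl fun x _ => ?_
      simp only [hf, Complex.ofReal_mul]
      split_ifs <;> simp
    · refine Finset.sum_nonneg fun x _ => mul_nonneg ?_ ?_ <;> split_ifs <;>
        first | exact sqrtZeta_nonneg _ | exact le_rfl
    · rw [← sum_divisorsAntidiagonal_sqrtZeta hn]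
      refine Finset.sum_le_sum fun x _ => mul_le_mul ?_ ?_ ?_ (sqrtZeta_nonneg _) <;> split_ifs <;>
        first | exact sqrtZeta_nonneg _ | exact le_rfl
    · intro hnN
      rw [← sum_divisorsAntidiagonal_sqrtZeta hn]
      refine Finset.sum_congr rfl fun x hx => ?_
      have hx := (Nat.mem_divisorsAntidiagonal.1 hx).1
      have h0 : x.1 ≠ 0 ∧ x.2 ≠ 0 := by
        constructor <;> intro h <;> simp [h] at hx <;> omega
      have hx1 : x.1 ≤ n := hx ▸ Nat.le_mul_of_pos_right _ (Nat.pos_of_ne_zero h0.2)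
      have hx2 : x.2 ≤ n := hx ▸ Nat.le_mul_of_pos_left _ (Nat.pos_of_ne_zero h0.1)
      rw [if_pos (hx1.trans hnN), if_pos (hx2.trans hnN)]
  have hN0 : (0 : ℝ) < N := by exact_mod_cast hN
  have hbound : ∀ n, ‖LSeries.term 1 s n - LSeries.term (f ⍟ f) s n‖ ≤
      (N : ℝ) ^ (-(7 / 4) : ℝ) * (n : ℝ) ^ (-(5 / 4) : ℝ) := by
    intro n
    rcases Nat.eq_zero_or_pos n with rfl | hn
    · simp only [LSeries.term_zero, sub_zero, norm_zero]; positivity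
    · obtain ⟨b, hb, hb0, hb1, hbN⟩ := hcoef n hn.ne'
      have hn0 : (0 : ℝ) < n := by exact_mod_cast hn
      rw [LSeries.term_of_ne_zero hn.ne', LSeries.term_of_ne_zero hn.ne', hb, ← sub_div, norm_div,
        Complex.norm_natCast_cpow_of_pos hn, hs]
      by_cases hnN : n ≤ N
      · simp only [hbN hnN, Pi.one_apply, Complex.ofReal_one, sub_self, norm_zero, zero_div]
        positivity
      · have hnN' : (N : ℝ) ≤ n := by exact_mod_cast (not_le.1 hnN).le
        have h2 : ‖(1 : ℕ → ℂ) n - (b : ℂ)‖ ≤ 1 := by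
          rw [Pi.one_apply, ← Complex.ofReal_one, ← Complex.ofReal_sub, Complex.norm_real,
            Real.norm_eq_abs, abs_of_nonneg (by linarith)]
          linarith
        calc _ ≤ 1 / (n : ℝ) ^ (3 : ℝ) := by gcongr
          _ = (n : ℝ) ^ (-(7 / 4) : ℝ) * (n : ℝ) ^ (-(5 / 4) : ℝ) := by
            rw [← Real.rpow_add hn0, one_div, ← Real.rpow_neg hn0.le]; norm_num
          _ ≤ _ := by
            refine mul_le_mul_of_nonneg_right ?_ (by positivity)
            exact Real.rpow_le_rpow_of_nonpos hN0 hnN' (by norm_num)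
  rw [hdiff]
  calc _ ≤ ∑' n : ℕ, (N : ℝ) ^ (-(7 / 4) : ℝ) * (n : ℝ) ^ (-(5 / 4) : ℝ) :=
        tsum_of_norm_bounded (hsum.mul_left _).hasSum hbound
    _ ≤ _ := by
      rw [tsum_mul_left, mul_comm]
      gcongr
      linarith

lemma norm_sqrtZetaPoly_le (N : ℕ) {s : ℂ} (hs : 0 ≤ s.re) : ‖sqrtZetaPoly N s‖ ≤ N := by
  refine (norm_sum_le _ _).trans ?_
  calc _ ≤ ∑ n ∈ Finset.Icc 1 N, (1 : ℝ) := by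
        refine Finset.sum_le_sum fun n hn => ?_
        have hn := (Finset.mem_Icc.1 hn).1
        rw [norm_mul, Complex.norm_real, Real.norm_eq_abs, abs_of_nonneg (sqrtZeta_nonneg n),
          Complex.norm_natCast_cpow_of_pos hn]
        refine mul_le_one₀ (sqrtZeta_le_one n) (by positivity) ?_
        exact Real.rpow_le_one_of_one_le_of_nonpos (by exact_mod_cast hn) (by simpa using hs)
    _ = N := by simp

lemma differentiable_sqrtZetaPoly (N : ℕ) : Differentiable ℂ (sqrtZetaPoly N) := by
  unfold sqrtZetaPoly
  refine Differentiable.fun_sum fun n hn => ?_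
  have hn : (n : ℂ) ≠ 0 := by
    exact_mod_cast (Nat.one_le_iff_ne_zero.1 (Finset.mem_Icc.1 hn).1)
  exact (differentiable_neg.const_cpow (Or.inl hn)).const_mul _

lemma exists_norm_riemannZeta_three_le : ∃ C : ℝ, 0 < C ∧ ∀ s : ℂ, s.re = 3 →
    ‖riemannZeta s‖ ≤ C := by
  obtain ⟨C, hC, h⟩ := exists_norm_riemannZeta_sub_sq_le
  refine ⟨C + 1, by positivity, fun s hs => ?_⟩
  have h1 := h 1 le_rfl s hs
  have h2 := norm_sqrtZetaPoly_le 1 (s := s) (by rw [hs]; norm_num)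
  rw [Nat.cast_one, Real.one_rpow, mul_one] at h1
  rw [Nat.cast_one] at h2
  have h3 : ‖sqrtZetaPoly 1 s ^ 2‖ ≤ 1 := by
    rw [norm_pow]; exact pow_le_one₀ (norm_nonneg _) h2
  have := norm_add_le (riemannZeta s - sqrtZetaPoly 1 s ^ 2) (sqrtZetaPoly 1 s ^ 2)
  rw [sub_add_cancel] at this
  linarith

lemma sum_le_sqrtZetaSq (N : ℕ) {y : ℝ} (hy : 1 < y) :
    ∑ n ∈ Finset.Icc 1 N, sqrtZeta n ^ 2 * (n : ℝ) ^ (-y) ≤ sqrtZetaSq y :=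
  (summable_sqrtZetaSq hy).sum_le_tsum _ fun n _ => by positivity

lemma exists_sum_sqrtZeta_sq_le : ∃ C T₀ : ℝ, 0 < C ∧ ∀ T ≥ T₀, ∀ N : ℕ, (N : ℝ) ≤ T →
    ∑ n ∈ Finset.Icc 1 N, sqrtZeta n ^ 2 * (n : ℝ) ^ (-1 : ℝ) ≤
      C * Real.log T ^ (1 / 4 : ℝ) := by
  obtain ⟨c, C, x₀, -, hC, hx₀, h⟩ := exists_sqrtZetaSq_bounds
  refine ⟨Real.exp 1 * C, Real.exp (1 / x₀), by positivity, fun T hT N hN => ?_⟩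
  have hT0 : 0 < T := (Real.exp_pos _).trans_le hT
  have hlog : 1 / x₀ ≤ Real.log T := (Real.le_log_iff_exp_le hT0).2 hT
  have hlog0 : 0 < Real.log T := lt_of_lt_of_le (by positivity) hlog
  set x := (Real.log T)⁻¹ with hx
  have hx0 : 0 < x := by positivity
  have hx1 : x ≤ x₀ := by
    rw [hx, inv_le_comm₀ hlog0 hx₀]; simpa using hlog
  have h1 := (h x hx0 hx1).2
  have e : x ^ (-(1 / 4) : ℝ) = Real.log T ^ (1 / 4 : ℝ) := by
    rw [hx, Real.inv_rpow hlog0.le, Real.rpow_neg hlog0.le, inv_inv]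
  rw [e] at h1
  calc _ ≤ ∑ n ∈ Finset.Icc 1 N, Real.exp 1 * (sqrtZeta n ^ 2 * (n : ℝ) ^ (-(1 + x))) := by
        refine Finset.sum_le_sum fun n hn => ?_
        have hn1 := Finset.mem_Icc.1 hn
        have hn0 : (0 : ℝ) < n := by exact_mod_cast hn1.1
        have hnT : (n : ℝ) ≤ T := le_trans (by exact_mod_cast hn1.2) hN
        have h2 : (n : ℝ) ^ x ≤ Real.exp 1 := by
          calc (n : ℝ) ^ x ≤ T ^ x := by gcongr
            _ = _ := by rw [Real.rpow_def_of_pos hT0, hx, mul_inv_cancel₀ hlog0.ne']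
        have h3 : (n : ℝ) ^ (-1 : ℝ) = (n : ℝ) ^ x * (n : ℝ) ^ (-(1 + x)) := by
          rw [← Real.rpow_add hn0]; congr 1; ring
        rw [h3, mul_left_comm]
        gcongr
    _ ≤ Real.exp 1 * sqrtZetaSq (1 + x) := by
        rw [← Finset.mul_sum]
        gcongr
        exact sum_le_sqrtZetaSq N (by linarith)
    _ ≤ _ := by rw [mul_assoc]; gcongr

lemma tsum_le_sum_range_add_tsum {f g : ℕ → ℝ} (M : ℕ) (hf : Summable f) (hg : Summable g)
    (hg0 : ∀ m, 0 ≤ g m) (h : ∀ m, M ≤ m → f m ≤ g m) :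
    ∑' n, f n ≤ ∑ n ∈ Finset.range M, f n + ∑' n, g n := by
  rw [← hf.sum_add_tsum_nat_add M, ← hg.sum_add_tsum_nat_add M]
  have h1 : 0 ≤ ∑ n ∈ Finset.range M, g n := Finset.sum_nonneg fun n _ => hg0 n
  have h2 : ∑' n, f (n + M) ≤ ∑' n, g (n + M) :=
    Summable.tsum_le_tsum (fun n => h _ (by omega)) ((summable_nat_add_iff M).2 hf)
      ((summable_nat_add_iff M).2 hg)
  linarith

lemma sqrtZetaSq_le_sum_add (N : ℕ) (hN : 1 ≤ N) {x : ℝ} (hx : 0 < x) :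
    sqrtZetaSq (1 + 2 * x) ≤ ∑ n ∈ Finset.Icc 1 N, sqrtZeta n ^ 2 * (n : ℝ) ^ (-(1 + 2 * x)) +
      (N : ℝ) ^ (-x) * sqrtZetaSq (1 + x) := by
  have hs := summable_sqrtZetaSq (y := 1 + 2 * x) (by linarith)
  have hs' := (summable_sqrtZetaSq (y := 1 + x) (by linarith)).mul_left ((N : ℝ) ^ (-x))
  have hN0 : (0 : ℝ) < N := by exact_mod_cast hN
  have h0 : ∑ n ∈ Finset.range (N + 1), sqrtZeta n ^ 2 * (n : ℝ) ^ (-(1 + 2 * x)) =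
      ∑ n ∈ Finset.Icc 1 N, sqrtZeta n ^ 2 * (n : ℝ) ^ (-(1 + 2 * x)) := by
    symm
    refine Finset.sum_subset (fun n hn => ?_) fun n hn hn' => ?_
    · simp only [Finset.mem_Icc, Finset.mem_range] at *; omega
    · have : n = 0 := by simp only [Finset.mem_Icc, Finset.mem_range] at *; omega
      simp [this]
  have key : ∀ m : ℕ, N ≤ m → sqrtZeta m ^ 2 * (m : ℝ) ^ (-(1 + 2 * x)) ≤
      (N : ℝ) ^ (-x) * (sqrtZeta m ^ 2 * (m : ℝ) ^ (-(1 + x))) := by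
    intro m hm
    have hm : (N : ℝ) ≤ m := by exact_mod_cast hm
    have hm0 : (0 : ℝ) < m := hN0.trans_le hm
    have e : (m : ℝ) ^ (-(1 + 2 * x)) = (m : ℝ) ^ (-x) * (m : ℝ) ^ (-(1 + x)) := by
      rw [← Real.rpow_add hm0]; congr 1; ring
    rw [e, mul_left_comm]
    have := Real.rpow_le_rpow_of_nonpos hN0 hm (by linarith : -x ≤ 0)
    gcongr
  rw [← h0, sqrtZetaSq, sqrtZetaSq, ← tsum_mul_left]
  exact tsum_le_sum_range_add_tsum (N + 1) hs hs' (fun m => by positivity)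
    fun m hm => key m (by omega)

lemma exists_le_sum_sqrtZeta_sq : ∃ c κ₀ : ℝ, 0 < c ∧ 0 < κ₀ ∧ ∀ κ ≥ κ₀, ∃ T₀ : ℝ, ∀ T ≥ T₀,
    ∀ N : ℕ, T ^ (1 / 2 : ℝ) ≤ N → c * κ ^ (-(1 / 4) : ℝ) * Real.log T ^ (1 / 4 : ℝ) ≤
      ∑ n ∈ Finset.Icc 1 N, sqrtZeta n ^ 2 * (n : ℝ) ^ (-(1 + 2 * (κ / Real.log T))) := by
  obtain ⟨c, C, x₀, hc, hC, hx₀, h⟩ := exists_sqrtZetaSq_bounds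
  refine ⟨c / 4, max 1 (2 * Real.log (4 * C / c)), by positivity, by positivity, fun κ hκ =>
    ⟨Real.exp (2 * κ / x₀ + 1), fun T hT N hN => ?_⟩⟩
  have hκ0 : 0 < κ := lt_of_lt_of_le one_pos ((le_max_left _ _).trans hκ)
  have hT0 : 0 < T := (Real.exp_pos _).trans_le hT
  have hlog : 2 * κ / x₀ + 1 ≤ Real.log T := (Real.le_log_iff_exp_le hT0).2 hT
  have hlog0 : 0 < Real.log T := lt_of_lt_of_le (by positivity) hlog
  set x := κ / Real.log T with hx
  have hx0 : 0 < x := by positivity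
  have hx1 : 2 * x ≤ x₀ := by
    have : 2 * κ / x₀ ≤ Real.log T := by linarith
    rw [div_le_iff₀ hx₀] at this
    rw [hx, ← mul_div_assoc, div_le_iff₀ hlog0]
    linarith
  have hT1 : 1 ≤ T := (Real.one_le_exp (by positivity)).trans hT
  have hN1 : 1 ≤ N := by
    have : (1 : ℝ) ≤ N := (Real.one_le_rpow hT1 (by norm_num)).trans hN
    exact_mod_cast this
  have h1 := (h (2 * x) (by positivity) hx1).1
  have h2 := (h x hx0 (by linarith)).2
  have h3 := sqrtZetaSq_le_sum_add N hN1 hx0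
  have h4 : (N : ℝ) ^ (-x) ≤ c / (4 * C) := by
    calc (N : ℝ) ^ (-x) ≤ (T ^ (1 / 2 : ℝ)) ^ (-x) :=
          Real.rpow_le_rpow_of_nonpos (by positivity) hN (by linarith)
      _ = Real.exp (-(κ / 2)) := by
          rw [← Real.rpow_mul hT0.le, Real.rpow_def_of_pos hT0, hx]
          congr 1
          field_simp
      _ ≤ Real.exp (-Real.log (4 * C / c)) := by
          have := (le_max_right _ _).trans hκ
          gcongr
          linarith
      _ = _ := by rw [Real.exp_neg, Real.exp_log (by positivity), inv_div]
  have h5 : (1 / 2 : ℝ) ≤ 2 ^ (-(1 / 4) : ℝ) := by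
    calc (1 / 2 : ℝ) = 2 ^ (-1 : ℝ) := by rw [Real.rpow_neg_one]; norm_num
      _ ≤ _ := Real.rpow_le_rpow_of_exponent_le (by norm_num) (by norm_num)
  have e : κ ^ (-(1 / 4) : ℝ) * Real.log T ^ (1 / 4 : ℝ) = x ^ (-(1 / 4) : ℝ) := by
    rw [hx, Real.div_rpow hκ0.le hlog0.le, Real.rpow_neg hlog0.le, div_inv_eq_mul]
  rw [mul_assoc, e]
  rw [Real.mul_rpow (by norm_num) hx0.le] at h1
  have hxp : 0 < x ^ (-(1 / 4) : ℝ) := by positivity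
  have h6 : (N : ℝ) ^ (-x) * sqrtZetaSq (1 + x) ≤ c / 4 * x ^ (-(1 / 4) : ℝ) := by
    calc _ ≤ c / (4 * C) * (C * x ^ (-(1 / 4) : ℝ)) := by
          have := sqrtZetaSq_nonneg (1 + x)
          gcongr
      _ = _ := by field_simp
  have h7 : c * (1 / 2 * x ^ (-(1 / 4) : ℝ)) ≤
      c * (2 ^ (-(1 / 4) : ℝ) * x ^ (-(1 / 4) : ℝ)) := by gcongr
  linarith

/-- The Gaussian weight centred at `τ` of width `B`. -/
noncomputable def gaussWeight (τ B t : ℝ) : ℝ := Real.exp (-((t - τ) / B) ^ 2)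

lemma gaussWeight_pos (τ B t : ℝ) : 0 < gaussWeight τ B t := Real.exp_pos _

lemma gaussWeight_le_one (τ B t : ℝ) : gaussWeight τ B t ≤ 1 :=
  Real.exp_le_one_iff.2 (by simpa using sq_nonneg _)

lemma continuous_gaussWeight (τ B : ℝ) : Continuous (gaussWeight τ B) := by
  unfold gaussWeight; fun_prop

lemma integrable_gaussWeight (τ : ℝ) {B : ℝ} (hB : 0 < B) : Integrable (gaussWeight τ B) := by
  have h := (integrable_exp_neg_mul_sq (b := (B ^ 2)⁻¹) (by positivity)).comp_sub_right τ
  refine h.congr (Filter.Eventually.of_forall fun t => ?_)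
  simp only [gaussWeight, div_pow]
  congr 1
  rw [div_eq_inv_mul]; ring

lemma integral_exp_mul_gaussWeight (τ ω : ℝ) {B : ℝ} (hB : 0 < B) :
    ∫ t : ℝ, Complex.exp ((ω * t : ℝ) * Complex.I) * (gaussWeight τ B t : ℂ) =
      Complex.exp ((ω * τ : ℝ) * Complex.I) *
        ((Real.sqrt Real.pi * B * Real.exp (-(B * ω / 2) ^ 2) : ℝ) : ℂ) := by
  have h := fourierIntegral_gaussian (b := ((B ^ 2)⁻¹ : ℝ)) (by
    rw [Complex.ofReal_re]; positivity) (ω : ℂ)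
  rw [← integral_sub_right_eq_self _ τ] at h
  have e1 : ∀ t : ℝ, Complex.exp ((ω * t : ℝ) * Complex.I) * (gaussWeight τ B t : ℂ) =
      Complex.exp ((ω * τ : ℝ) * Complex.I) * (Complex.exp (Complex.I * ω * (t - τ : ℝ)) *
        Complex.exp (-((B ^ 2)⁻¹ : ℝ) * (t - τ : ℝ) ^ 2)) := by
    intro t
    rw [gaussWeight, Complex.ofReal_exp, ← Complex.exp_add, ← Complex.exp_add, ← Complex.exp_add]
    congr 1
    push_cast
    rw [div_pow, div_eq_inv_mul]
    ring
  simp_rw [e1]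
  rw [integral_const_mul, h]
  congr 1
  have e2 : (Real.pi / ((B ^ 2)⁻¹ : ℝ) : ℂ) = ((Real.pi * B ^ 2 : ℝ) : ℂ) := by
    push_cast; rw [div_inv_eq_mul]
  have e3 : ((1 : ℂ) / 2) = ((1 / 2 : ℝ) : ℂ) := by push_cast; rfl
  rw [e2, e3, ← Complex.ofReal_cpow (by positivity), ← Real.sqrt_eq_rpow,
    Real.sqrt_mul Real.pi_pos.le, Real.sqrt_sq hB.le]
  have hB' : (B : ℂ) ≠ 0 := by exact_mod_cast hB.ne'
  push_cast
  congr 2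
  field_simp
  ring

lemma integral_gaussWeight (τ : ℝ) {B : ℝ} (hB : 0 < B) :
    ∫ t, gaussWeight τ B t = Real.sqrt Real.pi * B := by
  have h := integral_exp_mul_gaussWeight τ 0 hB
  simp only [zero_mul, Complex.ofReal_zero, Complex.exp_zero, one_mul, mul_zero, zero_div] at h
  rw [integral_complex_ofReal] at h
  have := Complex.ofReal_injective h
  simpa using this

lemma integral_cos_mul_gaussWeight (τ ω : ℝ) {B : ℝ} (hB : 0 < B) :
    |∫ t, Real.cos (ω * t) * gaussWeight τ B t| ≤
      Real.sqrt Real.pi * B * Real.exp (-(B * ω / 2) ^ 2) := by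
  have h := integral_exp_mul_gaussWeight τ ω hB
  have hi : Integrable fun t : ℝ =>
      Complex.exp ((ω * t : ℝ) * Complex.I) * (gaussWeight τ B t : ℂ) := by
    refine (integrable_gaussWeight τ hB).mono' ?_ (Filter.Eventually.of_forall fun t => ?_)
    · have := continuous_gaussWeight τ B
      exact (by fun_prop : Continuous _).aestronglyMeasurable
    · rw [norm_mul, Complex.norm_exp_ofReal_mul_I, one_mul, Complex.norm_real, Real.norm_eq_abs,
        abs_of_pos (gaussWeight_pos _ _ _)]
  have e : ∫ t, Real.cos (ω * t) * gaussWeight τ B t =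
      (∫ t : ℝ, Complex.exp ((ω * t : ℝ) * Complex.I) * (gaussWeight τ B t : ℂ)).re := by
    rw [← RCLike.re_eq_complex_re, ← integral_re hi]
    refine integral_congr_ae (Filter.Eventually.of_forall fun t => ?_)
    simp only [RCLike.re_eq_complex_re]
    rw [Complex.re_mul_ofReal, Complex.exp_ofReal_mul_I_re]
  rw [e, h]
  refine (Complex.abs_re_le_norm _).trans_eq ?_
  rw [norm_mul, Complex.norm_exp_ofReal_mul_I, one_mul, Complex.norm_real, Real.norm_eq_abs,
    abs_of_nonneg (by positivity)]

lemma integrable_cos_mul_gaussWeight (τ ω : ℝ) {B : ℝ} (hB : 0 < B) :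
    Integrable fun t => Real.cos (ω * t) * gaussWeight τ B t := by
  refine (integrable_gaussWeight τ hB).mono' ?_ (Filter.Eventually.of_forall fun t => ?_)
  · have := continuous_gaussWeight τ B
    exact (by fun_prop : Continuous _).aestronglyMeasurable
  · rw [norm_mul, Real.norm_eq_abs, Real.norm_eq_abs, abs_of_pos (gaussWeight_pos _ _ _)]
    exact mul_le_of_le_one_left (gaussWeight_pos _ _ _).le (Real.abs_cos_le_one _)

lemma norm_sq_sum_exp {ι : Type*} (s : Finset ι) (b ω : ι → ℝ) (t : ℝ) :
    ‖∑ n ∈ s, (b n : ℂ) * Complex.exp ((-(ω n * t) : ℝ) * Complex.I)‖ ^ 2 =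
      ∑ m ∈ s, ∑ n ∈ s, b m * b n * Real.cos ((ω m - ω n) * t) := by
  rw [← Complex.normSq_eq_norm_sq, Complex.normSq_apply, Complex.re_sum, Complex.im_sum,
    Finset.sum_mul_sum, Finset.sum_mul_sum, ← Finset.sum_add_distrib]
  refine Finset.sum_congr rfl fun m _ => ?_
  rw [← Finset.sum_add_distrib]
  refine Finset.sum_congr rfl fun n _ => ?_
  rw [Complex.re_ofReal_mul, Complex.re_ofReal_mul, Complex.im_ofReal_mul, Complex.im_ofReal_mul,
    Complex.exp_ofReal_mul_I_re, Complex.exp_ofReal_mul_I_re, Complex.exp_ofReal_mul_I_im,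
    Complex.exp_ofReal_mul_I_im, sub_mul, Real.cos_sub, Real.cos_neg, Real.cos_neg, Real.sin_neg,
    Real.sin_neg]
  ring

lemma sqrtZetaPoly_eq (N : ℕ) (σ t : ℝ) : sqrtZetaPoly N (σ + t * Complex.I) =
    ∑ n ∈ Finset.Icc 1 N, ((sqrtZeta n * (n : ℝ) ^ (-σ) : ℝ) : ℂ) *
      Complex.exp ((-(Real.log n * t) : ℝ) * Complex.I) := by
  refine Finset.sum_congr rfl fun n hn => ?_
  have hn0 : (n : ℂ) ≠ 0 := by
    exact_mod_cast (Nat.one_le_iff_ne_zero.1 (Finset.mem_Icc.1 hn).1)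
  rw [Complex.ofReal_mul, mul_assoc, Complex.ofReal_cpow (Nat.cast_nonneg _)]
  congr 1
  rw [Complex.ofReal_natCast, Complex.cpow_def_of_ne_zero hn0, Complex.cpow_def_of_ne_zero hn0,
    ← Complex.exp_add, ← Complex.natCast_log]
  congr 1; push_cast; ring

lemma one_div_le_abs_log_sub_log {N m n : ℕ} (hm : m ∈ Finset.Icc 1 N) (hn : n ∈ Finset.Icc 1 N)
    (h : m ≠ n) : 1 / (N : ℝ) ≤ |Real.log m - Real.log n| := by
  wlog hlt : n < m generalizing m n
  · rw [abs_sub_comm]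
    exact this hn hm h.symm (by omega)
  rw [Finset.mem_Icc] at hm hn
  have hm0 : (0 : ℝ) < m := by exact_mod_cast hm.1
  have hn0 : (0 : ℝ) < n := by exact_mod_cast hn.1
  have h1 : (n : ℝ) + 1 ≤ m := by exact_mod_cast hlt
  have h2 : (m : ℝ) ≤ N := by exact_mod_cast hm.2
  have h3 := Real.one_sub_inv_le_log_of_pos (div_pos hm0 hn0)
  rw [Real.log_div hm0.ne' hn0.ne', inv_div] at h3
  refine le_trans ?_ (h3.trans (le_abs_self _))
  calc 1 / (N : ℝ) ≤ 1 / m := by gcongr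
    _ ≤ _ := by
      rw [div_le_iff₀ hm0, sub_mul, div_mul_cancel₀ _ hm0.ne']
      linarith

/-- Mean square of the Dirichlet polynomial against a Gaussian weight. -/
lemma abs_integral_sqrtZetaPoly_sub_le (N : ℕ) {σ B : ℝ} (hσ : 0 ≤ σ) (hB : 0 < B) (τ : ℝ) :
    |(∫ t : ℝ, ‖sqrtZetaPoly N (σ + t * Complex.I)‖ ^ 2 * gaussWeight τ B t) -
      Real.sqrt Real.pi * B * ∑ n ∈ Finset.Icc 1 N, sqrtZeta n ^ 2 * (n : ℝ) ^ (-(2 * σ))| ≤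
      Real.sqrt Real.pi * B * ((N : ℝ) ^ 2 * Real.exp (-(B / (2 * N)) ^ 2)) := by
  set b : ℕ → ℝ := fun n => sqrtZeta n * (n : ℝ) ^ (-σ) with hb
  have hb0 : ∀ n, 0 ≤ b n := fun n => mul_nonneg (sqrtZeta_nonneg n) (by positivity)
  have hb1 : ∀ n ∈ Finset.Icc 1 N, b n ≤ 1 := fun n hn =>
    mul_le_one₀ (sqrtZeta_le_one n) (by positivity) (Real.rpow_le_one_of_one_le_of_nonpos
      (by exact_mod_cast (Finset.mem_Icc.1 hn).1) (by linarith))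
  set I : ℕ → ℕ → ℝ := fun m n =>
    ∫ t, Real.cos ((Real.log m - Real.log n) * t) * gaussWeight τ B t with hI
  have h1 : (∫ t : ℝ, ‖sqrtZetaPoly N (σ + t * Complex.I)‖ ^ 2 * gaussWeight τ B t) =
      ∑ m ∈ Finset.Icc 1 N, ∑ n ∈ Finset.Icc 1 N, b m * b n * I m n := by
    have e : ∀ t : ℝ, ‖sqrtZetaPoly N (σ + t * Complex.I)‖ ^ 2 * gaussWeight τ B t =
        ∑ m ∈ Finset.Icc 1 N, ∑ n ∈ Finset.Icc 1 N, b m * b n *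
          (Real.cos ((Real.log m - Real.log n) * t) * gaussWeight τ B t) := fun t => by
      have e' := norm_sq_sum_exp (Finset.Icc 1 N) b (fun n => Real.log n) t
      rw [sqrtZetaPoly_eq, e', Finset.sum_mul]
      refine Finset.sum_congr rfl fun m _ => ?_
      rw [Finset.sum_mul]
      exact Finset.sum_congr rfl fun n _ => mul_assoc _ _ _
    rw [integral_congr_ae (Filter.Eventually.of_forall e)]
    rw [integral_finsetSum _ fun m _ => integrable_finsetSum _ fun n _ =>
      (integrable_cos_mul_gaussWeight τ _ hB).const_mul _]
    refine Finset.sum_congr rfl fun m _ => ?_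
    rw [integral_finsetSum _ fun n _ => (integrable_cos_mul_gaussWeight τ _ hB).const_mul _]
    exact Finset.sum_congr rfl fun n _ => integral_const_mul _ _
  have h2 : Real.sqrt Real.pi * B * ∑ n ∈ Finset.Icc 1 N, sqrtZeta n ^ 2 * (n : ℝ) ^ (-(2 * σ)) =
      ∑ m ∈ Finset.Icc 1 N, ∑ n ∈ Finset.Icc 1 N,
        if m = n then b m * b n * (Real.sqrt Real.pi * B) else 0 := by
    rw [Finset.mul_sum]
    refine Finset.sum_congr rfl fun m hm => ?_
    rw [Finset.sum_ite_eq, if_pos hm, hb, rpow_neg_two_mul]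
    ring
  rw [h1, h2, ← Finset.sum_sub_distrib]
  simp_rw [← Finset.sum_sub_distrib]
  refine (Finset.abs_sum_le_sum_abs _ _).trans ?_
  have hK : ∀ m ∈ Finset.Icc 1 N, ∀ n ∈ Finset.Icc 1 N,
      |b m * b n * I m n - if m = n then b m * b n * (Real.sqrt Real.pi * B) else 0| ≤
        Real.sqrt Real.pi * B * Real.exp (-(B / (2 * N)) ^ 2) := by
    intro m hm n hn
    by_cases h : m = n
    · subst h
      simp only [hI, sub_self, zero_mul, Real.cos_zero, one_mul, if_true, integral_gaussWeight τ hB,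
        abs_zero]
      positivity
    · rw [if_neg h, sub_zero, abs_mul, abs_of_nonneg (mul_nonneg (hb0 m) (hb0 n))]
      have h3 := integral_cos_mul_gaussWeight τ (Real.log m - Real.log n) hB
      have h4 := one_div_le_abs_log_sub_log hm hn h
      have h5 : b m * b n ≤ 1 := mul_le_one₀ (hb1 m hm) (hb0 n) (hb1 n hn)
      refine (mul_le_of_le_one_left (abs_nonneg _) h5).trans (h3.trans ?_)
      have h6 : (B / (2 * N)) ^ 2 ≤ (B * (Real.log m - Real.log n) / 2) ^ 2 := by
        rw [← sq_abs (B * (Real.log m - Real.log n) / 2), abs_div, abs_mul, abs_of_pos hB,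
          abs_two]
        have : B / (2 * N) = B * (1 / N) / 2 := by ring
        rw [this]
        gcongr
      gcongr
  calc _ ≤ ∑ m ∈ Finset.Icc 1 N, ∑ n ∈ Finset.Icc 1 N,
        Real.sqrt Real.pi * B * Real.exp (-(B / (2 * N)) ^ 2) :=
        Finset.sum_le_sum fun m hm => (Finset.abs_sum_le_sum_abs _ _).trans
          (Finset.sum_le_sum fun n hn => hK m hm n hn)
    _ = _ := by simp; ring

/-- Differentiability on the right half plane with quadratic growth on vertical strips. -/
def StripGrowth (g : ℂ → ℂ) : Prop :=
  DifferentiableOn ℂ g {s | 0 < s.re} ∧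
    ∀ a b : ℝ, 0 < a → ∃ C, ∀ s : ℂ, a ≤ s.re → s.re ≤ b → ‖g s‖ ≤ C * (1 + s.im ^ 2)

/-- The entire function whose modulus on the critical line is `e^{φt} e^{-((t-τ)/B)²}`. -/
noncomputable def lineKernel (φ τ B : ℝ) (s : ℂ) : ℂ :=
  Complex.exp (-Complex.I * φ * (s - 1 / 2)) * Complex.exp (((s - 1 / 2 - Complex.I * τ) / B) ^ 2)

lemma differentiable_lineKernel (φ τ B : ℝ) : Differentiable ℂ (lineKernel φ τ B) := by
  unfold lineKernel
  fun_prop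

lemma lineKernel_half (φ τ B t : ℝ) : lineKernel φ τ B ((1 / 2 : ℝ) + t * Complex.I) =
    ((Real.exp (φ * t) * gaussWeight τ B t : ℝ) : ℂ) := by
  rw [lineKernel, gaussWeight, Complex.ofReal_mul, Complex.ofReal_exp, Complex.ofReal_exp]
  congr 2
  · push_cast
    ring_nf
    simp
  · push_cast
    rw [show (1 / 2 + (t : ℂ) * Complex.I - 1 / 2 - Complex.I * τ) / B =
      Complex.I * ((t - τ) / B) by ring, mul_pow, Complex.I_sq]
    ring

lemma norm_lineKernel (φ τ B σ t : ℝ) : ‖lineKernel φ τ B (σ + t * Complex.I)‖ =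
    Real.exp (φ * t) * Real.exp (((σ - 1 / 2) / B) ^ 2) * gaussWeight τ B t := by
  have h : ((σ : ℂ) + t * Complex.I - 1 / 2 - Complex.I * τ) / B =
      (((σ - 1 / 2) / B : ℝ) : ℂ) + (((t - τ) / B : ℝ) : ℂ) * Complex.I := by
    push_cast; ring
  rw [lineKernel, norm_mul, Complex.norm_exp, Complex.norm_exp, gaussWeight,
    mul_assoc (Real.exp _), ← Real.exp_add (((σ - 1 / 2) / B) ^ 2), h, sq, Complex.mul_re]
  congr 2
  · simp
  · simp only [Complex.add_re, Complex.ofReal_re, Complex.mul_re, Complex.I_re, mul_zero,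
      Complex.ofReal_im, Complex.I_im, mul_one, Complex.add_im, Complex.mul_im]
    ring

lemma one_add_sq_le_two_mul_exp_abs (y : ℝ) : 1 + y ^ 2 ≤ 2 * Real.exp |y| := by
  have h := Real.quadratic_le_exp_of_nonneg (abs_nonneg y)
  rw [sq_abs] at h
  nlinarith [abs_nonneg y]

lemma one_add_sq_sq_mul_exp_le (φ τ : ℝ) {B : ℝ} (hB : 0 < B) (y : ℝ) :
    (1 + y ^ 2) ^ 2 * (Real.exp (φ * y) * gaussWeight τ B y) ≤
      4 * Real.exp ((2 + |φ|) * |τ| + ((2 + |φ|) * B) ^ 2 / 4) := by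
  have h1 : (1 + y ^ 2) ^ 2 ≤ (2 * Real.exp |y|) ^ 2 := by
    gcongr
    exact one_add_sq_le_two_mul_exp_abs y
  rw [mul_pow, ← Real.exp_nat_mul] at h1
  refine (mul_le_mul_of_nonneg_right h1
    (mul_nonneg (Real.exp_pos _).le (gaussWeight_pos _ _ _).le)).trans ?_
  rw [gaussWeight, mul_assoc, ← Real.exp_add, ← Real.exp_add]
  norm_num
  have h2 : |y| ≤ |τ| + B * |(y - τ) / B| := by
    rw [abs_div, abs_of_pos hB, mul_div_cancel₀ _ hB.ne']
    have := abs_add_le τ (y - τ)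
    rwa [add_sub_cancel] at this
  have h3 : φ * y ≤ |φ| * |y| := (le_abs_self _).trans (abs_mul _ _).le
  rw [← sq_abs ((y - τ) / B)]
  have h4 : (2 + |φ|) * |y| ≤ (2 + |φ|) * (|τ| + B * |(y - τ) / B|) := by gcongr
  nlinarith [sq_nonneg (|(y - τ) / B| - (2 + |φ|) * B / 2)]

lemma StripGrowth.mul_lineKernel {g : ℂ → ℂ} (hg : StripGrowth g) (φ τ : ℝ) {B : ℝ} (hB : 0 < B) :
    StripDecay (fun s => g s * lineKernel φ τ B s) := by
  refine ⟨hg.1.mul (differentiable_lineKernel φ τ B).differentiableOn, fun a b ha => ?_⟩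
  obtain ⟨C, hC⟩ := hg.2 a b ha
  refine ⟨|C| * (Real.exp (((b + 1) / B) ^ 2) *
    (4 * Real.exp ((2 + |φ|) * |τ| + ((2 + |φ|) * B) ^ 2 / 4))), fun s h1 h2 => ?_⟩
  have hk := norm_lineKernel φ τ B s.re s.im
  rw [Complex.re_add_im] at hk
  have hpos : 0 < 1 + s.im ^ 2 := by positivity
  rw [norm_mul, hk, ← div_eq_mul_inv, le_div_iff₀ hpos]
  have h3 : ‖g s‖ ≤ |C| * (1 + s.im ^ 2) :=
    (hC s h1 h2).trans (mul_le_mul_of_nonneg_right (le_abs_self C) hpos.le)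
  have h4 : Real.exp (((s.re - 1 / 2) / B) ^ 2) ≤ Real.exp (((b + 1) / B) ^ 2) := by
    rw [Real.exp_le_exp, div_pow, div_pow]
    gcongr ?_ / _
    exact sq_le_sq' (by linarith) (by linarith)
  have h5 := one_add_sq_sq_mul_exp_le φ τ hB s.im
  have hG := gaussWeight_pos τ B s.im
  calc ‖g s‖ * (Real.exp (φ * s.im) * Real.exp (((s.re - 1 / 2) / B) ^ 2) *
        gaussWeight τ B s.im) * (1 + s.im ^ 2)
      ≤ |C| * (1 + s.im ^ 2) * (Real.exp (φ * s.im) * Real.exp (((b + 1) / B) ^ 2) *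
        gaussWeight τ B s.im) * (1 + s.im ^ 2) := by gcongr
    _ = |C| * (Real.exp (((b + 1) / B) ^ 2) * ((1 + s.im ^ 2) ^ 2 *
        (Real.exp (φ * s.im) * gaussWeight τ B s.im))) := by ring
    _ ≤ _ := by gcongr

lemma stripGrowth_xiFun : StripGrowth xiFun := by
  refine ⟨differentiable_xiFun.differentiableOn, fun a b _ => ?_⟩
  obtain ⟨C, -, hC⟩ := exists_norm_xiFun_le a b
  exact ⟨C, hC⟩

lemma stripGrowth_xiFactor : StripGrowth xiFactor := by
  refine ⟨fun s hs => (differentiableAt_xiFactor hs).differentiableWithinAt, fun a b ha => ?_⟩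
  obtain ⟨M, hM⟩ := (isCompact_Icc (a := a) (b := b)).exists_bound_of_continuousOn
    (f := fun x : ℝ => Real.pi ^ (-x / 2) * Real.Gamma (x / 2)) (by
      intro x hx
      have hx0 : 0 < x := ha.trans_le hx.1
      refine ContinuousAt.continuousWithinAt (ContinuousAt.mul ?_ ?_)
      · exact (Real.continuousAt_const_rpow Real.pi_pos.ne').comp (by fun_prop)
      · exact ContinuousAt.comp (g := Real.Gamma) (Real.differentiableAt_Gamma fun m => by
          have : (0 : ℝ) ≤ m := m.cast_nonneg
          linarith).continuousAt (by fun_prop))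
  refine ⟨(|b| + 2) ^ 2 * 2 * |M|, fun s h1 h2 => ?_⟩
  have hre : 0 < s.re := ha.trans_le h1
  have h3 := hM s.re ⟨h1, h2⟩
  have h4 : ‖Complex.Gammaℝ s‖ ≤ |M| := by
    refine le_trans ?_ ((h3).trans (le_abs_self M))
    rw [Complex.Gammaℝ_def, norm_mul, Complex.norm_cpow_eq_rpow_re_of_pos Real.pi_pos, norm_mul,
      Real.norm_of_nonneg (by positivity)]
    simp only [Complex.div_ofNat_re, Complex.neg_re]
    refine mul_le_mul_of_nonneg_left ?_ (by positivity)
    have := norm_Gamma_le_Gamma_re (s := s / 2) (by simpa using hre)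
    simp only [Complex.div_ofNat_re] at this
    exact this.trans (le_abs_self _)
  have hb : 0 ≤ |b| := abs_nonneg b
  have hs : ‖s‖ ≤ |b| + |s.im| := by
    refine (Complex.norm_le_abs_re_add_abs_im s).trans ?_
    rw [abs_of_pos hre]
    linarith [le_abs_self b]
  have hy := abs_nonneg s.im
  have h5 : ‖s‖ ≤ (|b| + 2) * (1 + |s.im|) := by nlinarith
  have h6 : ‖s - 1‖ ≤ (|b| + 2) * (1 + |s.im|) := by
    refine (norm_sub_le _ _).trans ?_
    rw [norm_one]
    nlinarith
  have h7 : (1 + |s.im|) ^ 2 ≤ 2 * (1 + s.im ^ 2) := by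
    rw [← sq_abs s.im]; nlinarith [sq_nonneg (1 - |s.im|)]
  rw [xiFactor, norm_mul, norm_mul]
  calc ‖s‖ * ‖s - 1‖ * ‖Complex.Gammaℝ s‖
      ≤ ((|b| + 2) * (1 + |s.im|)) * ((|b| + 2) * (1 + |s.im|)) * |M| := by gcongr
    _ = (|b| + 2) ^ 2 * |M| * (1 + |s.im|) ^ 2 := by ring
    _ ≤ (|b| + 2) ^ 2 * |M| * (2 * (1 + s.im ^ 2)) := by gcongr
    _ = _ := by ring

lemma StripGrowth.mul_bounded {g p : ℂ → ℂ} (hg : StripGrowth g)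
    (hp : DifferentiableOn ℂ p {s | 0 < s.re}) {M : ℝ} (hM : ∀ s : ℂ, 0 < s.re → ‖p s‖ ≤ M) :
    StripGrowth (fun s => g s * p s) := by
  refine ⟨hg.1.mul hp, fun a b ha => ?_⟩
  obtain ⟨C, hC⟩ := hg.2 a b ha
  refine ⟨C * M, fun s h1 h2 => ?_⟩
  rw [norm_mul]
  have := mul_le_mul (hC s h1 h2) (hM s (ha.trans_le h1)) (norm_nonneg _)
    ((norm_nonneg _).trans (hC s h1 h2))
  linarith

/-- The completed zeta function against the kernel. -/
noncomputable def xiLine (φ τ B : ℝ) (s : ℂ) : ℂ := xiFun s * lineKernel φ τ B s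

/-- The analogue of `xiLine` with zeta replaced by the square of the Dirichlet polynomial. -/
noncomputable def polyLine (N : ℕ) (φ τ B : ℝ) (s : ℂ) : ℂ :=
  xiFactor s * sqrtZetaPoly N s ^ 2 * lineKernel φ τ B s

lemma stripDecay_xiLine (φ τ : ℝ) {B : ℝ} (hB : 0 < B) : StripDecay (xiLine φ τ B) :=
  stripGrowth_xiFun.mul_lineKernel φ τ hB

lemma stripDecay_polyLine (N : ℕ) (φ τ : ℝ) {B : ℝ} (hB : 0 < B) :
    StripDecay (polyLine N φ τ B) :=
  (stripGrowth_xiFactor.mul_bounded (M := (N : ℝ) ^ 2)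
    ((differentiable_sqrtZetaPoly N).pow 2).differentiableOn fun s hs => by
      rw [Pi.pow_apply, norm_pow]
      exact pow_le_pow_left₀ (norm_nonneg _) (norm_sqrtZetaPoly_le N hs.le) 2).mul_lineKernel φ τ hB

/-- The difference of `xiLine` and `polyLine`. -/
noncomputable def diffLine (N : ℕ) (φ τ B : ℝ) (s : ℂ) : ℂ := xiLine φ τ B s - polyLine N φ τ B s

lemma stripDecay_diffLine (N : ℕ) (φ τ : ℝ) {B : ℝ} (hB : 0 < B) :
    StripDecay (diffLine N φ τ B) :=
  (stripDecay_xiLine φ τ hB).sub (stripDecay_polyLine N φ τ hB)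

lemma StripDecay.lineNorm_sub_le {f g : ℂ → ℂ} (hf : StripDecay f) (hg : StripDecay g) {σ : ℝ}
    (hσ : 0 < σ) : lineNorm (fun s => f s - g s) σ ≤ lineNorm f σ + lineNorm g σ := by
  unfold lineNorm
  rw [← integral_add (hf.integrable_line hσ).norm (hg.integrable_line hσ).norm]
  exact integral_mono ((hf.sub hg).integrable_line hσ).norm
    ((hf.integrable_line hσ).norm.add (hg.integrable_line hσ).norm) fun t => norm_sub_le _ _

lemma StripDecay.lineNorm_le_add_sub {f g : ℂ → ℂ} (hf : StripDecay f) (hg : StripDecay g) {σ : ℝ}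
    (hσ : 0 < σ) : lineNorm f σ ≤ lineNorm g σ + lineNorm (fun s => f s - g s) σ := by
  unfold lineNorm
  rw [← integral_add (hg.integrable_line hσ).norm ((hf.sub hg).integrable_line hσ).norm]
  refine integral_mono (hf.integrable_line hσ).norm
    ((hg.integrable_line hσ).norm.add ((hf.sub hg).integrable_line hσ).norm) fun t => ?_
  have := norm_add_le (g (σ + t * Complex.I)) (f (σ + t * Complex.I) - g (σ + t * Complex.I))
  rwa [add_sub_cancel] at this

lemma lineNorm_xiLine_reflect (φ τ B : ℝ) {σ : ℝ} (hσ : 0 < σ) :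
    lineNorm (xiLine φ τ B) (1 - σ) = lineNorm (xiLine φ τ B) σ := by
  refine integral_congr_ae (Filter.Eventually.of_forall fun t => ?_)
  simp only [xiLine, norm_mul, norm_lineKernel, norm_xiFun_reflect hσ t]
  rw [show (1 - σ - 1 / 2) / B = -((σ - 1 / 2) / B) by ring, neg_sq]

/-- By convexity and the functional equation the norm is minimal on the critical line. -/
lemma lineNorm_xiLine_half_le (φ τ : ℝ) {B σ : ℝ} (hB : 0 < B) (h1 : 1 / 2 < σ) (h2 : σ < 1) :
    lineNorm (xiLine φ τ B) (1 / 2) ≤ lineNorm (xiLine φ τ B) σ := by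
  have h := (stripDecay_xiLine φ τ hB).lineNorm_le_interp (a := 1 - σ) (b := σ) (σ := 1 / 2)
    (by linarith) (by linarith) (by linarith) (by linarith)
  rw [lineNorm_xiLine_reflect φ τ B (by linarith),
    show (1 / 2 - (1 - σ)) / (σ - (1 - σ)) = 1 / 2 by
      rw [div_eq_iff (by linarith)]; ring,
    ← Real.rpow_add_of_nonneg (lineNorm_nonneg _ _) (by norm_num) (by norm_num)] at h
  norm_num at h
  simpa using h

/-- Interpolation from the lines `1/2` and `3` in additive form. -/
lemma StripDecay.lineNorm_le_of_half_of_three {f : ℂ → ℂ} (hf : StripDecay f) {σ M : ℝ}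
    (h1 : 1 / 2 ≤ σ) (h2 : σ ≤ 3) (hM : 0 < M) :
    lineNorm f σ ≤ M ^ ((σ - 1 / 2) / (3 - 1 / 2)) * (lineNorm f (1 / 2) + lineNorm f 3 / M) := by
  have h := hf.lineNorm_le_interp (a := 1 / 2) (b := 3) (by norm_num) (by norm_num) h1 h2
  set θ := (σ - 1 / 2) / (3 - 1 / 2) with hθ
  have hθ0 : 0 ≤ θ := div_nonneg (by linarith) (by norm_num)
  have hθ1 : θ ≤ 1 := by rw [hθ, div_le_one (by norm_num)]; linarith
  have hx := lineNorm_nonneg f (1 / 2)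
  have hz : 0 ≤ lineNorm f 3 / M := div_nonneg (lineNorm_nonneg f 3) hM.le
  have h3 := Real.geom_mean_le_arith_mean2_weighted (w₁ := 1 - θ) (w₂ := θ) (by linarith) hθ0 hx hz
    (by ring)
  calc lineNorm f σ ≤ _ := h
    _ = M ^ θ * (lineNorm f (1 / 2) ^ (1 - θ) * (lineNorm f 3 / M) ^ θ) := by
      conv_lhs => rw [show lineNorm f 3 = M * (lineNorm f 3 / M) by
        rw [mul_div_cancel₀ _ hM.ne'], Real.mul_rpow hM.le hz]
      ring
    _ ≤ _ := by
      gcongr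
      nlinarith

lemma one_add_pow_four_mul_exp_le (u : ℝ) (hu : 0 ≤ u) :
    (1 + u) ^ 4 * Real.exp (-u ^ 2) ≤ 64 * Real.exp (-u ^ 2 / 2) := by
  have h1 : (1 + u) ^ 2 ≤ 2 * (1 + u ^ 2) := by nlinarith [sq_nonneg (1 - u)]
  have h2 : 1 + u ^ 2 ≤ 4 * Real.exp (u ^ 2 / 4) := by
    have := Real.add_one_le_exp (u ^ 2 / 4)
    linarith
  have h3 : (1 + u) ^ 4 ≤ 64 * Real.exp (u ^ 2 / 2) := by
    calc (1 + u) ^ 4 = ((1 + u) ^ 2) ^ 2 := by ring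
      _ ≤ (2 * (4 * Real.exp (u ^ 2 / 4))) ^ 2 := by gcongr; linarith
      _ = 64 * (Real.exp (u ^ 2 / 4) * Real.exp (u ^ 2 / 4)) := by ring
      _ = _ := by rw [← Real.exp_add]; ring_nf
  calc (1 + u) ^ 4 * Real.exp (-u ^ 2) ≤ 64 * Real.exp (u ^ 2 / 2) * Real.exp (-u ^ 2) := by
        gcongr
    _ = _ := by rw [mul_assoc, ← Real.exp_add]; ring_nf

lemma gaussWeight_sqrt_two (τ B t : ℝ) :
    gaussWeight τ (Real.sqrt 2 * B) t = Real.exp (-((t - τ) / B) ^ 2 / 2) := by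
  rw [gaussWeight, div_pow, div_pow, mul_pow, Real.sq_sqrt (by norm_num)]
  congr 1
  rw [neg_div, div_div, mul_comm]

/-- Polynomial factors are absorbed by widening the Gaussian. -/
lemma one_add_abs_rpow_mul_gaussWeight_le {p T δ : ℝ} (hp0 : 0 ≤ p) (hp4 : p ≤ 4) (hT : 1 ≤ T)
    (hδ0 : 0 < δ) (hδ1 : δ ≤ 1) (t : ℝ) :
    (1 + |t|) ^ p * gaussWeight (3 / 2 * T) (δ * T) t ≤
      2560 * T ^ p * gaussWeight (3 / 2 * T) (Real.sqrt 2 * (δ * T)) t := by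
  rw [gaussWeight_sqrt_two, gaussWeight]
  set u := |(t - 3 / 2 * T) / (δ * T)| with hu
  have hT0 : 0 < T := by linarith
  have hB : 0 < δ * T := by positivity
  have hu0 : 0 ≤ u := abs_nonneg _
  rw [← sq_abs ((t - 3 / 2 * T) / (δ * T)), ← hu]
  have h1 : |t| ≤ 3 / 2 * T + T * u := by
    have h2 : |t - 3 / 2 * T| = δ * T * u := by
      rw [hu, abs_div, abs_of_pos hB, mul_div_cancel₀ _ hB.ne']
    have h3 := abs_add_le (t - 3 / 2 * T) (3 / 2 * T)
    rw [sub_add_cancel, abs_of_pos (by positivity : 0 < 3 / 2 * T), h2] at h3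
    nlinarith [mul_nonneg hT0.le hu0]
  have h2 : 1 + |t| ≤ T * (5 / 2 * (1 + u)) := by nlinarith [mul_nonneg hT0.le hu0]
  have h3 : (1 + |t|) ^ p ≤ T ^ p * (40 * (1 + u) ^ 4) := by
    calc (1 + |t|) ^ p ≤ (T * (5 / 2 * (1 + u))) ^ p := by gcongr
      _ = T ^ p * (5 / 2 * (1 + u)) ^ p := Real.mul_rpow hT0.le (by positivity)
      _ ≤ T ^ p * (5 / 2 * (1 + u)) ^ (4 : ℝ) := by
        gcongr
        linarith
      _ ≤ _ := by
        gcongr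
        rw [show (4 : ℝ) = ((4 : ℕ) : ℝ) by norm_num, Real.rpow_natCast, mul_pow]
        gcongr
        norm_num
  calc (1 + |t|) ^ p * Real.exp (-u ^ 2) ≤ T ^ p * (40 * (1 + u) ^ 4) * Real.exp (-u ^ 2) := by
        gcongr
    _ = T ^ p * 40 * ((1 + u) ^ 4 * Real.exp (-u ^ 2)) := by ring
    _ ≤ T ^ p * 40 * (64 * Real.exp (-u ^ 2 / 2)) :=
        mul_le_mul_of_nonneg_left (one_add_pow_four_mul_exp_le u hu0) (by positivity)
    _ = _ := by ring

/-- The off-diagonal terms of the mean square are negligible for `N ≤ T^{6/7}`. -/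
lemma exists_offDiag_le {δ ε : ℝ} (hδ : 0 < δ) (hε : 0 < ε) :
    ∃ T₀, ∀ T ≥ T₀, ∀ N : ℕ, 1 ≤ N → (N : ℝ) ≤ T ^ (6 / 7 : ℝ) → ∀ B, δ * T ≤ B →
      (N : ℝ) ^ 2 * Real.exp (-(B / (2 * N)) ^ 2) ≤ ε := by
  set C := 5040 * 4 ^ 7 / δ ^ 14 with hC
  have hC0 : 0 < C := by positivity
  have hlim : Filter.Tendsto (fun T : ℝ => C * T ^ (-(2 / 7) : ℝ)) Filter.atTop (nhds (C * 0)) :=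
    (tendsto_rpow_neg_atTop (by norm_num)).const_mul C
  rw [mul_zero] at hlim
  obtain ⟨T₁, hT₁⟩ := Filter.eventually_atTop.1 (hlim.eventually_le_const hε)
  refine ⟨max T₁ 1, fun T hT N hN hNT B hB => le_trans ?_ (hT₁ T (le_of_max_le_left hT))⟩
  have hT0 : 0 < T := by linarith [le_of_max_le_right hT]
  have hN0 : (0 : ℝ) < N := by exact_mod_cast hN
  have h1 : δ * T / (2 * T ^ (6 / 7 : ℝ)) ≤ B / (2 * N) := by
    gcongr
    exact (by positivity : 0 < δ * T).le.trans hB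
  set y := δ * T / (2 * T ^ (6 / 7 : ℝ)) with hy
  have hy0 : 0 < y := by positivity
  have h2 : Real.exp (-(B / (2 * N)) ^ 2) ≤ Real.exp (-y ^ 2) := by
    rw [Real.exp_le_exp]; gcongr
  have h3 : Real.exp (-y ^ 2) ≤ 5040 / y ^ 14 := by
    have h4 := Real.pow_div_factorial_le_exp (y ^ 2) (by positivity) 7
    rw [show ((Nat.factorial 7 : ℕ) : ℝ) = 5040 by norm_num [Nat.factorial], ← pow_mul] at h4
    rw [Real.exp_neg, le_div_iff₀ (by positivity), inv_mul_le_iff₀ (Real.exp_pos _)]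
    linarith [(div_le_iff₀ (by norm_num : (0 : ℝ) < 5040)).1 h4]
  have e2 : (T ^ (6 / 7 : ℝ)) ^ 2 = T ^ (12 / 7 : ℝ) := by
    rw [← Real.rpow_natCast, ← Real.rpow_mul hT0.le]; norm_num
  have e14 : (T ^ (6 / 7 : ℝ)) ^ 14 = T ^ (12 : ℕ) := by
    rw [← Real.rpow_natCast, ← Real.rpow_mul hT0.le, ← Real.rpow_natCast]; norm_num
  have e3 : T ^ (-(2 / 7) : ℝ) = T ^ (12 / 7 : ℝ) / T ^ 2 := by
    rw [← Real.rpow_natCast, ← Real.rpow_sub hT0]; norm_num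
  calc (N : ℝ) ^ 2 * Real.exp (-(B / (2 * N)) ^ 2)
      ≤ (T ^ (6 / 7 : ℝ)) ^ 2 * (5040 / y ^ 14) := by gcongr; exact h2.trans h3
    _ = C * T ^ (-(2 / 7) : ℝ) := by
      rw [hy, div_pow, mul_pow, mul_pow, e14, e2, hC, e3]
      field_simp
      norm_num

lemma exists_polyLength : ∃ T₀ : ℝ, ∀ T ≥ T₀, ∃ N : ℕ, 1 ≤ N ∧ (N : ℝ) ≤ T ^ (6 / 7 : ℝ) ∧
    T ^ (1 / 2 : ℝ) ≤ N ∧ (N : ℝ) ^ (-(7 / 4) : ℝ) ≤ 4 * T ^ (-(3 / 2) : ℝ) := by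
  refine ⟨8, fun T hT => ⟨⌊T ^ (6 / 7 : ℝ)⌋₊, ?_⟩⟩
  have hT0 : 0 < T := by linarith
  have h1 : (2 : ℝ) ≤ T ^ (5 / 14 : ℝ) := by
    calc (2 : ℝ) = (2 ^ (14 / 5 : ℝ)) ^ (5 / 14 : ℝ) := by
          rw [← Real.rpow_mul (by norm_num)]; norm_num
      _ ≤ (2 ^ (3 : ℝ)) ^ (5 / 14 : ℝ) := by
          gcongr <;> norm_num
      _ ≤ T ^ (5 / 14 : ℝ) := by
          gcongr
          norm_num; linarith
  have h2 : T ^ (6 / 7 : ℝ) = T ^ (1 / 2 : ℝ) * T ^ (5 / 14 : ℝ) := by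
    rw [← Real.rpow_add hT0]; norm_num
  have h3 : 1 ≤ T ^ (1 / 2 : ℝ) := Real.one_le_rpow (by linarith) (by norm_num)
  have h4 := Nat.lt_floor_add_one (T ^ (6 / 7 : ℝ))
  have h5 : T ^ (6 / 7 : ℝ) / 2 ≤ (⌊T ^ (6 / 7 : ℝ)⌋₊ : ℝ) := by nlinarith
  have h6 : T ^ (1 / 2 : ℝ) ≤ (⌊T ^ (6 / 7 : ℝ)⌋₊ : ℝ) := by nlinarith
  refine ⟨by exact_mod_cast h3.trans h6, Nat.floor_le (by positivity), h6, ?_⟩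
  calc ((⌊T ^ (6 / 7 : ℝ)⌋₊ : ℕ) : ℝ) ^ (-(7 / 4) : ℝ) ≤ (T ^ (6 / 7 : ℝ) / 2) ^ (-(7 / 4) : ℝ) :=
        Real.rpow_le_rpow_of_nonpos (by positivity) h5 (by norm_num)
    _ = T ^ (-(3 / 2) : ℝ) * 2 ^ (7 / 4 : ℝ) := by
      rw [Real.div_rpow (by positivity) (by norm_num), ← Real.rpow_mul hT0.le,
        Real.rpow_neg (by norm_num : (0 : ℝ) ≤ 2), div_inv_eq_mul]
      norm_num
    _ ≤ T ^ (-(3 / 2) : ℝ) * 2 ^ (2 : ℝ) := by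
      gcongr <;> norm_num
    _ = _ := by norm_num; ring

/-- The diagonal sum of the mean square. -/
noncomputable def diagSum (N : ℕ) (σ : ℝ) : ℝ :=
  ∑ n ∈ Finset.Icc 1 N, sqrtZeta n ^ 2 * (n : ℝ) ^ (-(2 * σ))

lemma one_le_diagSum {N : ℕ} (hN : 1 ≤ N) (σ : ℝ) : 1 ≤ diagSum N σ := by
  have h := Finset.single_le_sum (f := fun n : ℕ => sqrtZeta n ^ 2 * (n : ℝ) ^ (-(2 * σ)))
    (fun n _ => by positivity) (Finset.mem_Icc.2 ⟨le_refl 1, hN⟩)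
  simpa [sqrtZeta_one, diagSum] using h

lemma meanSquare_bounds {N : ℕ} (hN : 1 ≤ N) {σ B : ℝ} (hσ : 0 ≤ σ) (hB : 0 < B) (τ : ℝ)
    (hoff : (N : ℝ) ^ 2 * Real.exp (-(B / (2 * N)) ^ 2) ≤ 1 / 4) :
    3 / 4 * (Real.sqrt Real.pi * B * diagSum N σ) ≤
        ∫ t : ℝ, ‖sqrtZetaPoly N (σ + t * Complex.I)‖ ^ 2 * gaussWeight τ B t ∧
      ∫ t : ℝ, ‖sqrtZetaPoly N (σ + t * Complex.I)‖ ^ 2 * gaussWeight τ B t ≤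
        5 / 4 * (Real.sqrt Real.pi * B * diagSum N σ) := by
  have h := abs_le.1 (abs_integral_sqrtZetaPoly_sub_le N hσ hB τ)
  rw [← diagSum] at h
  have hS := one_le_diagSum hN σ
  have hpi : 0 < Real.sqrt Real.pi * B := by positivity
  have h1 : Real.sqrt Real.pi * B * ((N : ℝ) ^ 2 * Real.exp (-(B / (2 * N)) ^ 2)) ≤
      Real.sqrt Real.pi * B * (1 / 4 * diagSum N σ) := by
    exact mul_le_mul_of_nonneg_left (by linarith) hpi.le
  constructor <;> nlinarith [h.1, h.2]

lemma continuous_sqrtZetaPoly_line (N : ℕ) (σ : ℝ) :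
    Continuous fun t : ℝ => sqrtZetaPoly N (σ + t * Complex.I) :=
  (differentiable_sqrtZetaPoly N).continuous.comp (by fun_prop)

lemma integrable_sqrtZetaPoly_sq_mul (N : ℕ) {σ B : ℝ} (hσ : 0 ≤ σ) (hB : 0 < B) (τ : ℝ) :
    Integrable fun t : ℝ => ‖sqrtZetaPoly N (σ + t * Complex.I)‖ ^ 2 * gaussWeight τ B t := by
  refine ((integrable_gaussWeight τ hB).const_mul ((N : ℝ) ^ 2)).mono'
    (((continuous_sqrtZetaPoly_line N σ).norm.pow 2).mul
      (continuous_gaussWeight τ B)).aestronglyMeasurable (Filter.Eventually.of_forall fun t => ?_)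
  rw [Real.norm_of_nonneg (mul_nonneg (by positivity) (gaussWeight_pos _ _ _).le)]
  refine mul_le_mul_of_nonneg_right ?_ (gaussWeight_pos _ _ _).le
  exact pow_le_pow_left₀ (norm_nonneg _) (norm_sqrtZetaPoly_le N (by simpa using hσ)) 2

lemma exp_sq_div_le {σ B : ℝ} (h1 : 1 / 2 ≤ σ) (h2 : σ ≤ 3) (hB : 5 / 2 ≤ B) :
    Real.exp (((σ - 1 / 2) / B) ^ 2) ≤ 3 := by
  have h3 : (σ - 1 / 2) / B ≤ 1 := by
    rw [div_le_one (by linarith)]; linarith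
  have h0 : 0 ≤ (σ - 1 / 2) / B := div_nonneg (by linarith) (by linarith)
  have h4 : ((σ - 1 / 2) / B) ^ 2 ≤ 1 := pow_le_one₀ h0 h3
  exact (Real.exp_le_exp.2 h4).trans Real.exp_one_lt_three.le

/-- Upper bound for the polynomial norm on the critical line. -/
lemma exists_lineNorm_polyLine_half_le : ∃ C, 0 < C ∧ ∀ T δ : ℝ, ∀ N : ℕ, 1 ≤ T → 0 < δ → δ ≤ 1 →
    1 ≤ N → (N : ℝ) ^ 2 * Real.exp (-(Real.sqrt 2 * (δ * T) / (2 * N)) ^ 2) ≤ 1 / 4 →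
    lineNorm (polyLine N (Real.pi / 4) (3 / 2 * T) (δ * T)) (1 / 2) ≤
      C * (T ^ (7 / 4 : ℝ) * (δ * T)) * diagSum N (1 / 2) := by
  obtain ⟨C, hC0, hC⟩ := exists_norm_xiFactor_half_le
  refine ⟨C * 2560 * (5 / 4) * (Real.sqrt Real.pi * Real.sqrt 2), by positivity,
    fun T δ N hT hδ0 hδ1 hN hoff => ?_⟩
  have hT0 : 0 < T := by linarith
  have hB : 0 < δ * T := by positivity
  have hB2 : 0 < Real.sqrt 2 * (δ * T) := by positivity
  have hmv := (meanSquare_bounds hN (σ := 1 / 2) (by norm_num) hB2 (3 / 2 * T) hoff).2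
  calc lineNorm (polyLine N (Real.pi / 4) (3 / 2 * T) (δ * T)) (1 / 2)
      ≤ ∫ t : ℝ, C * (2560 * T ^ (7 / 4 : ℝ)) *
        (‖sqrtZetaPoly N ((1 / 2 : ℝ) + t * Complex.I)‖ ^ 2 *
          gaussWeight (3 / 2 * T) (Real.sqrt 2 * (δ * T)) t) := by
        refine integral_mono_of_nonneg (Filter.Eventually.of_forall fun t => norm_nonneg _)
          ((integrable_sqrtZetaPoly_sq_mul N (by norm_num) hB2 _).const_mul _)
          (Filter.Eventually.of_forall fun t => ?_)
        have h1 := hC t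
        have h2 := one_add_abs_rpow_mul_gaussWeight_le (p := 7 / 4) (by norm_num) (by norm_num) hT
          hδ0 hδ1 t
        have hG := gaussWeight_pos (3 / 2 * T) (δ * T) t
        simp only [polyLine, norm_mul, norm_pow, norm_lineKernel, sub_self, zero_div, ne_eq,
          OfNat.ofNat_ne_zero, not_false_eq_true, zero_pow, Real.exp_zero, mul_one]
        set X := ‖sqrtZetaPoly N ((1 / 2 : ℝ) + t * Complex.I)‖ ^ 2 with hX
        have hX0 : 0 ≤ X := by positivity
        calc _ = ‖xiFactor ((1 / 2 : ℝ) + t * Complex.I)‖ * Real.exp (Real.pi / 4 * t) *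
              (gaussWeight (3 / 2 * T) (δ * T) t * X) := by ring
          _ ≤ C * (1 + |t|) ^ (7 / 4 : ℝ) * (gaussWeight (3 / 2 * T) (δ * T) t * X) := by gcongr
          _ = C * X * ((1 + |t|) ^ (7 / 4 : ℝ) * gaussWeight (3 / 2 * T) (δ * T) t) := by ring
          _ ≤ C * X * (2560 * T ^ (7 / 4 : ℝ) *
              gaussWeight (3 / 2 * T) (Real.sqrt 2 * (δ * T)) t) := by gcongr
          _ = _ := by ring
    _ ≤ C * (2560 * T ^ (7 / 4 : ℝ)) * (5 / 4 * (Real.sqrt Real.pi * (Real.sqrt 2 * (δ * T)) *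
        diagSum N (1 / 2))) := by
        rw [integral_const_mul]; gcongr
    _ = _ := by ring

/-- Trivial bound on the line `3`. -/
lemma exists_lineNorm_three_le : ∃ C, 0 < C ∧ ∀ (T δ D : ℝ) (f : ℂ → ℂ), 1 ≤ T → 0 < δ → δ ≤ 1 →
    5 / 2 ≤ δ * T → 0 ≤ D → (∀ t : ℝ, ‖f ((3 : ℝ) + t * Complex.I)‖ ≤
      ‖xiFactor ((3 : ℝ) + t * Complex.I)‖ * D *
        ‖lineKernel (Real.pi / 4) (3 / 2 * T) (δ * T) ((3 : ℝ) + t * Complex.I)‖) →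
    lineNorm f 3 ≤ C * D * (T ^ (3 : ℝ) * (δ * T)) := by
  refine ⟨18 * 3 * 2560 * (Real.sqrt Real.pi * Real.sqrt 2), by positivity,
    fun T δ D f hT hδ0 hδ1 hB5 hD hf => ?_⟩
  have hT0 : 0 < T := by linarith
  have hB : 0 < δ * T := by positivity
  have hB2 : 0 < Real.sqrt 2 * (δ * T) := by positivity
  calc lineNorm f 3
      ≤ ∫ t : ℝ, 18 * D * 3 * (2560 * T ^ (3 : ℝ)) *
          gaussWeight (3 / 2 * T) (Real.sqrt 2 * (δ * T)) t := by
        refine integral_mono_of_nonneg (Filter.Eventually.of_forall fun t => norm_nonneg _)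
          ((integrable_gaussWeight _ hB2).const_mul _)
          (Filter.Eventually.of_forall fun t => (hf t).trans ?_)
        have h1 := norm_xiFactor_three_le t
        have h2 := one_add_abs_rpow_mul_gaussWeight_le (p := 3) (by norm_num) (by norm_num) hT
          hδ0 hδ1 t
        rw [show (3 : ℝ) = ((3 : ℕ) : ℝ) by norm_num, Real.rpow_natCast] at h2
        norm_num at h2
        have hG := gaussWeight_pos (3 / 2 * T) (δ * T) t
        have h3 := exp_sq_div_le (σ := 3) (by norm_num) le_rfl hB5
        rw [norm_lineKernel]
        calc _ = ‖xiFactor ((3 : ℝ) + t * Complex.I)‖ * Real.exp (Real.pi / 4 * t) * D *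
              Real.exp (((3 - 1 / 2) / (δ * T)) ^ 2) * gaussWeight (3 / 2 * T) (δ * T) t := by ring
          _ ≤ 18 * (1 + |t|) ^ 3 * D * 3 * gaussWeight (3 / 2 * T) (δ * T) t := by gcongr
          _ = 18 * D * 3 * ((1 + |t|) ^ 3 * gaussWeight (3 / 2 * T) (δ * T) t) := by ring
          _ ≤ 18 * D * 3 * (2560 * T ^ 3 *
              gaussWeight (3 / 2 * T) (Real.sqrt 2 * (δ * T)) t) := by gcongr
          _ = _ := by
            rw [show (3 : ℝ) = ((3 : ℕ) : ℝ) by norm_num, Real.rpow_natCast]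
            norm_num
            ring
    _ = 18 * D * 3 * (2560 * T ^ (3 : ℝ)) * (Real.sqrt Real.pi * (Real.sqrt 2 * (δ * T))) := by
        rw [integral_const_mul, integral_gaussWeight _ hB2]
    _ = _ := by ring

/-- Lower bound for the polynomial norm to the right of the critical line. -/
lemma exists_le_lineNorm_polyLine : ∃ c, 0 < c ∧ ∀ T δ σ : ℝ, ∀ N : ℕ, 2 ≤ T → 0 < δ → δ ≤ 1 / 4 →
    1 / 2 ≤ σ → σ ≤ 1 → 1 ≤ N →
    (N : ℝ) ^ 2 * Real.exp (-(δ * T / (2 * N)) ^ 2) ≤ 1 / 4 →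
    (N : ℝ) ^ 2 * Real.exp (-(Real.sqrt 2 * (δ * T) / (2 * N)) ^ 2) ≤ 1 / 4 →
    c * (T ^ (7 / 4 : ℝ) * (δ * T)) * diagSum N σ ≤
      lineNorm (polyLine N (Real.pi / 4) (3 / 2 * T) (δ * T)) σ := by
  obtain ⟨c, hc0, hc⟩ := exists_le_norm_xiFactor
  refine ⟨c * Real.sqrt Real.pi * (1 / 4), by positivity,
    fun T δ σ N hT hδ0 hδ1 hσ0 hσ1 hN hoff1 hoff2 => ?_⟩
  have hT0 : 0 < T := by linarith
  have hB : 0 < δ * T := by positivity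
  have hB2 : 0 < Real.sqrt 2 * (δ * T) := by positivity
  have hσ : 0 ≤ σ := by linarith
  have h1 := (meanSquare_bounds hN hσ hB (3 / 2 * T) hoff1).1
  have h2 := (meanSquare_bounds hN hσ hB2 (3 / 2 * T) hoff2).2
  have hi1 := integrable_sqrtZetaPoly_sq_mul N hσ hB (3 / 2 * T)
  have hi2 := integrable_sqrtZetaPoly_sq_mul N hσ hB2 (3 / 2 * T)
  set A := ∫ t : ℝ, ‖sqrtZetaPoly N (σ + t * Complex.I)‖ ^ 2 * gaussWeight (3 / 2 * T) (δ * T) t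
  set A' := ∫ t : ℝ, ‖sqrtZetaPoly N (σ + t * Complex.I)‖ ^ 2 *
    gaussWeight (3 / 2 * T) (Real.sqrt 2 * (δ * T)) t
  have hle : c * T ^ (7 / 4 : ℝ) * (A - Real.exp (-2) * A') ≤
      lineNorm (polyLine N (Real.pi / 4) (3 / 2 * T) (δ * T)) σ := by
    rw [← integral_const_mul, ← integral_sub hi1 (hi2.const_mul _), ← integral_const_mul]
    refine integral_mono ((hi1.sub (hi2.const_mul _)).const_mul _)
      ((stripDecay_polyLine N _ _ hB).integrable_line (by linarith)).norm fun t => ?_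
    simp only [polyLine, norm_mul, norm_pow, norm_lineKernel]
    set X := ‖sqrtZetaPoly N (σ + t * Complex.I)‖ ^ 2 with hX
    have hX0 : 0 ≤ X := by positivity
    have hG := gaussWeight_pos (3 / 2 * T) (δ * T) t
    have hG2 := gaussWeight_pos (3 / 2 * T) (Real.sqrt 2 * (δ * T)) t
    have hE := Real.exp_pos (-2)
    by_cases ht : T ≤ t ∧ t ≤ 2 * T
    · have h3 := hc σ t hσ0 hσ1 (by linarith)
      have h4 : T ^ (7 / 4 : ℝ) ≤ t ^ (7 / 4 : ℝ) :=
        Real.rpow_le_rpow hT0.le ht.1 (by norm_num)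
      have h5 : 1 ≤ Real.exp (((σ - 1 / 2) / (δ * T)) ^ 2) := Real.one_le_exp (sq_nonneg _)
      calc c * T ^ (7 / 4 : ℝ) * (X * gaussWeight (3 / 2 * T) (δ * T) t -
            Real.exp (-2) * (X * gaussWeight (3 / 2 * T) (Real.sqrt 2 * (δ * T)) t))
          ≤ c * T ^ (7 / 4 : ℝ) * (X * gaussWeight (3 / 2 * T) (δ * T) t) :=
            mul_le_mul_of_nonneg_left (sub_le_self _ (by positivity)) (by positivity)
        _ ≤ c * t ^ (7 / 4 : ℝ) * (X * gaussWeight (3 / 2 * T) (δ * T) t) := by gcongr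
        _ ≤ ‖xiFactor (σ + t * Complex.I)‖ * Real.exp (Real.pi / 4 * t) *
            (X * gaussWeight (3 / 2 * T) (δ * T) t) := by gcongr
        _ ≤ ‖xiFactor (σ + t * Complex.I)‖ * Real.exp (Real.pi / 4 * t) *
            (X * gaussWeight (3 / 2 * T) (δ * T) t) *
            Real.exp (((σ - 1 / 2) / (δ * T)) ^ 2) := le_mul_of_one_le_right (by positivity) h5
        _ = _ := by ring
    · refine le_trans ?_ (by positivity : (0 : ℝ) ≤ _)
      have h3 : gaussWeight (3 / 2 * T) (δ * T) t ≤
          Real.exp (-2) * gaussWeight (3 / 2 * T) (Real.sqrt 2 * (δ * T)) t := by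
        rw [gaussWeight_sqrt_two, gaussWeight, ← Real.exp_add, Real.exp_le_exp]
        have h4 : 2 ^ 2 ≤ ((t - 3 / 2 * T) / (δ * T)) ^ 2 := by
          rw [sq_le_sq, abs_div, abs_of_pos hB, le_div_iff₀ hB, abs_of_pos (by norm_num : (0:ℝ) < 2)]
          have : 2 * (δ * T) ≤ T / 2 := by nlinarith
          refine this.trans ?_
          by_contra! hlt
          obtain ⟨h5, h6⟩ := abs_lt.1 hlt
          exact ht ⟨by linarith, by linarith⟩
        linarith
      refine mul_nonpos_of_nonneg_of_nonpos (by positivity) ?_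
      nlinarith [mul_le_mul_of_nonneg_left h3 hX0]
  refine le_trans ?_ hle
  have hS := one_le_diagSum hN σ
  have hs2 : Real.sqrt 2 ≤ 3 / 2 := by
    rw [Real.sqrt_le_left (by norm_num)]; norm_num
  have he : Real.exp (-2) ≤ 1 / 4 := by
    rw [Real.exp_neg, one_div]
    apply inv_anti₀ (by norm_num)
    have := Real.add_one_le_exp (1 : ℝ)
    rw [show (2 : ℝ) = 1 + 1 by norm_num, Real.exp_add]
    nlinarith
  set Y := Real.sqrt Real.pi * (δ * T) * diagSum N σ with hY
  have hY0 : 0 ≤ Y := by positivity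
  have h6 : A' ≤ 15 / 8 * Y := by
    refine h2.trans ?_
    have : Real.sqrt Real.pi * (Real.sqrt 2 * (δ * T)) * diagSum N σ = Real.sqrt 2 * Y := by
      rw [hY]; ring
    rw [this]
    nlinarith
  have h7 : Real.exp (-2) * A' ≤ 1 / 4 * (15 / 8 * Y) :=
    mul_le_mul he h6 (integral_nonneg fun t =>
      mul_nonneg (by positivity) (gaussWeight_pos _ _ _).le) (by norm_num)
  calc c * Real.sqrt Real.pi * (1 / 4) * (T ^ (7 / 4 : ℝ) * (δ * T)) * diagSum N σ
      = c * T ^ (7 / 4 : ℝ) * (1 / 4 * Y) := by rw [hY]; ring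
    _ ≤ _ := by
      gcongr
      linarith

lemma rpow_rpow_div_log {T q κ : ℝ} (hT : 1 < T) :
    (T ^ q) ^ ((1 / 2 + κ / Real.log T - 1 / 2) / (3 - 1 / 2)) = Real.exp (q * κ * (2 / 5)) := by
  have hl : Real.log T ≠ 0 := (Real.log_pos hT).ne'
  rw [← Real.rpow_mul (by linarith), Real.rpow_def_of_pos (by linarith)]
  congr 1
  field_simp
  ring

set_option maxHeartbeats 1000000 in
/-- The basic comparison between `xiLine` and `polyLine` slightly to the right of the critical
line. -/
lemma exists_comparison : ∃ C, 0 < C ∧ ∀ κ δ : ℝ, 0 < κ → 0 < δ → δ ≤ 1 → ∃ T₀ : ℝ, ∀ T ≥ T₀,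
    ∃ N : ℕ, 1 ≤ N ∧ T ^ (1 / 2 : ℝ) ≤ N ∧
    (N : ℝ) ^ 2 * Real.exp (-(δ * T / (2 * N)) ^ 2) ≤ 1 / 4 ∧
    (N : ℝ) ^ 2 * Real.exp (-(Real.sqrt 2 * (δ * T) / (2 * N)) ^ 2) ≤ 1 / 4 ∧
    lineNorm (xiLine (Real.pi / 4) (3 / 2 * T) (δ * T)) (1 / 2) ≤
      Real.exp (κ / 2) * (C * (T ^ (7 / 4 : ℝ) * (δ * T)) * Real.log T ^ (1 / 4 : ℝ)) +
      Real.exp (-(κ / 10)) * (lineNorm (xiLine (Real.pi / 4) (3 / 2 * T) (δ * T)) (1 / 2) +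
        C * (T ^ (7 / 4 : ℝ) * (δ * T)) * Real.log T ^ (1 / 4 : ℝ)) ∧
    lineNorm (polyLine N (Real.pi / 4) (3 / 2 * T) (δ * T)) (1 / 2 + κ / Real.log T) ≤
      Real.exp (κ / 2) * (lineNorm (xiLine (Real.pi / 4) (3 / 2 * T) (δ * T)) (1 / 2) +
        C * (T ^ (7 / 4 : ℝ) * (δ * T))) +
      Real.exp (-(κ / 10)) * (lineNorm (xiLine (Real.pi / 4) (3 / 2 * T) (δ * T)) (1 / 2) +
        C * (T ^ (7 / 4 : ℝ) * (δ * T)) * Real.log T ^ (1 / 4 : ℝ)) := by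
  obtain ⟨C₁, hC₁, hP⟩ := exists_lineNorm_polyLine_half_le
  obtain ⟨C₂, hC₂, h3⟩ := exists_lineNorm_three_le
  obtain ⟨Cz, hCz, hz⟩ := exists_norm_riemannZeta_three_le
  obtain ⟨Cd, hCd, hd⟩ := exists_norm_riemannZeta_sub_sq_le
  obtain ⟨Cs, T₁, hCs, hs⟩ := exists_sum_sqrtZeta_sq_le
  obtain ⟨T₂, hT₂⟩ := exists_polyLength
  set C := C₁ * Cs + C₂ * (Cz + Cd) + C₂ * (4 * Cd) with hC
  have hCpos : 0 < C := by positivity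
  have hCz' : C₂ * Cz ≤ C := by
    rw [hC]
    have : 0 ≤ C₁ * Cs + C₂ * Cd + C₂ * (4 * Cd) := by positivity
    linarith
  have hCp' : C₁ * Cs + C₂ * (Cz + Cd) ≤ C := by
    rw [hC]
    have : 0 ≤ C₂ * (4 * Cd) := by positivity
    linarith
  have hCd' : C₁ * Cs + C₂ * (4 * Cd) ≤ C := by
    rw [hC]
    have : 0 ≤ C₂ * (Cz + Cd) := by positivity
    linarith
  refine ⟨C, hCpos, fun κ δ hκ hδ0 hδ1 => ?_⟩
  obtain ⟨T₃, hT₃⟩ := exists_offDiag_le hδ0 (ε := 1 / 4) (by norm_num)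
  obtain ⟨T₄, hT₄⟩ := Filter.eventually_atTop.1
    (Real.tendsto_log_atTop.eventually_ge_atTop (2 * κ + 1))
  refine ⟨max (max T₁ T₂) (max (max T₃ T₄) (5 / 2 / δ)), fun T hT => ?_⟩
  simp only [ge_iff_le, max_le_iff] at hT
  obtain ⟨⟨hTs, hTN⟩, ⟨hToff, hTlog⟩, hTδ⟩ := hT
  have hB5 : 5 / 2 ≤ δ * T := by rwa [div_le_iff₀' hδ0] at hTδ
  have hT2 : 5 / 2 ≤ T := by
    by_contra! h
    nlinarith
  have hT0 : 0 < T := by linarith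
  have hB : 0 < δ * T := by positivity
  have hlog := hT₄ T hTlog
  have hlogpos : 0 < Real.log T := by linarith
  obtain ⟨N, hN1, hN67, hNhalf, hN74⟩ := hT₂ T hTN
  have hoff1 := hT₃ T hToff N hN1 hN67 (δ * T) le_rfl
  have hs21 : 1 ≤ Real.sqrt 2 := Real.one_le_sqrt.2 (by norm_num)
  have hoff2 := hT₃ T hToff N hN1 hN67 (Real.sqrt 2 * (δ * T)) (le_mul_of_one_le_left hB.le hs21)
  have hNT : (N : ℝ) ≤ T := by
    refine hN67.trans ((Real.rpow_le_rpow_of_exponent_le (by linarith) (by norm_num)).trans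
      (Real.rpow_one T).le)
  have hsum : diagSum N (1 / 2) ≤ Cs * Real.log T ^ (1 / 4 : ℝ) := by
    have := hs T hTs N hNT
    simpa [diagSum] using this
  refine ⟨N, hN1, hNhalf, hoff1, hoff2, ?_⟩
  set σ := 1 / 2 + κ / Real.log T with hσ
  have hσ1 : 1 / 2 < σ := by
    have : 0 < κ / Real.log T := by positivity
    linarith
  have hσ2 : σ < 1 := by
    have : κ / Real.log T < 1 / 2 := by rw [div_lt_iff₀ hlogpos]; linarith
    linarith
  set L := Real.log T ^ (1 / 4 : ℝ) with hL
  have hL1 : 1 ≤ L := Real.one_le_rpow (by linarith) (by norm_num)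
  set M := T ^ (7 / 4 : ℝ) * (δ * T) with hM
  have hM0 : 0 < M := by positivity
  set fx := xiLine (Real.pi / 4) (3 / 2 * T) (δ * T) with hfx
  set fp := polyLine N (Real.pi / 4) (3 / 2 * T) (δ * T) with hfp
  set fd := diffLine N (Real.pi / 4) (3 / 2 * T) (δ * T) with hfd
  have hx : StripDecay fx := stripDecay_xiLine _ _ hB
  have hp : StripDecay fp := stripDecay_polyLine N _ _ hB
  have hdd : StripDecay fd := stripDecay_diffLine N _ _ hB
  -- values on the line `3`
  have hN74' : (N : ℝ) ^ (-(7 / 4) : ℝ) ≤ 1 :=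
    Real.rpow_le_one_of_one_le_of_nonpos (by exact_mod_cast hN1) (by norm_num)
  have hre : ∀ t : ℝ, (((3 : ℝ) : ℂ) + t * Complex.I).re = 3 := fun t => by simp
  have hxi : ∀ t : ℝ, xiFun ((3 : ℝ) + t * Complex.I) =
      xiFactor ((3 : ℝ) + t * Complex.I) * riemannZeta ((3 : ℝ) + t * Complex.I) := fun t =>
    xiFun_eq (by rw [hre]; norm_num) (fun h => by
      have := congrArg Complex.re h
      rw [hre] at this
      norm_num at this)
  have hX3 : lineNorm fx 3 ≤ C₂ * Cz * (T ^ (3 : ℝ) * (δ * T)) := by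
    refine h3 T δ Cz fx (by linarith) hδ0 hδ1 hB5 hCz.le fun t => ?_
    rw [hfx, xiLine, hxi, norm_mul, norm_mul]
    gcongr
    exact hz _ (hre t)
  have hP3 : lineNorm fp 3 ≤ C₂ * (Cz + Cd) * (T ^ (3 : ℝ) * (δ * T)) := by
    refine h3 T δ (Cz + Cd) fp (by linarith) hδ0 hδ1 hB5 (by positivity) fun t => ?_
    rw [hfp, polyLine, norm_mul, norm_mul]
    gcongr
    have h4 := hd N hN1 _ (hre t)
    have h5 := norm_sub_norm_le (sqrtZetaPoly N ((3 : ℝ) + t * Complex.I) ^ 2)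
      (riemannZeta ((3 : ℝ) + t * Complex.I))
    rw [norm_sub_rev] at h5
    have h6 := hz _ (hre t)
    have h7 := mul_le_mul_of_nonneg_left hN74' hCd.le
    linarith
  have hD3 : lineNorm fd 3 ≤ C₂ * (4 * Cd * T ^ (-(3 / 2) : ℝ)) * (T ^ (3 : ℝ) * (δ * T)) := by
    refine h3 T δ (4 * Cd * T ^ (-(3 / 2) : ℝ)) fd (by linarith) hδ0 hδ1 hB5 (by positivity)
      fun t => ?_
    rw [hfd, diffLine, xiLine, polyLine, hxi, ← sub_mul, ← mul_sub, norm_mul, norm_mul]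
    gcongr
    refine (hd N hN1 _ (hre t)).trans ((mul_le_mul_of_nonneg_left hN74 hCd.le).trans_eq ?_)
    ring
  -- interpolation
  have hX := hx.lineNorm_le_of_half_of_three (M := T ^ (5 / 4 : ℝ)) hσ1.le (by linarith)
    (by positivity)
  have hPP := hp.lineNorm_le_of_half_of_three (M := T ^ (5 / 4 : ℝ)) hσ1.le (by linarith)
    (by positivity)
  have hDD := hdd.lineNorm_le_of_half_of_three (M := T ^ (-(1 / 4) : ℝ)) hσ1.le (by linarith)
    (by positivity)
  rw [hσ, rpow_rpow_div_log (by linarith), ← hσ] at hX hPP hDD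
  rw [show 5 / 4 * κ * (2 / 5) = κ / 2 by ring] at hX hPP
  rw [show -(1 / 4) * κ * (2 / 5) = -(κ / 10) by ring] at hDD
  have e1 : T ^ (3 : ℝ) = T ^ (7 / 4 : ℝ) * T ^ (5 / 4 : ℝ) := by
    rw [← Real.rpow_add hT0]; norm_num
  have e2 : T ^ (-(3 / 2) : ℝ) * T ^ (3 : ℝ) = T ^ (7 / 4 : ℝ) * T ^ (-(1 / 4) : ℝ) := by
    rw [← Real.rpow_add hT0, ← Real.rpow_add hT0]; norm_num
  have hX3' : lineNorm fx 3 / T ^ (5 / 4 : ℝ) ≤ C₂ * Cz * M := by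
    rw [div_le_iff₀ (by positivity)]
    refine hX3.trans_eq ?_
    rw [e1, hM]; ring
  have hP3' : lineNorm fp 3 / T ^ (5 / 4 : ℝ) ≤ C₂ * (Cz + Cd) * M := by
    rw [div_le_iff₀ (by positivity)]
    refine hP3.trans_eq ?_
    rw [e1, hM]; ring
  have hD3' : lineNorm fd 3 / T ^ (-(1 / 4) : ℝ) ≤ C₂ * (4 * Cd) * M := by
    rw [div_le_iff₀ (by positivity)]
    refine hD3.trans_eq ?_
    calc C₂ * (4 * Cd * T ^ (-(3 / 2) : ℝ)) * (T ^ (3 : ℝ) * (δ * T))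
        = C₂ * (4 * Cd) * (δ * T) * (T ^ (-(3 / 2) : ℝ) * T ^ (3 : ℝ)) := by ring
      _ = _ := by rw [e2, hM]; ring
  have hPh : lineNorm fp (1 / 2) ≤ C₁ * Cs * M * L := by
    calc lineNorm fp (1 / 2) ≤ C₁ * M * diagSum N (1 / 2) :=
          hP T δ N (by linarith) hδ0 hδ1 hN1 hoff2
      _ ≤ C₁ * M * (Cs * L) := by gcongr
      _ = _ := by ring
  have hDh : lineNorm fd (1 / 2) ≤ lineNorm fx (1 / 2) + lineNorm fp (1 / 2) :=
    hx.lineNorm_sub_le hp (by norm_num)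
  have hML : M ≤ M * L := le_mul_of_one_le_right hM0.le hL1
  have hPσ : lineNorm fp σ ≤ Real.exp (κ / 2) * (C * M * L) := by
    refine hPP.trans ?_
    gcongr
    calc _ ≤ C₁ * Cs * M * L + C₂ * (Cz + Cd) * M := add_le_add hPh hP3'
      _ ≤ C₁ * Cs * M * L + C₂ * (Cz + Cd) * (M * L) := by gcongr
      _ = (C₁ * Cs + C₂ * (Cz + Cd)) * (M * L) := by ring
      _ ≤ C * (M * L) := by gcongr
      _ = _ := by ring
  have hXσ : lineNorm fx σ ≤ Real.exp (κ / 2) * (lineNorm fx (1 / 2) + C * M) := by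
    refine hX.trans ?_
    gcongr
    exact hX3'.trans (by gcongr)
  have hDσ : lineNorm fd σ ≤ Real.exp (-(κ / 10)) * (lineNorm fx (1 / 2) + C * M * L) := by
    refine hDD.trans (mul_le_mul_of_nonneg_left ?_ (Real.exp_pos _).le)
    calc _ ≤ lineNorm fx (1 / 2) + C₁ * Cs * M * L + C₂ * (4 * Cd) * M :=
          add_le_add (hDh.trans (add_le_add le_rfl hPh)) hD3'
      _ ≤ lineNorm fx (1 / 2) + C₁ * Cs * M * L + C₂ * (4 * Cd) * (M * L) := by gcongr
      _ = lineNorm fx (1 / 2) + (C₁ * Cs + C₂ * (4 * Cd)) * (M * L) := by ring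
      _ ≤ lineNorm fx (1 / 2) + C * (M * L) := by gcongr
      _ = _ := by ring
  have hσ0 : 0 < σ := by linarith
  constructor
  · refine (lineNorm_xiLine_half_le _ _ hB hσ1 hσ2).trans ?_
    exact (hx.lineNorm_le_add_sub hp hσ0).trans (add_le_add hPσ hDσ)
  · have h7 := hp.lineNorm_le_add_sub hx hσ0
    have h8 : lineNorm (fun s => fp s - fx s) σ = lineNorm fd σ :=
      integral_congr_ae (Filter.Eventually.of_forall fun t => norm_sub_rev _ _)
    rw [h8] at h7
    exact h7.trans (add_le_add hXσ hDσ)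

/-- Upper bound for the smoothed first moment. -/
theorem exists_lineNorm_xiLine_le : ∃ C, 0 < C ∧ ∀ δ : ℝ, 0 < δ → δ ≤ 1 → ∃ T₀ : ℝ, ∀ T ≥ T₀,
    lineNorm (xiLine (Real.pi / 4) (3 / 2 * T) (δ * T)) (1 / 2) ≤
      C * (T ^ (7 / 4 : ℝ) * (δ * T)) * Real.log T ^ (1 / 4 : ℝ) := by
  obtain ⟨C, hC, h⟩ := exists_comparison
  refine ⟨2 * (Real.exp (10 / 2) + 1) * C, by positivity, fun δ hδ0 hδ1 => ?_⟩
  obtain ⟨T₀, hT₀⟩ := h 10 δ (by norm_num) hδ0 hδ1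
  refine ⟨max T₀ 1, fun T hT => ?_⟩
  obtain ⟨N, -, -, -, -, hle, -⟩ := hT₀ T (le_of_max_le_left hT)
  have hT1 : 1 ≤ T := le_of_max_le_right hT
  have hlog : 0 ≤ Real.log T := Real.log_nonneg hT1
  set J := lineNorm (xiLine (Real.pi / 4) (3 / 2 * T) (δ * T)) (1 / 2) with hJ
  have hJ0 : 0 ≤ J := lineNorm_nonneg _ _
  set Y := C * (T ^ (7 / 4 : ℝ) * (δ * T)) * Real.log T ^ (1 / 4 : ℝ) with hY
  have hY0 : 0 ≤ Y := by positivity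
  have he : Real.exp (-(10 / 10)) ≤ 1 / 2 := by
    rw [Real.exp_neg, one_div]
    apply inv_anti₀ (by norm_num)
    have := Real.add_one_le_exp (1 : ℝ)
    norm_num at this ⊢
    linarith
  have h1 := mul_le_mul_of_nonneg_right he (add_nonneg hJ0 hY0)
  have : J ≤ 2 * (Real.exp (10 / 2) + 1) * Y := by nlinarith
  calc J ≤ _ := this
    _ = _ := by rw [hY]; ring

/-- Lower bound for the smoothed first moment. -/
theorem exists_le_lineNorm_xiLine : ∃ c, 0 < c ∧ ∀ δ : ℝ, 0 < δ → δ ≤ 1 / 4 → ∃ T₀ : ℝ, ∀ T ≥ T₀,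
    c * (T ^ (7 / 4 : ℝ) * (δ * T)) * Real.log T ^ (1 / 4 : ℝ) ≤
      lineNorm (xiLine (Real.pi / 4) (3 / 2 * T) (δ * T)) (1 / 2) := by
  obtain ⟨C, hC, h⟩ := exists_comparison
  obtain ⟨c₁, hc₁, hP⟩ := exists_le_lineNorm_polyLine
  obtain ⟨c₂, κ₀, hc₂, hκ₀, hs⟩ := exists_le_sum_sqrtZeta_sq
  have hlim : Filter.Tendsto (fun κ : ℝ => κ ^ (1 / 4 : ℝ) * Real.exp (-(1 / 10) * κ))
      Filter.atTop (nhds 0) := tendsto_rpow_mul_exp_neg_mul_atTop_nhds_zero _ _ (by norm_num)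
  obtain ⟨κ, hκ1, hκ2⟩ := ((hlim.eventually_le_const
    (show 0 < c₁ * c₂ / 4 / C by positivity)).and (Filter.eventually_ge_atTop κ₀)).exists
  have hκ : 0 < κ := hκ₀.trans_le hκ2
  have hκC : Real.exp (-(κ / 10)) * C ≤ c₁ * c₂ / 4 * κ ^ (-(1 / 4) : ℝ) := by
    rw [le_div_iff₀ hC] at hκ1
    rw [Real.rpow_neg hκ.le, ← div_eq_mul_inv, le_div_iff₀ (by positivity)]
    calc _ = κ ^ (1 / 4 : ℝ) * Real.exp (-(1 / 10) * κ) * C := by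
          rw [show -(1 / 10) * κ = -(κ / 10) by ring]; ring
      _ ≤ _ := hκ1
  set b := c₁ * c₂ / 4 * κ ^ (-(1 / 4) : ℝ) with hb
  have hb0 : 0 < b := by positivity
  refine ⟨b * 2 / (Real.exp (κ / 2) + 1), by positivity, fun δ hδ0 hδ1 => ?_⟩
  obtain ⟨T₁, hT₁⟩ := h κ δ hκ hδ0 (by linarith)
  obtain ⟨T₂, hT₂⟩ := hs κ hκ2
  have hL := (tendsto_rpow_atTop (show (0 : ℝ) < 1 / 4 by norm_num)).comp Real.tendsto_log_atTop
  obtain ⟨T₃, hT₃⟩ := Filter.eventually_atTop.1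
    (hL.eventually_ge_atTop (Real.exp (κ / 2) * C / b))
  obtain ⟨T₄, hT₄⟩ := Filter.eventually_atTop.1
    (Real.tendsto_log_atTop.eventually_ge_atTop (2 * κ + 1))
  refine ⟨max (max T₁ T₂) (max (max T₃ T₄) 2), fun T hT => ?_⟩
  simp only [ge_iff_le, max_le_iff] at hT
  obtain ⟨⟨h1, h2⟩, ⟨h3, h4⟩, hT2⟩ := hT
  obtain ⟨N, hN1, hNh, hoff1, hoff2, -, hle⟩ := hT₁ T h1
  have hsum := hT₂ T h2 N hNh
  have hL3 := hT₃ T h3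
  have hlog := hT₄ T h4
  have hlogpos : 0 < Real.log T := by linarith
  have hσ0 : 0 ≤ κ / Real.log T := by positivity
  have hσ1 : κ / Real.log T ≤ 1 / 2 := by rw [div_le_iff₀ hlogpos]; linarith
  have hlow := hP T δ (1 / 2 + κ / Real.log T) N hT2 hδ0 hδ1 (by linarith) (by linarith) hN1
    hoff1 hoff2
  have hdiag : c₂ * κ ^ (-(1 / 4) : ℝ) * Real.log T ^ (1 / 4 : ℝ) ≤
      diagSum N (1 / 2 + κ / Real.log T) := by
    refine hsum.trans_eq ?_
    rw [diagSum]
    ring_nf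
  have hT0 : 0 < T := by linarith
  set L := Real.log T ^ (1 / 4 : ℝ) with hLdef
  set M := T ^ (7 / 4 : ℝ) * (δ * T) with hM
  have hM0 : 0 < M := by positivity
  have hL0 : 0 ≤ L := by positivity
  set J := lineNorm (xiLine (Real.pi / 4) (3 / 2 * T) (δ * T)) (1 / 2) with hJ
  have hJ0 : 0 ≤ J := lineNorm_nonneg _ _
  have h5 : 4 * b * (M * L) ≤ c₁ * M * diagSum N (1 / 2 + κ / Real.log T) := by
    calc 4 * b * (M * L) = c₁ * M * (c₂ * κ ^ (-(1 / 4) : ℝ) * L) := by rw [hb]; ring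
      _ ≤ _ := by gcongr
  have h6 : Real.exp (κ / 2) * C ≤ b * L := by
    have : Real.exp (κ / 2) * C / b ≤ L := hL3
    rwa [div_le_iff₀' hb0] at this
  have h7 : Real.exp (κ / 2) * C * M ≤ b * L * M := by gcongr
  have h8 : Real.exp (-(κ / 10)) * C * (M * L) ≤ b * (M * L) := by gcongr
  have h9 : Real.exp (-(κ / 10)) * J ≤ 1 * J := by
    gcongr
    exact Real.exp_le_one_iff.2 (by linarith)
  have h10 := h5.trans (hlow.trans hle)
  calc b * 2 / (Real.exp (κ / 2) + 1) * M * L = b * 2 * (M * L) / (Real.exp (κ / 2) + 1) := by ring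
    _ ≤ J := by
      rw [div_le_iff₀ (by positivity)]
      nlinarith

lemma integrableOn_rpow_mul_exp_neg_mul {b ρ : ℝ} (hb : 0 < b) (hρ : 0 < ρ) :
    IntegrableOn (fun x : ℝ => x ^ (b - 1) * Real.exp (-(ρ * x))) (Set.Ioi 0) := by
  have h := integrableOn_rpow_mul_exp_neg_mul_rpow (p := 1) (s := b - 1) (by linarith) one_pos hρ
  simpa using h

/-- The Gamma integral along a rotated ray. -/
lemma integral_cpow_mul_exp_neg_mul_Ioi_of_re_pos {a r : ℂ} (ha : 0 < a.re) (hr : 0 < r.re) :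
    ∫ x : ℝ in Set.Ioi 0, (x : ℂ) ^ (a - 1) * Complex.exp (-(r * x)) =
      r ^ (-a) * Complex.Gamma a := by
  set F : ℂ → ℂ := fun r => ∫ x : ℝ in Set.Ioi 0, (x : ℂ) ^ (a - 1) * Complex.exp (-(r * x))
  have hopen : IsOpen {r : ℂ | 0 < r.re} := isOpen_lt continuous_const Complex.continuous_re
  have hF : DifferentiableOn ℂ F {r : ℂ | 0 < r.re} := by
    intro z hz
    have hz0 : 0 < z.re := hz
    refine (differentiableAt_integral_of_dominated (R := z.re / 2)
      (bound := fun x => x ^ (a.re - 1) * Real.exp (-(z.re / 2 * x))) (by positivity)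
      (fun w _ => ?_) ?_ (integrableOn_rpow_mul_exp_neg_mul ha (by positivity))
      ?_).differentiableWithinAt
    · refine ContinuousOn.aestronglyMeasurable ?_ measurableSet_Ioi
      refine ContinuousOn.mul (fun x hx => ?_) (by fun_prop)
      exact (Complex.continuousAt_ofReal_cpow_const x _ (Or.inr
        (ne_of_gt hx))).continuousWithinAt
    · refine (ae_restrict_iff' measurableSet_Ioi).2 (Filter.Eventually.of_forall fun x hx w hw => ?_)
      have hx0 : 0 < x := hx
      have hw1 : z.re / 2 ≤ w.re := by
        rw [Metric.mem_ball, dist_eq_norm] at hw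
        have := (Complex.abs_re_le_norm (w - z)).trans hw.le
        rw [Complex.sub_re] at this
        linarith [(abs_le.1 this).1]
      rw [norm_mul, Complex.norm_cpow_eq_rpow_re_of_pos hx0, Complex.norm_exp]
      simp only [Complex.sub_re, Complex.one_re, Complex.neg_re, Complex.mul_re, Complex.ofReal_re,
        Complex.ofReal_im, mul_zero, sub_zero]
      gcongr
    · exact Filter.Eventually.of_forall fun x => by fun_prop
  have hG : DifferentiableOn ℂ (fun r : ℂ => r ^ (-a) * Complex.Gamma a) {r : ℂ | 0 < r.re} := by
    refine DifferentiableOn.mul_const (fun z hz => ?_) _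
    exact (DifferentiableAt.cpow_const differentiableAt_id (Or.inl hz)).differentiableWithinAt
  have hpre : IsPreconnected {r : ℂ | 0 < r.re} :=
    (convex_halfSpace_re_gt 0).isPreconnected
  have hfreq : ∃ᶠ z in nhdsWithin (1 : ℂ) {1}ᶜ, F z = z ^ (-a) * Complex.Gamma a := by
    have htend : Filter.Tendsto (fun n : ℕ => ((1 + 1 / ((n : ℝ) + 1) : ℝ) : ℂ)) Filter.atTop
        (nhdsWithin (1 : ℂ) {1}ᶜ) := by
      refine tendsto_nhdsWithin_iff.2 ⟨?_, Filter.Eventually.of_forall fun n => ?_⟩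
      · have h1 : Filter.Tendsto (fun n : ℕ => 1 + 1 / ((n : ℝ) + 1)) Filter.atTop
            (nhds (1 + 0)) := tendsto_const_nhds.add tendsto_one_div_add_atTop_nhds_zero_nat
        rw [add_zero] at h1
        have h2 := (Complex.continuous_ofReal.tendsto 1).comp h1
        rw [Complex.ofReal_one] at h2
        exact h2
      · have : (0 : ℝ) < 1 / ((n : ℝ) + 1) := by positivity
        rw [Set.mem_compl_singleton_iff]
        exact Complex.ofReal_ne_one.2 (by linarith)
    refine htend.frequently (Filter.Eventually.of_forall fun n => ?_).frequently
    set q : ℝ := 1 + 1 / ((n : ℝ) + 1) with hq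
    have hq0 : 0 < q := by positivity
    have h := Complex.integral_cpow_mul_exp_neg_mul_Ioi ha hq0
    refine h.trans ?_
    rw [one_div, Complex.inv_cpow _ _ (by
      rw [Complex.arg_ofReal_of_nonneg hq0.le]; exact Real.pi_pos.ne), Complex.cpow_neg]
  exact (hF.analyticOnNhd hopen).eqOn_of_preconnected_of_frequently_eq (hG.analyticOnNhd hopen)
    hpre (by simp : (1 : ℂ) ∈ {r : ℂ | 0 < r.re}) hfreq hr

/-- Pairing the Gamma function on a vertical line with an integrable function. -/
lemma norm_integral_cpow_mul_Gamma_le {b : ℝ} {r : ℂ} (hb : 0 < b) (hr : 0 < r.re) {g : ℝ → ℂ}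
    (hg : Integrable g) {W : ℝ → ℝ}
    (hW : ∀ x : ℝ, 0 < x →
      ‖∫ t : ℝ, Complex.exp ((Real.log x / 2 * t : ℝ) * Complex.I) * g t‖ ≤ W x)
    (hWi : IntegrableOn (fun x : ℝ => x ^ (b - 1) * Real.exp (-(r.re * x)) * W x) (Set.Ioi 0)) :
    (Integrable fun t : ℝ => r ^ (-((b : ℂ) + t / 2 * Complex.I)) *
        Complex.Gamma ((b : ℂ) + t / 2 * Complex.I) * g t) ∧
    ‖∫ t : ℝ, r ^ (-((b : ℂ) + t / 2 * Complex.I)) *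
        Complex.Gamma ((b : ℂ) + t / 2 * Complex.I) * g t‖ ≤
      ∫ x : ℝ in Set.Ioi 0, x ^ (b - 1) * Real.exp (-(r.re * x)) * W x := by
  set E : ℝ → ℝ → ℂ := fun t x => (((x ^ (b - 1) : ℝ) : ℂ) * Complex.exp (-(r * x))) *
    (Complex.exp ((Real.log x / 2 * t : ℝ) * Complex.I) * g t) with hE
  have h1 : ∀ t : ℝ, r ^ (-((b : ℂ) + t / 2 * Complex.I)) *
        Complex.Gamma ((b : ℂ) + t / 2 * Complex.I) * g t =
      ∫ x : ℝ in Set.Ioi 0, E t x := by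
    intro t
    rw [← integral_cpow_mul_exp_neg_mul_Ioi_of_re_pos (by simpa using hb) hr,
      ← integral_mul_const]
    refine setIntegral_congr_fun measurableSet_Ioi fun x hx => ?_
    have hx0 : 0 < x := hx
    have hx0' : (x : ℂ) ≠ 0 := by exact_mod_cast hx0.ne'
    simp only [hE]
    rw [show (b : ℂ) + t / 2 * Complex.I - 1 = ((b - 1 : ℝ) : ℂ) + t / 2 * Complex.I by
      push_cast; ring, Complex.cpow_add _ _ hx0', ← Complex.ofReal_cpow hx0.le,
      Complex.cpow_def_of_ne_zero hx0', ← Complex.ofReal_log hx0.le]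
    rw [show ((Real.log x / 2 * t : ℝ) : ℂ) * Complex.I =
      (Real.log x : ℂ) * (t / 2 * Complex.I) by push_cast; ring]
    ring
  have hnorm : ∀ t x : ℝ, ‖Complex.exp ((Real.log x / 2 * t : ℝ) * Complex.I) * g t‖ = ‖g t‖ := by
    intro t x
    rw [norm_mul, Complex.norm_exp_ofReal_mul_I, one_mul]
  have hxi : IntegrableOn (fun x : ℝ => ((x ^ (b - 1) : ℝ) : ℂ) * Complex.exp (-(r * x)))
      (Set.Ioi 0) := by
    refine (integrableOn_rpow_mul_exp_neg_mul hb hr).mono' ?_ ?_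
    · refine (Measurable.mul ?_ (by fun_prop)).aestronglyMeasurable
      exact Complex.measurable_ofReal.comp (measurable_id.pow_const _)
    · refine (ae_restrict_iff' measurableSet_Ioi).2 (Filter.Eventually.of_forall fun x hx => ?_)
      have hx0 : 0 < x := hx
      rw [norm_mul, Complex.norm_real, Real.norm_of_nonneg (by positivity), Complex.norm_exp]
      simp
  have h_int : Integrable (Function.uncurry E) (volume.prod (volume.restrict (Set.Ioi 0))) := by
    have h2 : Integrable (fun p : ℝ × ℝ => g p.1 * (((p.2 ^ (b - 1) : ℝ) : ℂ) *
        Complex.exp (-(r * p.2)))) (volume.prod (volume.restrict (Set.Ioi 0))) :=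
      hg.mul_prod hxi
    have h3 : AEStronglyMeasurable (fun p : ℝ × ℝ =>
        Complex.exp ((Real.log p.2 / 2 * p.1 : ℝ) * Complex.I))
        (volume.prod (volume.restrict (Set.Ioi 0))) := by
      refine Measurable.aestronglyMeasurable ?_
      have : Measurable fun p : ℝ × ℝ => Real.log p.2 / 2 * p.1 :=
        ((Real.measurable_log.comp measurable_snd).div_const 2).mul measurable_fst
      exact Complex.measurable_exp.comp ((Complex.measurable_ofReal.comp this).mul_const _)
    refine (h2.norm).mono' ((h2.aestronglyMeasurable.mul h3).congr
      (Filter.Eventually.of_forall fun p => ?_)) (Filter.Eventually.of_forall fun p => ?_)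
    · simp only [Function.uncurry, hE, Pi.mul_apply]
      ring
    · simp only [Function.uncurry, hE]
      rw [norm_mul, hnorm, norm_mul (g p.1), mul_comm]
  simp_rw [h1]
  refine ⟨h_int.integral_prod_left, ?_⟩
  rw [integral_integral_swap h_int]
  refine norm_integral_le_of_norm_le hWi ?_
  refine (ae_restrict_iff' measurableSet_Ioi).2 (Filter.Eventually.of_forall fun x hx => ?_)
  have hx0 : 0 < x := hx
  simp only [hE]
  rw [integral_const_mul, norm_mul, norm_mul, Complex.norm_real, Real.norm_of_nonneg (by positivity),
    Complex.norm_exp]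
  simp only [Complex.neg_re, Complex.mul_re, Complex.ofReal_re, Complex.ofReal_im, mul_zero,
    sub_zero]
  exact mul_le_mul_of_nonneg_left (hW x hx0) (by positivity)

lemma exp_mul_gaussWeight_le {B : ℝ} (hB : 5 / 2 ≤ B) (v : ℝ) :
    Real.exp (7 / 8 * v) * gaussWeight (-(10 / B ^ 2)) (4 / B) v ≤
      3 * gaussWeight (-(10 / B ^ 2)) (Real.sqrt 2 * (4 / B)) v := by
  have hB0 : 0 < B := by linarith
  rw [gaussWeight_sqrt_two, gaussWeight, ← Real.exp_add]
  set u : ℝ := (v - -(10 / B ^ 2)) / (4 / B) with hu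
  have hv : v = 4 / B * u - 10 / B ^ 2 := by
    rw [hu]; field_simp; ring
  have h1 : v ≤ 8 / 5 * |u| := by
    have h2 : 4 / B * u ≤ 4 / B * |u| := mul_le_mul_of_nonneg_left (le_abs_self u) (by positivity)
    have h3 : 4 / B ≤ 8 / 5 := by rw [div_le_iff₀ hB0]; linarith
    have h4 : 4 / B * |u| ≤ 8 / 5 * |u| := mul_le_mul_of_nonneg_right h3 (abs_nonneg u)
    have h5 : 0 ≤ 10 / B ^ 2 := by positivity
    linarith
  have h6 : 7 / 8 * v + -u ^ 2 ≤ 1 + -u ^ 2 / 2 := by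
    nlinarith [sq_abs u, sq_nonneg (|u| - 7 / 5)]
  calc _ ≤ Real.exp (1 + -u ^ 2 / 2) := Real.exp_le_exp.2 h6
    _ = Real.exp 1 * Real.exp (-u ^ 2 / 2) := Real.exp_add _ _
    _ ≤ _ := mul_le_mul_of_nonneg_right Real.exp_one_lt_three.le (Real.exp_pos _).le

/-- A log-normal density against `x ^ (-1/8)`. -/
lemma integral_rpow_mul_logNormal_le {B : ℝ} (hB : 5 / 2 ≤ B) :
    IntegrableOn (fun x : ℝ => x ^ (-(1 / 8) : ℝ) *
      (B * Real.exp (-(B * (Real.log x / 2 + 5 / B ^ 2) / 2) ^ 2))) (Set.Ioi 0) ∧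
    ∫ x in Set.Ioi 0, x ^ (-(1 / 8) : ℝ) *
      (B * Real.exp (-(B * (Real.log x / 2 + 5 / B ^ 2) / 2) ^ 2)) ≤ 48 := by
  have hB0 : 0 < B := by linarith
  set h : ℝ → ℝ := fun x => x ^ (-(1 / 8) : ℝ) *
      (B * Real.exp (-(B * (Real.log x / 2 + 5 / B ^ 2) / 2) ^ 2)) with hh
  set H : ℝ → ℝ := fun v =>
    B * (Real.exp (7 / 8 * v) * gaussWeight (-(10 / B ^ 2)) (4 / B) v) with hH
  have hsub : ∀ v : ℝ, |Real.exp v| • h (Real.exp v) = H v := by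
    intro v
    simp only [hh, hH, smul_eq_mul, Real.abs_exp, Real.log_exp, gaussWeight]
    rw [← Real.exp_mul, show v * -(1 / 8) = -(1 / 8) * v by ring,
      show B * (v / 2 + 5 / B ^ 2) / 2 = (v - -(10 / B ^ 2)) / (4 / B) by field_simp; ring,
      show 7 / 8 * v = v + -(1 / 8) * v by ring, Real.exp_add]
    ring
  have himg : Set.Ioi (0 : ℝ) = Real.exp '' Set.univ := by rw [Set.image_univ, Real.range_exp]
  have hder : ∀ x ∈ (Set.univ : Set ℝ), HasDerivWithinAt Real.exp (Real.exp x) Set.univ x :=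
    fun x _ => (Real.hasDerivAt_exp x).hasDerivWithinAt
  have hle : ∀ v, H v ≤ B * (3 * gaussWeight (-(10 / B ^ 2)) (Real.sqrt 2 * (4 / B)) v) :=
    fun v => mul_le_mul_of_nonneg_left (exp_mul_gaussWeight_le hB v) hB0.le
  have hdom : Integrable fun v =>
      B * (3 * gaussWeight (-(10 / B ^ 2)) (Real.sqrt 2 * (4 / B)) v) :=
    ((integrable_gaussWeight _ (by positivity)).const_mul 3).const_mul B
  have hHi : Integrable H := by
    refine hdom.mono' ?_ (Filter.Eventually.of_forall fun v => ?_)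
    · refine Continuous.aestronglyMeasurable ?_
      have := continuous_gaussWeight (-(10 / B ^ 2)) (4 / B)
      fun_prop
    · rw [Real.norm_of_nonneg]
      · exact hle v
      · have := gaussWeight_pos (-(10 / B ^ 2)) (4 / B) v
        positivity
  constructor
  · rw [himg, integrableOn_image_iff_integrableOn_abs_deriv_smul MeasurableSet.univ hder
      Real.exp_injective.injOn]
    simp_rw [hsub]
    exact hHi.integrableOn
  · change ∫ x in Set.Ioi 0, h x ≤ 48
    rw [himg, integral_image_eq_integral_abs_deriv_smul MeasurableSet.univ hder
      Real.exp_injective.injOn]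
    simp_rw [hsub]
    rw [setIntegral_univ]
    refine (integral_mono hHi hdom hle).trans ?_
    rw [integral_const_mul, integral_const_mul, integral_gaussWeight _ (by positivity)]
    have h2 : Real.sqrt 2 ≤ 2 := Real.sqrt_le_iff.2 (by norm_num)
    have h3 : Real.sqrt Real.pi ≤ 2 := Real.sqrt_le_iff.2 ⟨by norm_num, by
      linarith [Real.pi_lt_four]⟩
    calc B * (3 * (Real.sqrt Real.pi * (Real.sqrt 2 * (4 / B)))) =
        12 * (Real.sqrt Real.pi * Real.sqrt 2) := by field_simp; ring
      _ ≤ 12 * (2 * 2) := by gcongr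
      _ = 48 := by norm_num

lemma rpow_mul_exp_neg_le {a y : ℝ} (ha : 0 ≤ a) (ha3 : a ≤ 3) (hy : 0 < y) :
    y ^ a * Real.exp (-y) ≤ 7 := by
  have h1 : y ^ a ≤ 1 + y ^ 3 := by
    rcases le_total y 1 with h | h
    · have := Real.rpow_le_one hy.le h ha
      have : 0 < y ^ 3 := by positivity
      linarith
    · have := Real.rpow_le_rpow_of_exponent_le h ha3
      rw [show (3 : ℝ) = ((3 : ℕ) : ℝ) by norm_num, Real.rpow_natCast] at this
      exact this.trans (by linarith)
  have h2 : 1 + y ^ 3 ≤ 7 * Real.exp y := by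
    have h3 := Real.pow_div_factorial_le_exp y hy.le 3
    have h4 := Real.add_one_le_exp y
    norm_num [Nat.factorial] at h3
    linarith
  rw [Real.exp_neg, ← div_eq_mul_inv, div_le_iff₀ (Real.exp_pos _)]
  exact h1.trans h2

/-- The Gaussian factor of `lineKernel` on the line `Re s = 3`. -/
noncomputable def shiftedGauss (τ B t : ℝ) : ℂ :=
  Complex.exp (((5 / 2 + (t - τ) * Complex.I) / B) ^ 2)

lemma shiftedGauss_eq (τ t : ℝ) {B : ℝ} (hB : 0 < B) : shiftedGauss τ B t =
    ((Real.exp ((5 / 2 / B) ^ 2) : ℝ) : ℂ) * Complex.exp ((-(5 * τ / B ^ 2) : ℝ) * Complex.I) *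
      (Complex.exp ((5 / B ^ 2 * t : ℝ) * Complex.I) * (gaussWeight τ B t : ℂ)) := by
  have hB' : (B : ℂ) ≠ 0 := by exact_mod_cast hB.ne'
  rw [shiftedGauss, gaussWeight, Complex.ofReal_exp, Complex.ofReal_exp, ← Complex.exp_add,
    ← Complex.exp_add, ← Complex.exp_add]
  congr 1
  push_cast
  field_simp
  ring_nf
  rw [Complex.I_sq]
  ring

lemma integrable_shiftedGauss (τ : ℝ) {B : ℝ} (hB : 0 < B) : Integrable (shiftedGauss τ B) := by
  have h1 : Integrable fun t => Real.exp ((5 / 2 / B) ^ 2) * gaussWeight τ B t :=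
    (integrable_gaussWeight τ hB).const_mul _
  refine h1.mono' ?_ (Filter.Eventually.of_forall fun t => ?_)
  · refine Continuous.aestronglyMeasurable ?_
    unfold shiftedGauss
    fun_prop
  · rw [shiftedGauss_eq τ t hB, norm_mul, norm_mul, norm_mul, Complex.norm_exp_ofReal_mul_I,
      Complex.norm_exp_ofReal_mul_I, Complex.norm_real, Complex.norm_real, mul_one, one_mul,
      Real.norm_of_nonneg (Real.exp_pos _).le, Real.norm_of_nonneg (gaussWeight_pos _ _ _).le]

lemma norm_integral_exp_mul_shiftedGauss_le (τ ω : ℝ) {B : ℝ} (hB : 5 / 2 ≤ B) :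
    ‖∫ t : ℝ, Complex.exp ((ω * t : ℝ) * Complex.I) * shiftedGauss τ B t‖ ≤
      6 * (B * Real.exp (-(B * (ω + 5 / B ^ 2) / 2) ^ 2)) := by
  have hB0 : 0 < B := by linarith
  have h1 : ∀ t : ℝ, Complex.exp ((ω * t : ℝ) * Complex.I) * shiftedGauss τ B t =
      ((Real.exp ((5 / 2 / B) ^ 2) : ℝ) : ℂ) * Complex.exp ((-(5 * τ / B ^ 2) : ℝ) * Complex.I) *
      (Complex.exp (((ω + 5 / B ^ 2) * t : ℝ) * Complex.I) * (gaussWeight τ B t : ℂ)) := by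
    intro t
    rw [shiftedGauss_eq τ t hB0, show (((ω + 5 / B ^ 2) * t : ℝ) : ℂ) * Complex.I =
      (ω * t : ℝ) * Complex.I + (5 / B ^ 2 * t : ℝ) * Complex.I by push_cast; ring, Complex.exp_add]
    ring
  simp_rw [h1]
  rw [integral_const_mul, integral_exp_mul_gaussWeight _ _ hB0, norm_mul, norm_mul, norm_mul,
    Complex.norm_exp_ofReal_mul_I, Complex.norm_exp_ofReal_mul_I, Complex.norm_real,
    Complex.norm_real, mul_one, one_mul, Real.norm_of_nonneg (Real.exp_pos _).le,
    Real.norm_of_nonneg (by positivity)]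
  have h2 := exp_sq_div_le (σ := 3) (by norm_num) le_rfl hB
  rw [show ((3 : ℝ) - 1 / 2) = 5 / 2 by norm_num] at h2
  have h3 : Real.sqrt Real.pi ≤ 2 := Real.sqrt_le_iff.2 ⟨by norm_num, by
      linarith [Real.pi_lt_four]⟩
  calc _ ≤ 3 * (2 * B * Real.exp (-(B * (ω + 5 / B ^ 2) / 2) ^ 2)) := by gcongr
    _ = _ := by ring

lemma norm_integral_cpow_mul_Gamma_mul_shiftedGauss_le (τ : ℝ) {b B : ℝ} {r : ℂ} (hB : 5 / 2 ≤ B)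
    (hb : 1 ≤ b) (hb4 : b ≤ 7 / 2) (hr : 0 < r.re) :
    (Integrable fun t : ℝ => r ^ (-((b : ℂ) + t / 2 * Complex.I)) *
        Complex.Gamma ((b : ℂ) + t / 2 * Complex.I) * shiftedGauss τ B t) ∧
    ‖∫ t : ℝ, r ^ (-((b : ℂ) + t / 2 * Complex.I)) *
        Complex.Gamma ((b : ℂ) + t / 2 * Complex.I) * shiftedGauss τ B t‖ ≤
      2016 * r.re ^ (-(b - 7 / 8)) := by
  have hB0 : 0 < B := by linarith
  obtain ⟨h_int, hle⟩ := integral_rpow_mul_logNormal_le hB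
  set W : ℝ → ℝ := fun x => 6 * (B * Real.exp (-(B * (Real.log x / 2 + 5 / B ^ 2) / 2) ^ 2)) with hW
  have hpt : ∀ x : ℝ, 0 < x → x ^ (b - 1) * Real.exp (-(r.re * x)) * W x ≤
      42 * r.re ^ (-(b - 7 / 8)) * (x ^ (-(1 / 8) : ℝ) *
        (B * Real.exp (-(B * (Real.log x / 2 + 5 / B ^ 2) / 2) ^ 2))) := by
    intro x hx
    have h1 := rpow_mul_exp_neg_le (a := b - 7 / 8) (by linarith) (by linarith) (mul_pos hr hx)
    rw [Real.mul_rpow hr.le hx.le] at h1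
    have h2 : x ^ (b - 1) = x ^ (b - 7 / 8) * x ^ (-(1 / 8) : ℝ) := by
      rw [← Real.rpow_add hx]; ring_nf
    have h3 : r.re ^ (b - 7 / 8) * r.re ^ (-(b - 7 / 8)) = 1 := by
      rw [← Real.rpow_add hr]; simp
    have h4 : x ^ (b - 1) * Real.exp (-(r.re * x)) ≤
        7 * r.re ^ (-(b - 7 / 8)) * x ^ (-(1 / 8) : ℝ) := by
      calc _ = (r.re ^ (b - 7 / 8) * r.re ^ (-(b - 7 / 8))) * (x ^ (b - 7 / 8) *
            x ^ (-(1 / 8) : ℝ)) * Real.exp (-(r.re * x)) := by rw [h3, h2]; ring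
        _ = (r.re ^ (b - 7 / 8) * x ^ (b - 7 / 8) * Real.exp (-(r.re * x))) *
            (r.re ^ (-(b - 7 / 8)) * x ^ (-(1 / 8) : ℝ)) := by ring
        _ ≤ 7 * (r.re ^ (-(b - 7 / 8)) * x ^ (-(1 / 8) : ℝ)) := by gcongr
        _ = _ := by ring
    calc _ ≤ 7 * r.re ^ (-(b - 7 / 8)) * x ^ (-(1 / 8) : ℝ) * W x :=
          mul_le_mul_of_nonneg_right h4 (by positivity)
      _ = _ := by rw [hW]; ring
  have hdom := h_int.const_mul (42 * r.re ^ (-(b - 7 / 8)))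
  have hWi : IntegrableOn (fun x : ℝ => x ^ (b - 1) * Real.exp (-(r.re * x)) * W x)
      (Set.Ioi 0) := by
    refine Integrable.mono' hdom ?_ ?_
    · refine Measurable.aestronglyMeasurable ?_
      have : Measurable fun x : ℝ => x ^ (b - 1) := measurable_id.pow_const _
      fun_prop
    · refine (ae_restrict_iff' measurableSet_Ioi).2 (Filter.Eventually.of_forall fun x hx => ?_)
      have hx0 : 0 < x := hx
      rw [Real.norm_of_nonneg (by positivity)]
      exact hpt x hx0
  obtain ⟨hI, hN⟩ := norm_integral_cpow_mul_Gamma_le (by linarith) hr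
    (integrable_shiftedGauss τ hB0) (W := W)
    (fun x _ => norm_integral_exp_mul_shiftedGauss_le τ _ hB) hWi
  refine ⟨hI, hN.trans ?_⟩
  refine (setIntegral_mono_on hWi hdom measurableSet_Ioi fun x hx => hpt x hx).trans ?_
  rw [integral_const_mul]
  calc _ ≤ 42 * r.re ^ (-(b - 7 / 8)) * 48 := by gcongr
    _ = _ := by ring

lemma xiFactor_two_mul {w : ℂ} (hw : 0 < w.re) : xiFactor (2 * w) =
    (Real.pi : ℂ) ^ (-w) * (4 * Complex.Gamma (w + 2) - 6 * Complex.Gamma (w + 1)) := by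
  have h0 : w ≠ 0 := by rintro rfl; simp at hw
  have h1 : w + 1 ≠ 0 := by
    intro h
    have := congrArg Complex.re h
    simp at this
    linarith
  rw [show w + 2 = w + 1 + 1 by ring, Complex.Gamma_add_one _ h1, Complex.Gamma_add_one _ h0,
    xiFactor, Complex.Gammaℝ_def, show -(2 * w) / 2 = -w by ring, show 2 * w / 2 = w by ring]
  ring

/-- The ray point `π m² e^{2iφ}`. -/
noncomputable def rayPoint (φ m : ℝ) : ℂ :=
  ((Real.pi * m ^ 2 : ℝ) : ℂ) * Complex.exp ((2 * φ : ℝ) * Complex.I)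

lemma rayPoint_ne_zero (φ : ℝ) {m : ℝ} (hm : 0 < m) : rayPoint φ m ≠ 0 := by
  refine mul_ne_zero ?_ (Complex.exp_ne_zero _)
  exact_mod_cast (by positivity : 0 < Real.pi * m ^ 2).ne'

lemma norm_rayPoint (φ m : ℝ) : ‖rayPoint φ m‖ = Real.pi * m ^ 2 := by
  rw [rayPoint, norm_mul, Complex.norm_exp_ofReal_mul_I, mul_one, Complex.norm_real,
    Real.norm_of_nonneg (by positivity)]

lemma rayPoint_re (φ m : ℝ) : (rayPoint φ m).re = Real.pi * m ^ 2 * Real.cos (2 * φ) := by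
  rw [rayPoint, Complex.re_ofReal_mul, Complex.exp_ofReal_mul_I_re]

lemma log_rayPoint {φ m : ℝ} (hφ : 0 < φ) (hφ4 : φ ≤ Real.pi / 4) (hm : 0 < m) :
    Complex.log (rayPoint φ m) =
      (Real.log Real.pi : ℂ) + 2 * (Real.log m : ℂ) + 2 * φ * Complex.I := by
  have hpi := Real.pi_pos
  rw [rayPoint, Complex.log_ofReal_mul (by positivity) (Complex.exp_ne_zero _), Complex.log_exp
    (by simp; linarith) (by simp; linarith), Real.log_mul (by positivity) (by positivity),
    Real.log_pow]
  push_cast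
  ring

lemma xiFactor_mul_cpow_mul_lineKernel {φ m : ℝ} (hφ : 0 < φ) (hφ4 : φ ≤ Real.pi / 4) (hm : 0 < m)
    (τ B t : ℝ) :
    xiFactor ((3 : ℝ) + t * Complex.I) * (1 / (m : ℂ) ^ (((3 : ℝ) : ℂ) + t * Complex.I)) *
        lineKernel φ τ B ((3 : ℝ) + t * Complex.I) =
      Complex.exp ((φ / 2 : ℝ) * Complex.I) *
        (4 * rayPoint φ m ^ 2 * (rayPoint φ m ^ (-(((7 / 2 : ℝ) : ℂ) + t / 2 * Complex.I)) *
          Complex.Gamma (((7 / 2 : ℝ) : ℂ) + t / 2 * Complex.I) * shiftedGauss τ B t) -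
        6 * rayPoint φ m * (rayPoint φ m ^ (-(((5 / 2 : ℝ) : ℂ) + t / 2 * Complex.I)) *
          Complex.Gamma (((5 / 2 : ℝ) : ℂ) + t / 2 * Complex.I) * shiftedGauss τ B t)) := by
  set w : ℂ := 3 / 2 + t / 2 * Complex.I with hw
  have hw0 : 0 < w.re := by simp [hw]
  have hs : ((3 : ℝ) : ℂ) + t * Complex.I = 2 * w := by rw [hw]; push_cast; ring
  have h7 : ((7 / 2 : ℝ) : ℂ) + t / 2 * Complex.I = w + 2 := by rw [hw]; push_cast; ring
  have h5 : ((5 / 2 : ℝ) : ℂ) + t / 2 * Complex.I = w + 1 := by rw [hw]; push_cast; ring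
  have hr := rayPoint_ne_zero φ hm
  have e2 : rayPoint φ m ^ 2 * rayPoint φ m ^ (-(w + 2)) = rayPoint φ m ^ (-w) := by
    rw [← Complex.cpow_ofNat, ← Complex.cpow_add _ _ hr]
    congr 1
    simp
  have e1 : rayPoint φ m * rayPoint φ m ^ (-(w + 1)) = rayPoint φ m ^ (-w) := by
    nth_rewrite 1 [← Complex.cpow_one (rayPoint φ m)]
    rw [← Complex.cpow_add _ _ hr]
    congr 1
    ring
  have hm' : (m : ℂ) ≠ 0 := by exact_mod_cast hm.ne'
  have hpi' : (Real.pi : ℂ) ≠ 0 := by exact_mod_cast Real.pi_pos.ne'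
  have key : (Real.pi : ℂ) ^ (-w) * (1 / (m : ℂ) ^ (2 * w)) *
      lineKernel φ τ B (2 * w) =
      Complex.exp ((φ / 2 : ℝ) * Complex.I) * rayPoint φ m ^ (-w) * shiftedGauss τ B t := by
    have hq : (2 * w - 1 / 2 - Complex.I * τ) / B = (5 / 2 + (t - τ) * Complex.I) / B := by
      rw [hw]; ring
    rw [lineKernel, shiftedGauss, hq, one_div, ← Complex.cpow_neg,
      Complex.cpow_def_of_ne_zero hpi', Complex.cpow_def_of_ne_zero hm',
      Complex.cpow_def_of_ne_zero hr, log_rayPoint hφ hφ4 hm,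
      ← Complex.ofReal_log Real.pi_pos.le, ← Complex.ofReal_log hm.le]
    simp only [← Complex.exp_add]
    congr 1
    push_cast
    ring
  rw [hs, h7, h5, xiFactor_two_mul hw0]
  calc _ = ((Real.pi : ℂ) ^ (-w) * (1 / (m : ℂ) ^ (2 * w)) * lineKernel φ τ B (2 * w)) *
        (4 * Complex.Gamma (w + 2) - 6 * Complex.Gamma (w + 1)) := by ring
    _ = Complex.exp ((φ / 2 : ℝ) * Complex.I) * (4 * (rayPoint φ m ^ (-w)) * Complex.Gamma (w + 2) -
        6 * (rayPoint φ m ^ (-w)) * Complex.Gamma (w + 1)) * shiftedGauss τ B t := by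
        rw [key]; ring
    _ = _ := by
      nth_rewrite 1 [← e2]
      rw [← e1]
      ring

lemma norm_integral_sub_le_of_le {f g : ℝ → ℂ} {c d e : ℂ} {M N : ℝ} (hf : ‖∫ t, f t‖ ≤ M)
    (hg : ‖∫ t, g t‖ ≤ N) (hfi : Integrable f) (hgi : Integrable g) :
    ‖∫ t, e * (c * f t - d * g t)‖ ≤ ‖e‖ * (‖c‖ * M + ‖d‖ * N) := by
  rw [integral_const_mul, integral_sub (hfi.const_mul c) (hgi.const_mul d), integral_const_mul,
    integral_const_mul, norm_mul]
  refine mul_le_mul_of_nonneg_left ((norm_sub_le _ _).trans ?_) (norm_nonneg _)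
  rw [norm_mul, norm_mul]
  gcongr

/-- The contribution of one term of the Dirichlet series of zeta on the line `Re s = 3`. -/
lemma norm_integral_xiFactor_term_le {T B m : ℝ} (hT : 2 ≤ T) (hB : 5 / 2 ≤ B) (hm : 1 ≤ m)
    (τ : ℝ) :
    ‖∫ t : ℝ, xiFactor ((3 : ℝ) + t * Complex.I) *
        (1 / (m : ℂ) ^ (((3 : ℝ) : ℂ) + t * Complex.I)) *
        lineKernel (Real.pi / 4 - 1 / T) τ B ((3 : ℝ) + t * Complex.I)‖ ≤
      190000 * T ^ (21 / 8 : ℝ) * m ^ (-(5 / 4) : ℝ) := by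
  have hpi := Real.pi_gt_three
  have hpi4 := Real.pi_lt_four
  have hT0 : 0 < T := by linarith
  have hm0 : 0 < m := by linarith
  have hTi : 1 / T ≤ 1 / 2 := one_div_le_one_div_of_le (by norm_num) hT
  have hTi0 : 0 < 1 / T := by positivity
  set φ : ℝ := Real.pi / 4 - 1 / T with hφ
  have hφ0 : 0 < φ := by rw [hφ]; linarith
  have hφ4 : φ ≤ Real.pi / 4 := by rw [hφ]; linarith
  simp_rw [xiFactor_mul_cpow_mul_lineKernel hφ0 hφ4 hm0]
  have hcos : 1 / T ≤ Real.cos (2 * φ) := by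
    rw [hφ, show 2 * (Real.pi / 4 - 1 / T) = Real.pi / 2 - 2 * (1 / T) by ring,
      Real.cos_pi_div_two_sub]
    have h1 := Real.mul_le_sin (x := 2 * (1 / T)) (by linarith) (by linarith)
    refine le_trans ?_ h1
    rw [show 2 / Real.pi * (2 * (1 / T)) = 4 / Real.pi * (1 / T) by ring]
    refine le_mul_of_one_le_left hTi0.le ?_
    rw [le_div_iff₀ Real.pi_pos]
    linarith
  have hre : m ^ 2 / T ≤ (rayPoint φ m).re := by
    rw [rayPoint_re]
    calc m ^ 2 / T = 1 * m ^ 2 * (1 / T) := by ring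
      _ ≤ Real.pi * m ^ 2 * Real.cos (2 * φ) := by gcongr; linarith
  have hmT : 0 < m ^ 2 / T := by positivity
  have hre0 : 0 < (rayPoint φ m).re := hmT.trans_le hre
  obtain ⟨i7, n7⟩ := norm_integral_cpow_mul_Gamma_mul_shiftedGauss_le τ hB
    (b := 7 / 2) (by norm_num) (by norm_num) hre0
  obtain ⟨i5, n5⟩ := norm_integral_cpow_mul_Gamma_mul_shiftedGauss_le τ hB
    (b := 5 / 2) (by norm_num) (by norm_num) hre0
  refine (norm_integral_sub_le_of_le n7 n5 i7 i5).trans ?_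
  rw [Complex.norm_exp_ofReal_mul_I, one_mul, norm_mul, norm_mul, norm_pow, norm_rayPoint,
    Complex.norm_ofNat, Complex.norm_ofNat]
  have hray : Real.pi * m ^ 2 ≤ 4 * m ^ 2 := by gcongr
  have hneg : ∀ a : ℝ, 0 ≤ a → (rayPoint φ m).re ^ (-a) ≤ (m ^ 2 / T) ^ (-a) := fun a ha =>
    Real.rpow_le_rpow_of_nonpos hmT hre (by linarith)
  have hsplit : ∀ a : ℝ, (m ^ 2 / T) ^ (-a) = T ^ a * m ^ (-(2 * a)) := by
    intro a
    rw [Real.div_rpow (by positivity) hT0.le, Real.rpow_neg hT0.le, div_inv_eq_mul,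
      show (m ^ 2 : ℝ) = m ^ (2 : ℝ) by norm_cast, ← Real.rpow_mul hm0.le, mul_comm]
    ring_nf
  have m7 : (m ^ 2) ^ 2 * m ^ (-(2 * (7 / 2 - 7 / 8)) : ℝ) = m ^ (-(5 / 4) : ℝ) := by
    rw [← pow_mul, ← Real.rpow_natCast, ← Real.rpow_add hm0]
    norm_num
  have m5 : m ^ 2 * m ^ (-(2 * (5 / 2 - 7 / 8)) : ℝ) = m ^ (-(5 / 4) : ℝ) := by
    rw [← Real.rpow_natCast, ← Real.rpow_add hm0]
    norm_num
  have t5 : T ^ (5 / 2 - 7 / 8 : ℝ) ≤ T ^ (21 / 8 : ℝ) :=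
    Real.rpow_le_rpow_of_exponent_le (by linarith) (by norm_num)
  calc _ ≤ 4 * (4 * m ^ 2) ^ 2 * (2016 * (m ^ 2 / T) ^ (-(7 / 2 - 7 / 8) : ℝ)) +
        6 * (4 * m ^ 2) * (2016 * (m ^ 2 / T) ^ (-(5 / 2 - 7 / 8) : ℝ)) := by
        have h7 := hneg (7 / 2 - 7 / 8) (by norm_num)
        have h5 := hneg (5 / 2 - 7 / 8) (by norm_num)
        gcongr
    _ = 129024 * T ^ (7 / 2 - 7 / 8 : ℝ) * ((m ^ 2) ^ 2 * m ^ (-(2 * (7 / 2 - 7 / 8)) : ℝ)) +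
        48384 * T ^ (5 / 2 - 7 / 8 : ℝ) * (m ^ 2 * m ^ (-(2 * (5 / 2 - 7 / 8)) : ℝ)) := by
        rw [hsplit, hsplit]; ring
    _ = 129024 * T ^ (21 / 8 : ℝ) * m ^ (-(5 / 4) : ℝ) +
        48384 * T ^ (5 / 2 - 7 / 8 : ℝ) * m ^ (-(5 / 4) : ℝ) := by
        rw [m7, m5]; norm_num
    _ ≤ 129024 * T ^ (21 / 8 : ℝ) * m ^ (-(5 / 4) : ℝ) +
        48384 * T ^ (21 / 8 : ℝ) * m ^ (-(5 / 4) : ℝ) := by gcongr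
    _ = 177408 * T ^ (21 / 8 : ℝ) * m ^ (-(5 / 4) : ℝ) := by ring
    _ ≤ _ := by gcongr; norm_num

/-- The integral of `xiLine` on the critical line, at an angle just below `π/4`. -/
theorem exists_norm_integral_xiLine_le : ∃ C, 0 < C ∧ ∀ T τ B : ℝ, 2 ≤ T → 5 / 2 ≤ B →
    ‖∫ t : ℝ, xiLine (Real.pi / 4 - 1 / T) τ B ((1 / 2 : ℝ) + t * Complex.I)‖ ≤
      C * T ^ (21 / 8 : ℝ) := by
  have hsum : Summable fun n : ℕ => ((n + 1 : ℕ) : ℝ) ^ (-(5 / 4) : ℝ) :=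
    (summable_nat_add_iff 1).2 (summable_nat_rpow_neg (by norm_num))
  have hpos : 0 < ∑' n : ℕ, ((n + 1 : ℕ) : ℝ) ^ (-(5 / 4) : ℝ) :=
    hsum.tsum_pos (fun n => by positivity) 0 (by positivity)
  refine ⟨190000 * ∑' n : ℕ, ((n + 1 : ℕ) : ℝ) ^ (-(5 / 4) : ℝ), by positivity, ?_⟩
  intro T τ B hT hB
  have hB0 : 0 < B := by linarith
  rw [(stripDecay_xiLine _ τ hB0).integral_line_eq (b := 3) (by norm_num) (by norm_num)]
  set φ : ℝ := Real.pi / 4 - 1 / T with hφ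
  set F : ℕ → ℝ → ℂ := fun n t => xiFactor ((3 : ℝ) + t * Complex.I) *
        (1 / (((n + 1 : ℕ) : ℝ) : ℂ) ^ (((3 : ℝ) : ℂ) + t * Complex.I)) *
        lineKernel φ τ B ((3 : ℝ) + t * Complex.I) with hF
  have hline : Integrable fun t : ℝ => xiFactor ((3 : ℝ) + t * Complex.I) *
      lineKernel φ τ B ((3 : ℝ) + t * Complex.I) :=
    (stripGrowth_xiFactor.mul_lineKernel φ τ hB0).integrable_line (by norm_num)
  have hterm : ∀ (n : ℕ) (t : ℝ),
      ‖1 / (((n + 1 : ℕ) : ℝ) : ℂ) ^ (((3 : ℝ) : ℂ) + t * Complex.I)‖ =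
        ((n + 1 : ℕ) : ℝ) ^ (-(3 : ℝ)) := by
    intro n t
    rw [norm_div, norm_one, Complex.norm_cpow_eq_rpow_re_of_pos (by positivity),
      Real.rpow_neg (by positivity)]
    simp
  have hFn : ∀ (n : ℕ) (t : ℝ), ‖F n t‖ = ((n + 1 : ℕ) : ℝ) ^ (-(3 : ℝ)) *
      ‖xiFactor ((3 : ℝ) + t * Complex.I) * lineKernel φ τ B ((3 : ℝ) + t * Complex.I)‖ := by
    intro n t
    simp only [hF]
    rw [norm_mul, norm_mul, hterm, norm_mul]
    ring
  have hFi : ∀ n, Integrable (F n) := by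
    intro n
    have h1 : F n = fun t : ℝ => (1 / (((n + 1 : ℕ) : ℝ) : ℂ) ^ (((3 : ℝ) : ℂ) + t * Complex.I)) *
        (xiFactor ((3 : ℝ) + t * Complex.I) * lineKernel φ τ B ((3 : ℝ) + t * Complex.I)) := by
      funext t
      simp only [hF]
      ring
    rw [h1]
    refine hline.bdd_mul (c := ((n + 1 : ℕ) : ℝ) ^ (-(3 : ℝ))) ?_
      (Filter.Eventually.of_forall fun t => (hterm n t).le)
    refine Continuous.aestronglyMeasurable ?_
    have hne : (((n + 1 : ℕ) : ℝ) : ℂ) ≠ 0 := by exact_mod_cast n.succ_ne_zero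
    refine continuous_const.div ?_ fun t h => hne ((Complex.cpow_eq_zero_iff _ _).1 h).1
    exact Continuous.const_cpow (by fun_prop) (Or.inl hne)
  have hFs : Summable fun n => ∫ t, ‖F n t‖ := by
    simp_rw [hFn, integral_const_mul]
    exact ((summable_nat_add_iff 1).2 (summable_nat_rpow_neg (by norm_num))).mul_right _
  have hxi : ∀ t : ℝ, xiLine φ τ B ((3 : ℝ) + t * Complex.I) = ∑' n, F n t := by
    intro t
    have hs1 : (3 : ℝ) + t * Complex.I ≠ 1 := by
      intro h
      have := congrArg Complex.re h
      simp at this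
    rw [xiLine, xiFun_eq (by simp) hs1, zeta_eq_tsum_one_div_nat_add_one_cpow (by simp),
      ← tsum_mul_left, ← tsum_mul_right]
    simp only [hF]
    push_cast
    rfl
  simp_rw [hxi]
  rw [← integral_tsum_of_summable_integral_norm hFi hFs]
  have hb : ∀ n, ‖∫ t, F n t‖ ≤ 190000 * T ^ (21 / 8 : ℝ) * ((n + 1 : ℕ) : ℝ) ^ (-(5 / 4) : ℝ) :=
    fun n => norm_integral_xiFactor_term_le hT hB (by
      have : (1 : ℝ) ≤ ((n + 1 : ℕ) : ℝ) := by exact_mod_cast Nat.succ_le_succ n.zero_le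
      exact this) τ
  refine (tsum_of_norm_bounded (hsum.hasSum.mul_left _) hb).trans (le_of_eq ?_)
  ring

lemma continuous_HardyZ : Continuous HardyZ := by
  have hre : ∀ t : ℝ, 0 < (1 / 4 + Complex.I * (t : ℂ) / 2).re := by intro t; simp
  have hG : Continuous fun t : ℝ => Complex.Gamma (1 / 4 + Complex.I * (t : ℂ) / 2) := by
    refine continuous_iff_continuousAt.2 fun t => ?_
    refine ContinuousAt.comp (f := fun t : ℝ => 1 / 4 + Complex.I * (t : ℂ) / 2)
      (g := Complex.Gamma) ?_ (by fun_prop)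
    refine (Complex.differentiableAt_Gamma _ fun m h => ?_).continuousAt
    have h1 := hre t
    rw [h] at h1
    simp only [Complex.neg_re, Complex.natCast_re] at h1
    have : (0 : ℝ) ≤ m := m.cast_nonneg
    linarith
  have hz : Continuous fun t : ℝ => riemannZeta (1 / 2 + Complex.I * (t : ℂ)) := by
    refine continuous_iff_continuousAt.2 fun t => ?_
    refine ContinuousAt.comp (f := fun t : ℝ => 1 / 2 + Complex.I * (t : ℂ))
      (g := riemannZeta) ?_ (by fun_prop)
    refine (differentiableAt_riemannZeta fun h => ?_).continuousAt
    have := congrArg Complex.re h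
    norm_num at this
  have hp : Continuous fun t : ℝ => (Real.pi : ℂ) ^ (-(Complex.I * (t : ℂ)) / 2) :=
    Continuous.const_cpow (by fun_prop) (Or.inl (by exact_mod_cast Real.pi_pos.ne'))
  refine Complex.continuous_re.comp (Continuous.mul (hp.mul (hG.div ?_ fun t => ?_)) hz)
  · exact Complex.continuous_ofReal.comp hG.norm
  · exact_mod_cast norm_ne_zero_iff.2 (Complex.Gamma_ne_zero_of_re_pos (hre t))

/-- The real integrand `-xiLine` on the critical line. -/
noncomputable def hardyLine (φ τ B t : ℝ) : ℝ :=
  ‖xiFactor ((1 / 2 : ℝ) + t * Complex.I)‖ * HardyZ t * (Real.exp (φ * t) * gaussWeight τ B t)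

lemma xiLine_half (φ τ B t : ℝ) :
    xiLine φ τ B ((1 / 2 : ℝ) + t * Complex.I) = ((-hardyLine φ τ B t : ℝ) : ℂ) := by
  rw [xiLine, xiFun_half, lineKernel_half, ← Complex.ofReal_mul, hardyLine]
  congr 1
  ring

lemma lineNorm_xiLine_half_eq (φ τ B : ℝ) :
    lineNorm (xiLine φ τ B) (1 / 2) = ∫ t, |hardyLine φ τ B t| := by
  unfold lineNorm
  refine integral_congr_ae (Filter.Eventually.of_forall fun t => ?_)
  simp only
  rw [xiLine_half, Complex.norm_real, norm_neg, Real.norm_eq_abs]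

lemma integrable_hardyLine (φ τ : ℝ) {B : ℝ} (hB : 0 < B) : Integrable (hardyLine φ τ B) := by
  have h := ((stripDecay_xiLine φ τ hB).integrable_line (σ := 1 / 2) (by norm_num)).re.neg
  refine h.congr (Filter.Eventually.of_forall fun t => ?_)
  simp only [Pi.neg_apply]
  rw [xiLine_half]
  simp

lemma abs_integral_hardyLine (φ τ B : ℝ) : |∫ t, hardyLine φ τ B t| =
    ‖∫ t : ℝ, xiLine φ τ B ((1 / 2 : ℝ) + t * Complex.I)‖ := by
  simp_rw [xiLine_half]
  rw [integral_complex_ofReal, integral_neg, Complex.norm_real, norm_neg, Real.norm_eq_abs]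

lemma abs_hardyLine (φ τ B t : ℝ) : |hardyLine φ τ B t| =
    ‖xiFactor ((1 / 2 : ℝ) + t * Complex.I)‖ * Real.exp (φ * t) * gaussWeight τ B t *
      |HardyZ t| := by
  rw [hardyLine, abs_mul, abs_mul, abs_of_nonneg (norm_nonneg _),
    abs_of_pos (mul_pos (Real.exp_pos _) (gaussWeight_pos _ _ _))]
  ring

lemma Iplus_eq (T : ℝ) : Iplus T = ∫ t in Set.Ioc T (2 * T), max (HardyZ t) 0 := by
  have hm : MeasurableSet {t : ℝ | 0 < HardyZ t} :=
    (isOpen_lt continuous_const continuous_HardyZ).measurableSet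
  have h1 : {t : ℝ | t ∈ Set.Ioc T (2 * T) ∧ 0 < HardyZ t} =
      Set.Ioc T (2 * T) ∩ {t : ℝ | 0 < HardyZ t} := rfl
  rw [Iplus, h1, ← setIntegral_indicator hm]
  refine integral_congr_ae (Filter.Eventually.of_forall fun t => ?_)
  simp only [Set.indicator_apply, Set.mem_ofPred_eq]
  split_ifs with h
  · exact (max_eq_left h.le).symm
  · exact (max_eq_right (not_lt.1 h)).symm

lemma integrableOn_Ioc_of_continuous {f : ℝ → ℝ} (hf : Continuous f) (a b : ℝ) :
    IntegrableOn f (Set.Ioc a b) :=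
  (hf.continuousOn.integrableOn_Icc).mono_set Set.Ioc_subset_Icc_self

theorem exists_Iplus_le : ∃ C, 0 < C ∧ ∃ T₀ : ℝ, ∀ T ≥ T₀,
    Iplus T ≤ C * T * Real.log T ^ (1 / 4 : ℝ) := by
  obtain ⟨C, hC, hJ⟩ := exists_lineNorm_xiLine_le
  obtain ⟨T₀, hT₀⟩ := hJ 1 one_pos le_rfl
  obtain ⟨c, hc, hK⟩ := exists_le_norm_xiFactor
  refine ⟨2 * C / c, by positivity, max T₀ 2, fun T hT => ?_⟩
  have hT2 : 2 ≤ T := (le_max_right _ _).trans hT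
  have hT0 : 0 < T := by linarith
  have hJT := hT₀ T ((le_max_left _ _).trans hT)
  rw [lineNorm_xiLine_half_eq, one_mul] at hJT
  have hpt : ∀ t ∈ Set.Ioc T (2 * T), c * T ^ (7 / 4 : ℝ) / 2 * max (HardyZ t) 0 ≤
      |hardyLine (Real.pi / 4) (3 / 2 * T) T t| := by
    rintro t ⟨h1, h2⟩
    rw [abs_hardyLine]
    have hk := hK (1 / 2) t le_rfl (by norm_num) (hT2.trans h1.le)
    have hk2 : c * T ^ (7 / 4 : ℝ) ≤ c * t ^ (7 / 4 : ℝ) := by gcongr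
    have hg : 1 / 2 ≤ gaussWeight (3 / 2 * T) T t := by
      have hu : ((t - 3 / 2 * T) / T) ^ 2 ≤ 1 / 4 := by
        rw [div_pow, div_le_iff₀ (by positivity)]
        nlinarith
      have h3 := Real.add_one_le_exp (-((t - 3 / 2 * T) / T) ^ 2)
      rw [gaussWeight]
      linarith
    have hz : max (HardyZ t) 0 ≤ |HardyZ t| := max_le (le_abs_self _) (abs_nonneg _)
    calc _ = c * T ^ (7 / 4 : ℝ) * (1 / 2) * max (HardyZ t) 0 := by ring
      _ ≤ _ := by
        refine mul_le_mul (mul_le_mul (hk2.trans hk) hg (by norm_num) (by positivity)) hz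
          (le_max_right _ _) ?_
        have := gaussWeight_pos (3 / 2 * T) T t
        positivity
  have h_int := (integrable_hardyLine (Real.pi / 4) (3 / 2 * T) hT0).abs
  have hle : c * T ^ (7 / 4 : ℝ) / 2 * Iplus T ≤
      ∫ t, |hardyLine (Real.pi / 4) (3 / 2 * T) T t| := by
    rw [Iplus_eq, ← integral_const_mul]
    refine (setIntegral_mono_on ?_ h_int.integrableOn measurableSet_Ioc hpt).trans
      (setIntegral_le_integral h_int (Filter.Eventually.of_forall fun t => abs_nonneg _))
    exact (integrableOn_Ioc_of_continuous (continuous_HardyZ.max continuous_const) _ _).const_mul _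
  have hTp : 0 < T ^ (7 / 4 : ℝ) := by positivity
  have h5 : c * T ^ (7 / 4 : ℝ) / 2 * Iplus T ≤ c * T ^ (7 / 4 : ℝ) / 2 *
      (2 * C / c * T * Real.log T ^ (1 / 4 : ℝ)) := by
    refine (hle.trans hJT).trans (le_of_eq ?_)
    field_simp
  exact le_of_mul_le_mul_left h5 (by positivity)

lemma hardyLine_sub (φ ψ τ B t : ℝ) :
    hardyLine (φ - ψ) τ B t = Real.exp (-(ψ * t)) * hardyLine φ τ B t := by
  rw [hardyLine, hardyLine, sub_mul, sub_eq_add_neg (φ * t), Real.exp_add]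
  ring

/-- Away from the window the narrow Gaussian is much smaller than the wide one. -/
lemma exp_mul_gaussWeight_le_of_not_mem {T δ t : ℝ} (hT : 0 < T) (hδ : 0 < δ) (hδ2 : δ ≤ 1 / 2)
    (ht : t ∉ Set.Ioc T (2 * T)) :
    Real.exp (-(1 / T * t)) * gaussWeight (3 / 2 * T) (δ * T) t ≤
        8 * δ ^ 2 * gaussWeight (3 / 2 * T) T t ∧
      gaussWeight (3 / 2 * T) (δ * T) t ≤ 8 * δ ^ 2 * gaussWeight (3 / 2 * T) T t := by
  set u : ℝ := (t - 3 / 2 * T) / T with hu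
  have htu : t = (u + 3 / 2) * T := by rw [hu]; field_simp; ring
  have hu4 : 1 / 4 ≤ u ^ 2 := by
    by_contra h
    rw [not_le] at h
    have h2 := abs_lt_of_sq_lt_sq (b := 1 / 2) (a := u) (by linarith) (by norm_num)
    obtain ⟨h3, h4⟩ := abs_lt.1 h2
    apply ht
    rw [htu]
    constructor <;> nlinarith
  have hδi : 4 ≤ 1 / δ ^ 2 := by
    rw [le_div_iff₀ (by positivity)]; nlinarith
  have h1 : gaussWeight (3 / 2 * T) (δ * T) t = Real.exp (-(u ^ 2 * (1 / δ ^ 2))) := by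
    rw [gaussWeight]
    congr 1
    rw [hu]
    field_simp
  have h2 : gaussWeight (3 / 2 * T) T t = Real.exp (-u ^ 2) := rfl
  have hE : Real.exp (u ^ 2 * (2 - 1 / δ ^ 2)) ≤ 8 * δ ^ 2 := by
    have h3 : u ^ 2 * (2 - 1 / δ ^ 2) ≤ 1 / 2 + -(1 / (4 * δ ^ 2)) := by
      have : 1 / (4 * δ ^ 2) = 1 / 4 * (1 / δ ^ 2) := by field_simp
      rw [this]
      nlinarith
    have h4 : Real.exp (1 / 2) ≤ 2 := by
      have h5 := Real.exp_one_lt_three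
      have h6 : Real.exp (1 / 2) ^ 2 = Real.exp 1 := by
        rw [← Real.exp_nat_mul]; norm_num
      nlinarith [Real.exp_pos (1 / 2)]
    have h7 : Real.exp (-(1 / (4 * δ ^ 2))) ≤ 4 * δ ^ 2 := by
      have h8 := Real.add_one_le_exp (1 / (4 * δ ^ 2))
      have h9 : 0 < 1 / (4 * δ ^ 2) := by positivity
      rw [Real.exp_neg]
      calc _ ≤ (1 / (4 * δ ^ 2))⁻¹ := inv_anti₀ h9 (by linarith)
        _ = _ := by rw [one_div, inv_inv]
    calc _ ≤ Real.exp (1 / 2 + -(1 / (4 * δ ^ 2))) := Real.exp_le_exp.2 h3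
      _ = Real.exp (1 / 2) * Real.exp (-(1 / (4 * δ ^ 2))) := Real.exp_add _ _
      _ ≤ 2 * (4 * δ ^ 2) := by gcongr
      _ = _ := by ring
  have hfin : ∀ y : ℝ, y ≤ u ^ 2 → Real.exp y * Real.exp (-(u ^ 2 * (1 / δ ^ 2))) ≤
      8 * δ ^ 2 * Real.exp (-u ^ 2) := by
    intro y hy
    calc _ = Real.exp (y + -(u ^ 2 * (1 / δ ^ 2))) := (Real.exp_add _ _).symm
      _ ≤ Real.exp (u ^ 2 * (2 - 1 / δ ^ 2) + -u ^ 2) := Real.exp_le_exp.2 (by linarith)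
      _ = Real.exp (u ^ 2 * (2 - 1 / δ ^ 2)) * Real.exp (-u ^ 2) := Real.exp_add _ _
      _ ≤ _ := mul_le_mul_of_nonneg_right hE (Real.exp_pos _).le
  rw [h1, h2]
  constructor
  · refine hfin _ ?_
    rw [show 1 / T * t = u + 3 / 2 by rw [htu]; field_simp]
    nlinarith [sq_nonneg (u + 1)]
  · have := hfin 0 (sq_nonneg u)
    rwa [Real.exp_zero, one_mul] at this

lemma abs_hardyLine_le_of_not_mem {T δ t : ℝ} (hT : 0 < T) (hδ : 0 < δ) (hδ2 : δ ≤ 1 / 2) (φ : ℝ)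
    (ht : t ∉ Set.Ioc T (2 * T)) :
    |hardyLine (φ - 1 / T) (3 / 2 * T) (δ * T) t| ≤
        8 * δ ^ 2 * |hardyLine φ (3 / 2 * T) T t| ∧
      |hardyLine φ (3 / 2 * T) (δ * T) t| ≤ 8 * δ ^ 2 * |hardyLine φ (3 / 2 * T) T t| := by
  obtain ⟨h1, h2⟩ := exp_mul_gaussWeight_le_of_not_mem hT hδ hδ2 ht
  set A : ℝ := ‖xiFactor ((1 / 2 : ℝ) + t * Complex.I)‖ * Real.exp (φ * t) * |HardyZ t| with hA
  have hA0 : 0 ≤ A := by positivity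
  constructor
  · rw [hardyLine_sub, abs_mul, Real.abs_exp, abs_hardyLine, abs_hardyLine]
    calc _ = A * (Real.exp (-(1 / T * t)) * gaussWeight (3 / 2 * T) (δ * T) t) := by
          rw [hA]; ring
      _ ≤ A * (8 * δ ^ 2 * gaussWeight (3 / 2 * T) T t) := mul_le_mul_of_nonneg_left h1 hA0
      _ = _ := by rw [hA]; ring
  · rw [abs_hardyLine, abs_hardyLine]
    calc _ = A * gaussWeight (3 / 2 * T) (δ * T) t := by rw [hA]; ring
      _ ≤ A * (8 * δ ^ 2 * gaussWeight (3 / 2 * T) T t) := mul_le_mul_of_nonneg_left h2 hA0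
      _ = _ := by rw [hA]; ring

lemma setIntegral_compl_le_of_le {f g : ℝ → ℝ} {S : Set ℝ} (hS : MeasurableSet S)
    (hf : Integrable f) (hg : Integrable g) (h0 : ∀ t, 0 ≤ g t) (h : ∀ t ∉ S, f t ≤ g t) :
    ∫ t in Sᶜ, f t ≤ ∫ t, g t :=
  (setIntegral_mono_on hf.integrableOn hg.integrableOn hS.compl h).trans
    (setIntegral_le_integral hg (Filter.Eventually.of_forall h0))

lemma two_mul_setIntegral_max_zero {f : ℝ → ℝ} {S : Set ℝ} (hf : IntegrableOn f S) :
    2 * ∫ t in S, max (f t) 0 = (∫ t in S, |f t|) + ∫ t in S, f t := by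
  rw [← integral_add hf.abs hf, ← integral_const_mul]
  refine integral_congr_ae (Filter.Eventually.of_forall fun t => ?_)
  simp only
  rcases le_total (f t) 0 with h | h
  · rw [max_eq_right h, abs_of_nonpos h]; ring
  · rw [max_eq_left h, abs_of_nonneg h]; ring

/-- The positive part of the integrand on the window, from below. -/
lemma le_setIntegral_max_hardyLine {T δ : ℝ} (hT : 0 < T) (hδ : 0 < δ) (hδ2 : δ ≤ 1 / 2) (φ : ℝ) :
    Real.exp (-2) * (∫ t, |hardyLine φ (3 / 2 * T) (δ * T) t|) -
        16 * δ ^ 2 * (∫ t, |hardyLine φ (3 / 2 * T) T t|) -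
        |∫ t, hardyLine (φ - 1 / T) (3 / 2 * T) (δ * T) t| ≤
      2 * ∫ t in Set.Ioc T (2 * T), max (hardyLine (φ - 1 / T) (3 / 2 * T) (δ * T) t) 0 := by
  have hB : 0 < δ * T := by positivity
  set S := Set.Ioc T (2 * T) with hSdef
  have hS : MeasurableSet S := measurableSet_Ioc
  set X := hardyLine (φ - 1 / T) (3 / 2 * T) (δ * T) with hX
  set X₀ := hardyLine φ (3 / 2 * T) (δ * T) with hX₀
  set H := hardyLine φ (3 / 2 * T) T with hH
  have iX : Integrable X := integrable_hardyLine _ _ hB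
  have iX₀ : Integrable X₀ := integrable_hardyLine _ _ hB
  have iH : Integrable H := integrable_hardyLine _ _ hT
  have iH' : Integrable fun t => 8 * δ ^ 2 * |H t| := iH.abs.const_mul _
  have hH0 : ∀ t, 0 ≤ 8 * δ ^ 2 * |H t| := fun t => by positivity
  have t1 : ∫ t in Sᶜ, |X t| ≤ 8 * δ ^ 2 * ∫ t, |H t| := by
    rw [← integral_const_mul]
    exact setIntegral_compl_le_of_le hS iX.abs iH' hH0 fun t ht =>
      (abs_hardyLine_le_of_not_mem hT hδ hδ2 φ ht).1
  have t0 : ∫ t in Sᶜ, |X₀ t| ≤ 8 * δ ^ 2 * ∫ t, |H t| := by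
    rw [← integral_const_mul]
    exact setIntegral_compl_le_of_le hS iX₀.abs iH' hH0 fun t ht =>
      (abs_hardyLine_le_of_not_mem hT hδ hδ2 φ ht).2
  have hin : Real.exp (-2) * ∫ t in S, |X₀ t| ≤ ∫ t in S, |X t| := by
    rw [← integral_const_mul]
    refine setIntegral_mono_on (iX₀.abs.const_mul _).integrableOn iX.abs.integrableOn hS
      fun t ht => ?_
    rw [hX, hardyLine_sub, abs_mul, Real.abs_exp]
    refine mul_le_mul_of_nonneg_right (Real.exp_le_exp.2 ?_) (abs_nonneg _)
    have : 1 / T * t ≤ 2 := by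
      rw [one_div, inv_mul_le_iff₀ hT, mul_comm]
      exact ht.2
    linarith
  have s0 := integral_add_compl hS iX₀.abs
  have s1 := integral_add_compl hS iX
  have a1 : |∫ t in Sᶜ, X t| ≤ ∫ t in Sᶜ, |X t| := abs_integral_le_integral_abs
  rw [two_mul_setIntegral_max_zero iX.integrableOn]
  have he1 : Real.exp (-2) ≤ 1 := Real.exp_le_one_iff.2 (by norm_num)
  have he0 := Real.exp_pos (-2)
  have b1 := neg_abs_le (∫ t, X t)
  have b2 := le_abs_self (∫ t in Sᶜ, X t)
  have hHI : 0 ≤ 8 * δ ^ 2 * ∫ t, |H t| :=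
    mul_nonneg (by positivity) (integral_nonneg fun t => abs_nonneg _)
  have b3 : Real.exp (-2) * ∫ t in Sᶜ, |X₀ t| ≤ 8 * δ ^ 2 * ∫ t, |H t| :=
    (mul_le_mul_of_nonneg_left t0 he0.le).trans (mul_le_of_le_one_left hHI he1)
  rw [← s0, mul_add]
  linarith

lemma exists_setIntegral_max_hardyLine_le : ∃ C, 0 < C ∧ ∀ T δ : ℝ, 1 ≤ T →
    ∫ t in Set.Ioc T (2 * T), max (hardyLine (Real.pi / 4 - 1 / T) (3 / 2 * T) (δ * T) t) 0 ≤
      C * T ^ (7 / 4 : ℝ) * Iplus T := by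
  obtain ⟨C, hC, hK⟩ := exists_norm_xiFactor_half_le
  refine ⟨C * 3 ^ (7 / 4 : ℝ), by positivity, fun T δ hT => ?_⟩
  have hT0 : 0 < T := by linarith
  rw [Iplus_eq, ← integral_const_mul]
  refine integral_mono_of_nonneg (Filter.Eventually.of_forall fun t => le_max_right _ _) ?_ ?_
  · exact (integrableOn_Ioc_of_continuous (continuous_HardyZ.max continuous_const) _ _).const_mul _
  · refine (ae_restrict_iff' measurableSet_Ioc).2 (Filter.Eventually.of_forall fun t ht => ?_)
    obtain ⟨h1, h2⟩ := ht
    have ht0 : 0 < t := hT0.trans h1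
    have hk := hK t
    have hk2 : (1 + |t|) ^ (7 / 4 : ℝ) ≤ 3 ^ (7 / 4 : ℝ) * T ^ (7 / 4 : ℝ) := by
      rw [← Real.mul_rpow (by norm_num) hT0.le, abs_of_pos ht0]
      exact Real.rpow_le_rpow (by linarith) (by linarith) (by norm_num)
    set A : ℝ := ‖xiFactor ((1 / 2 : ℝ) + t * Complex.I)‖ * Real.exp (Real.pi / 4 * t) *
      (Real.exp (-(1 / T * t)) * gaussWeight (3 / 2 * T) (δ * T) t) with hA
    have hg := gaussWeight_pos (3 / 2 * T) (δ * T) t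
    have hA0 : 0 ≤ A := by positivity
    have hle : A ≤ C * 3 ^ (7 / 4 : ℝ) * T ^ (7 / 4 : ℝ) := by
      have h3 : Real.exp (-(1 / T * t)) * gaussWeight (3 / 2 * T) (δ * T) t ≤ 1 :=
        mul_le_one₀ (Real.exp_le_one_iff.2 (by
          have : 0 < 1 / T * t := by positivity
          linarith)) hg.le (gaussWeight_le_one _ _ _)
      calc A ≤ C * (1 + |t|) ^ (7 / 4 : ℝ) * 1 := mul_le_mul hk h3 (by positivity) (by positivity)
        _ ≤ C * (3 ^ (7 / 4 : ℝ) * T ^ (7 / 4 : ℝ)) := by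
          rw [mul_one]; exact mul_le_mul_of_nonneg_left hk2 hC.le
        _ = _ := by ring
    have hX : hardyLine (Real.pi / 4 - 1 / T) (3 / 2 * T) (δ * T) t = A * HardyZ t := by
      rw [hardyLine_sub, hardyLine, hA]; ring
    simp only
    rw [hX]
    refine max_le ?_ (mul_nonneg (by positivity) (le_max_right _ _))
    calc A * HardyZ t ≤ A * max (HardyZ t) 0 := mul_le_mul_of_nonneg_left (le_max_left _ _) hA0
      _ ≤ _ := mul_le_mul_of_nonneg_right hle (le_max_right _ _)

theorem exists_le_Iplus : ∃ c, 0 < c ∧ ∃ T₀ : ℝ, ∀ T ≥ T₀,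
    c * T * Real.log T ^ (1 / 4 : ℝ) ≤ Iplus T := by
  obtain ⟨C₁, hC₁, hup⟩ := exists_lineNorm_xiLine_le
  obtain ⟨T₁, hT₁⟩ := hup 1 one_pos le_rfl
  obtain ⟨c, hc, hlow⟩ := exists_le_lineNorm_xiLine
  obtain ⟨C₂, hC₂, h_int⟩ := exists_norm_integral_xiLine_le
  obtain ⟨C₃, hC₃, hpos⟩ := exists_setIntegral_max_hardyLine_le
  have he := Real.exp_pos (-2)
  set k : ℝ := Real.exp (-2) * c with hk
  have hk0 : 0 < k := by positivity
  set δ : ℝ := min (1 / 4) (k / (64 * C₁)) with hδdef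
  have hδ : 0 < δ := by positivity
  have hδ4 : δ ≤ 1 / 4 := min_le_left _ _
  have hδk : 16 * δ * C₁ ≤ k / 4 := by
    have : δ ≤ k / (64 * C₁) := min_le_right _ _
    rw [le_div_iff₀ (by positivity)] at this
    linarith
  obtain ⟨T₂, hT₂⟩ := hlow δ hδ hδ4
  have htend : Filter.Tendsto (fun T : ℝ => T ^ (1 / 8 : ℝ)) Filter.atTop Filter.atTop :=
    tendsto_rpow_atTop (by norm_num)
  obtain ⟨T₃, hT₃⟩ := Filter.eventually_atTop.1 (htend.eventually_ge_atTop (4 * C₂ / (k * δ)))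
  refine ⟨k * δ / (4 * C₃), by positivity,
    max (max T₁ T₂) (max T₃ (max 3 (5 / 2 / δ))), fun T hT => ?_⟩
  simp only [ge_iff_le, max_le_iff] at hT
  obtain ⟨⟨h1, h2⟩, h3, h4, h5⟩ := hT
  have hT0 : 0 < T := by linarith
  have hB : 5 / 2 ≤ δ * T := by
    rw [div_le_iff₀ hδ] at h5; linarith
  have hJ := hT₁ T h1
  have hL := hT₂ T h2
  have h8 := hT₃ T h3
  have hI := h_int T (3 / 2 * T) (δ * T) (by linarith) hB
  have hP := hpos T δ (by linarith)
  have hS := le_setIntegral_max_hardyLine hT0 hδ (by linarith) (Real.pi / 4)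
  rw [lineNorm_xiLine_half_eq] at hJ hL
  rw [one_mul] at hJ
  rw [← abs_integral_hardyLine] at hI
  have hlog : 1 ≤ Real.log T ^ (1 / 4 : ℝ) := by
    refine Real.one_le_rpow ?_ (by norm_num)
    rw [Real.le_log_iff_exp_le hT0]
    linarith [Real.exp_one_lt_three]
  set L : ℝ := Real.log T ^ (1 / 4 : ℝ) with hLdef
  have hTp : 0 < T ^ (7 / 4 : ℝ) := by positivity
  set M : ℝ := T ^ (7 / 4 : ℝ) * T * L with hM
  have hM0 : 0 < M := by positivity
  have hIM : C₂ * T ^ (21 / 8 : ℝ) ≤ k * δ / 4 * M := by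
    rw [div_le_iff₀ (by positivity)] at h8
    have h9 : T ^ (21 / 8 : ℝ) * T ^ (1 / 8 : ℝ) = T ^ (7 / 4 : ℝ) * T := by
      rw [← Real.rpow_add hT0]
      nth_rewrite 3 [← Real.rpow_one T]
      rw [← Real.rpow_add hT0]
      norm_num
    have h10 : T ^ (7 / 4 : ℝ) * T ≤ M := le_mul_of_one_le_right (by positivity) hlog
    calc C₂ * T ^ (21 / 8 : ℝ) = (4 * C₂) * T ^ (21 / 8 : ℝ) / 4 := by ring
      _ ≤ (T ^ (1 / 8 : ℝ) * (k * δ)) * T ^ (21 / 8 : ℝ) / 4 := by gcongr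
      _ = k * δ / 4 * (T ^ (21 / 8 : ℝ) * T ^ (1 / 8 : ℝ)) := by ring
      _ ≤ _ := by rw [h9]; exact mul_le_mul_of_nonneg_left h10 (by positivity)
  have hJM : 16 * δ ^ 2 * (∫ t, |hardyLine (Real.pi / 4) (3 / 2 * T) T t|) ≤ k * δ / 4 * M := by
    calc _ ≤ 16 * δ ^ 2 * (C₁ * (T ^ (7 / 4 : ℝ) * T) * L) :=
          mul_le_mul_of_nonneg_left hJ (by positivity)
      _ = 16 * δ * C₁ * (δ * M) := by rw [hM]; ring
      _ ≤ k / 4 * (δ * M) := mul_le_mul_of_nonneg_right hδk (by positivity)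
      _ = _ := by ring
  have hLM : k * δ * M ≤
      Real.exp (-2) * ∫ t, |hardyLine (Real.pi / 4) (3 / 2 * T) (δ * T) t| := by
    calc _ = Real.exp (-2) * (c * (T ^ (7 / 4 : ℝ) * (δ * T)) * L) := by rw [hM, hk]; ring
      _ ≤ _ := mul_le_mul_of_nonneg_left hL he.le
  have hfin : k * δ / 4 * M ≤ C₃ * T ^ (7 / 4 : ℝ) * Iplus T := by linarith
  have h11 : C₃ * T ^ (7 / 4 : ℝ) * (k * δ / (4 * C₃) * T * L) ≤
      C₃ * T ^ (7 / 4 : ℝ) * Iplus T := by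
    refine le_trans (le_of_eq ?_) hfin
    rw [hM]
    field_simp
  exact le_of_mul_le_mul_left h11 (by positivity)

theorem Iplus_exact_order :
    ∃ c₁ c₂ T₀ : ℝ, 0 < c₁ ∧ c₁ ≤ c₂ ∧ ∀ T ≥ T₀,
      c₁ * T * (Real.log T) ^ ((1 : ℝ) / 4) ≤ Iplus T ∧
        Iplus T ≤ c₂ * T * (Real.log T) ^ ((1 : ℝ) / 4) := by
  obtain ⟨c, hc, T₁, h1⟩ := exists_le_Iplus
  obtain ⟨C, hC, T₂, h2⟩ := exists_Iplus_le
  refine ⟨c, max c C, max T₁ (max T₂ 1), hc, le_max_left _ _, fun T hT => ?_⟩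
  simp only [ge_iff_le, max_le_iff] at hT
  obtain ⟨h3, h4, h5⟩ := hT
  refine ⟨h1 T h3, (h2 T h4).trans ?_⟩
  have : 0 ≤ Real.log T ^ (1 / 4 : ℝ) := Real.rpow_nonneg (Real.log_nonneg h5) _
  gcongr
  exact le_max_right _ _
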